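/- arXiv:2605.18644 — 11 statements merged into one kernel-verified Lean document; each statement's English description precedes it below -/
import Mathlib

section
/- Let m_1, ..., m_n be pairwise distinct integers, each greater than 1, such that lcm(m_1, ..., m_n) = 2^a·3^b·5^c for some nonnegative integers a, b, c, and write L = lcm(m_1, ..., m_n). Let C be a system of congruences x ≡ r_i (mod m_i) for i = 1, ..., n, where r_1, ..., r_n are arbitrary integers. Then the number of residues x ∈ {0, 1, ..., L−1} that satisfy at least one congruence of C is at most L·( Σ_i 1/m_i − Σ_{i<j, gcd(m_i,m_j)=1} 1/(m_i·m_j) + Σ_{i<j<k, m_i,m_j,m_k pairwise coprime} 1/(m_i·m_j·m_k) ). In particular, if this upper bound is less than L, then C does not cover all the integers. -/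
open Finset

open Classical in
/-- The proportion of the integers `0, …, M - 1` that satisfy `P`. -/
noncomputable def rangeDensity (P : ℕ → Prop) (M : ℕ) : ℚ :=
  (((range M).filter P).card : ℚ) / M

section RangeDensity

variable {P Q : ℕ → Prop} {M A B : ℕ}

theorem rangeDensity_eq_card_div [DecidablePred P] :
    rangeDensity P M = (((range M).filter P).card : ℚ) / M := by
  unfold rangeDensity
  congr!

theorem rangeDensity_mono (h : ∀ x, P x → Q x) : rangeDensity P M ≤ rangeDensity Q M := by
  classical
  simp only [rangeDensity_eq_card_div]
  gcongr
  exact h _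

theorem rangeDensity_not (hM : 0 < M) :
    rangeDensity (fun x => ¬ P x) M = 1 - rangeDensity P M := by
  classical
  have h := card_filter_add_card_filter_not (s := range M) P
  rw [card_range] at h
  have hM' : (M : ℚ) ≠ 0 := by positivity
  have h' := congrArg (Nat.cast : ℕ → ℚ) h
  push_cast at h'
  simp only [rangeDensity_eq_card_div]
  field_simp
  linarith

theorem rangeDensity_le_one : rangeDensity P M ≤ 1 := by
  classical
  simp only [rangeDensity_eq_card_div]
  apply div_le_one_of_le₀ _ (Nat.cast_nonneg _)
  exact_mod_cast (card_filter_le _ _).trans (card_range M).le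

theorem rangeDensity_or_le :
    rangeDensity (fun x => P x ∨ Q x) M ≤ rangeDensity P M + rangeDensity Q M := by
  classical
  simp only [rangeDensity_eq_card_div]
  rw [← add_div, filter_or]
  gcongr
  exact_mod_cast card_union_le _ _

theorem rangeDensity_exists_le {ι : Type*} (T : Finset ι) (R : ι → ℕ → Prop) :
    rangeDensity (fun x => ∃ n ∈ T, R n x) M ≤ ∑ n ∈ T, rangeDensity (R n) M := by
  classical
  simp only [rangeDensity_eq_card_div]
  rw [← sum_div]
  gcongr
  have h : (range M).filter (fun x => ∃ n ∈ T, R n x) =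
      T.biUnion fun n => (range M).filter (R n) := by
    ext x; simp only [mem_filter, mem_biUnion]; tauto
  rw [h]
  exact_mod_cast card_biUnion_le

/-- Periodic conditions with coprime periods are independent. -/
theorem rangeDensity_and (hAB : A.Coprime B) (hA : 0 < A) (hB : 0 < B)
    (hP : ∀ x y, x ≡ y [MOD A] → (P x ↔ P y)) (hQ : ∀ x y, x ≡ y [MOD B] → (Q x ↔ Q y)) :
    rangeDensity (fun x => P x ∧ Q x) (A * B) = rangeDensity P A * rangeDensity Q B := by
  classical
  simp only [rangeDensity_eq_card_div]
  rw [div_mul_div_comm, ← Nat.cast_mul, ← Nat.cast_mul, ← card_product]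
  congr 2
  refine card_bij (fun x _ => (x % A, x % B)) ?_ ?_ ?_
  · intro x hx
    simp only [mem_filter, mem_range, mem_product] at hx ⊢
    exact ⟨⟨Nat.mod_lt _ hA, (hP _ _ (Nat.mod_modEq x A)).2 hx.2.1⟩,
      Nat.mod_lt _ hB, (hQ _ _ (Nat.mod_modEq x B)).2 hx.2.2⟩
  · intro x hx y hy hxy
    simp only [mem_filter, mem_range, Prod.mk.injEq] at hx hy hxy
    exact Nat.ModEq.eq_of_lt_of_lt ((Nat.modEq_and_modEq_iff_modEq_mul hAB).1 hxy) hx.1 hy.1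
  · rintro ⟨u, v⟩ huv
    simp only [mem_filter, mem_range, mem_product] at huv
    obtain ⟨⟨hu, hPu⟩, hv, hQv⟩ := huv
    obtain ⟨hzu, hzv⟩ := (Nat.chineseRemainder hAB u v).2
    refine ⟨(Nat.chineseRemainder hAB u v : ℕ), ?_, ?_⟩
    · simp only [mem_filter, mem_range]
      exact ⟨Nat.chineseRemainder_lt_mul hAB u v hA.ne' hB.ne',
        (hP _ _ hzu).2 hPu, (hQ _ _ hzv).2 hQv⟩
    · exact Prod.ext (Nat.mod_eq_of_modEq hzu hu) (Nat.mod_eq_of_modEq hzv hv)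

theorem rangeDensity_modEq {n : ℕ} (hn : n ∣ M) (hM : 0 < M) (r : ℤ) :
    rangeDensity (fun x => (x : ℤ) ≡ r [ZMOD (n : ℤ)]) M = 1 / n := by
  classical
  have hn0 : 0 < n := Nat.pos_of_dvd_of_pos hn hM
  have hr : ((r % n).toNat : ℤ) = r % n :=
    Int.toNat_of_nonneg (Int.emod_nonneg _ (by positivity))
  have h : (fun x : ℕ => (x : ℤ) ≡ r [ZMOD (n : ℤ)]) =
      fun x => x ≡ (r % n).toNat [MOD n] := by
    funext x
    rw [← Int.natCast_modEq_iff, hr]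
    simp [Int.ModEq]
  obtain ⟨k, rfl⟩ := hn
  have hk : 0 < k := Nat.pos_of_mul_pos_left hM
  simp only [rangeDensity_eq_card_div]
  rw [funext_iff] at h
  simp only [h, ← Nat.count_eq_card_filter_range, Nat.count_modEq_card _ hn0]
  have : (n : ℚ) ≠ 0 := by positivity
  have : (k : ℚ) ≠ 0 := by positivity
  simp [hn0]
  field_simp

end RangeDensity

theorem modEq_iff_of_dvd {n A x y : ℕ} {r : ℤ} (hn : n ∣ A) (h : x ≡ y [MOD A]) :
    (x : ℤ) ≡ r [ZMOD (n : ℤ)] ↔ (y : ℤ) ≡ r [ZMOD (n : ℤ)] := by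
  have h' := Int.natCast_modEq_iff.2 (h.of_dvd hn)
  exact ⟨fun hx => h'.symm.trans hx, fun hy => h'.trans hy⟩

/-- No congruence with modulus in `T` holds at `x`. -/
def Avoids (T : Finset ℕ) (r : ℕ → ℤ) (x : ℕ) : Prop :=
  ¬ ∃ n ∈ T, (x : ℤ) ≡ r n [ZMOD (n : ℤ)]

theorem avoids_iff_of_modEq {T : Finset ℕ} {r : ℕ → ℤ} {A x y : ℕ} (hT : ∀ n ∈ T, n ∣ A)
    (h : x ≡ y [MOD A]) : Avoids T r x ↔ Avoids T r y :=
  not_congr <| exists_congr fun n => and_congr_right fun hn => modEq_iff_of_dvd (hT n hn) h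

theorem one_sub_sum_le_rangeDensity_avoids {T : Finset ℕ} {r : ℕ → ℤ} {A : ℕ}
    (hA : 0 < A) (hT : ∀ n ∈ T, n ∣ A) :
    1 - ∑ n ∈ T, (1 : ℚ) / n ≤ rangeDensity (Avoids T r) A := by
  unfold Avoids
  rw [rangeDensity_not hA]
  refine sub_le_sub_left ((rangeDensity_exists_le _ _).trans_eq ?_) _
  exact sum_congr rfl fun n hn => rangeDensity_modEq (hT n hn) hA _

theorem rangeDensity_exists_and_avoids_le {T U : Finset ℕ} {r : ℕ → ℤ} {A B : ℕ}
    (hA : 0 < A) (hB : 0 < B) (hAB : A.Coprime B) (hT : ∀ n ∈ T, n ∣ A) (hU : ∀ n ∈ U, n ∣ B) :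
    rangeDensity (fun x => ∃ n ∈ T, (x : ℤ) ≡ r n [ZMOD (n : ℤ)] ∧ Avoids U r x) (A * B) ≤
      (∑ n ∈ T, (1 : ℚ) / n) * rangeDensity (Avoids U r) B := by
  refine (rangeDensity_exists_le _ _).trans_eq ?_
  rw [sum_mul]
  refine sum_congr rfl fun n hn => ?_
  rw [rangeDensity_and hAB hA hB (fun x y h => modEq_iff_of_dvd (hT n hn) h)
    (fun x y h => avoids_iff_of_modEq hU h), rangeDensity_modEq (hT n hn) hA]

/-- Capped at `1`, the expression `1 - x * y * z + p * z + q * y + s * x` does not decrease when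
the nonnegative factors `x`, `y`, `z` are replaced by smaller ones. -/
theorem min_one_le_of_factors {X Y Z x y z p q s : ℚ} (hX : 0 ≤ X) (hY : 0 ≤ Y) (hZ : 0 ≤ Z)
    (hx : X ≤ x) (hy : Y ≤ y) (hz : Z ≤ z) (hp : 0 ≤ p) (hq : 0 ≤ q) (hs : 0 ≤ s) :
    min 1 (1 - x * y * z + p * z + q * y + s * x) ≤
      1 - X * Y * Z + p * Z + q * Y + s * X := by
  by_cases h : 1 ≤ 1 - X * Y * Z + p * Z + q * Y + s * X
  · exact (min_le_left _ _).trans h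
  refine (min_le_right _ _).trans ?_
  push Not at h
  have hpZ := mul_nonneg hp hZ
  have hqY := mul_nonneg hq hY
  have hsX := mul_nonneg hs hX
  have hp' : p ≤ X * Y := by
    by_contra! hc
    nlinarith [mul_le_mul_of_nonneg_right hc.le hZ]
  have hq' : q ≤ X * Z := by
    by_contra! hc
    nlinarith [mul_le_mul_of_nonneg_right hc.le hY]
  have hs' : s ≤ Y * Z := by
    by_contra! hc
    nlinarith [mul_le_mul_of_nonneg_right hc.le hX]
  have h1 : s * (x - X) ≤ y * z * (x - X) :=
    mul_le_mul_of_nonneg_right (hs'.trans (mul_le_mul hy hz hZ (hY.trans hy))) (by linarith)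
  have h2 : q * (y - Y) ≤ X * z * (y - Y) :=
    mul_le_mul_of_nonneg_right (hq'.trans (mul_le_mul_of_nonneg_left hz hX)) (by linarith)
  have h3 : p * (z - Z) ≤ X * Y * (z - Z) :=
    mul_le_mul_of_nonneg_right hp' (by linarith)
  linarith

/-- The density bound for moduli sorted by which of three pairwise coprime factors of the period
they meet. -/
theorem rangeDensity_covered_le {r : ℕ → ℤ} {A B C : ℕ} (hA : 0 < A) (hB : 0 < B) (hC : 0 < C)
    (hAB : A.Coprime B) (hAC : A.Coprime C) (hBC : B.Coprime C)
    {S T₁ T₂ T₃ T₁₂ T₁₃ T₂₃ T : Finset ℕ}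
    (hS : ∀ n ∈ S, n ∈ T₁ ∨ n ∈ T₂ ∨ n ∈ T₃ ∨ n ∈ T₁₂ ∨ n ∈ T₁₃ ∨ n ∈ T₂₃ ∨ n ∈ T)
    (h₁ : ∀ n ∈ T₁, n ∣ A) (h₂ : ∀ n ∈ T₂, n ∣ B) (h₃ : ∀ n ∈ T₃, n ∣ C)
    (h₁₂ : ∀ n ∈ T₁₂, n ∣ A * B) (h₁₃ : ∀ n ∈ T₁₃, n ∣ A * C) (h₂₃ : ∀ n ∈ T₂₃, n ∣ B * C)
    (h : ∀ n ∈ T, n ∣ A * B * C)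
    (hs₁ : ∑ n ∈ T₁, (1 : ℚ) / n ≤ 1) (hs₂ : ∑ n ∈ T₂, (1 : ℚ) / n ≤ 1)
    (hs₃ : ∑ n ∈ T₃, (1 : ℚ) / n ≤ 1) :
    rangeDensity (fun x => ∃ n ∈ S, (x : ℤ) ≡ r n [ZMOD (n : ℤ)]) (A * B * C) ≤
      1 - (1 - ∑ n ∈ T₁, (1 : ℚ) / n) * (1 - ∑ n ∈ T₂, (1 : ℚ) / n) *
          (1 - ∑ n ∈ T₃, (1 : ℚ) / n)
        + (∑ n ∈ T₁₂, (1 : ℚ) / n) * (1 - ∑ n ∈ T₃, (1 : ℚ) / n)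
        + (∑ n ∈ T₁₃, (1 : ℚ) / n) * (1 - ∑ n ∈ T₂, (1 : ℚ) / n)
        + (∑ n ∈ T₂₃, (1 : ℚ) / n) * (1 - ∑ n ∈ T₁, (1 : ℚ) / n)
        + ∑ n ∈ T, (1 : ℚ) / n := by
  have hpos : 0 < A * B * C := by positivity
  have hsum (U : Finset ℕ) : 0 ≤ ∑ n ∈ U, (1 : ℚ) / n := sum_nonneg fun _ _ => by positivity
  have hmin := min_one_le_of_factors (sub_nonneg.2 hs₁) (sub_nonneg.2 hs₂) (sub_nonneg.2 hs₃)
    (one_sub_sum_le_rangeDensity_avoids (r := r) hA h₁)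
    (one_sub_sum_le_rangeDensity_avoids (r := r) hB h₂)
    (one_sub_sum_le_rangeDensity_avoids (r := r) hC h₃) (hsum T₁₂) (hsum T₁₃) (hsum T₂₃)
  refine le_trans ?_ (add_le_add_left hmin _)
  rw [← min_add_add_right]
  refine le_min (rangeDensity_le_one.trans (by linarith [hsum T])) ?_
  have e₁ : rangeDensity (fun x => ¬ ((Avoids T₁ r x ∧ Avoids T₂ r x) ∧ Avoids T₃ r x))
      (A * B * C) = 1 - rangeDensity (Avoids T₁ r) A * rangeDensity (Avoids T₂ r) B *
        rangeDensity (Avoids T₃ r) C := by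
    rw [rangeDensity_not hpos, rangeDensity_and (Nat.Coprime.mul_left hAC hBC) (by positivity) hC
      _ (fun x y => avoids_iff_of_modEq h₃), rangeDensity_and hAB hA hB
      (fun x y => avoids_iff_of_modEq h₁) (fun x y => avoids_iff_of_modEq h₂)]
    intro x y hxy
    exact and_congr (avoids_iff_of_modEq h₁ (hxy.of_mul_right _))
      (avoids_iff_of_modEq h₂ (hxy.of_mul_left _))
  have e₁₂ := rangeDensity_exists_and_avoids_le (r := r) (by positivity) hC
    (Nat.Coprime.mul_left hAC hBC) h₁₂ h₃
  have e₁₃ := rangeDensity_exists_and_avoids_le (r := r) (by positivity) hB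
    (Nat.Coprime.mul_left hAB hBC.symm) h₁₃ h₂
  have e₂₃ := rangeDensity_exists_and_avoids_le (r := r) (by positivity) hA
    (Nat.Coprime.mul_left hAB.symm hAC.symm) h₂₃ h₁
  rw [mul_right_comm A C B] at e₁₃
  rw [mul_comm (B * C) A, ← mul_assoc] at e₂₃
  have e : rangeDensity (fun x => ∃ n ∈ T, (x : ℤ) ≡ r n [ZMOD (n : ℤ)]) (A * B * C) ≤
      ∑ n ∈ T, (1 : ℚ) / n :=
    (rangeDensity_exists_le _ _).trans_eq
      (sum_congr rfl fun n hn => rangeDensity_modEq (h n hn) hpos _)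
  refine le_trans ?_ (add_le_add (add_le_add (add_le_add (add_le_add e₁.le e₁₂) e₁₃) e₂₃) e)
  refine le_trans (rangeDensity_mono ?_) (rangeDensity_or_le.trans (add_le_add_left
    (rangeDensity_or_le.trans (add_le_add_left (rangeDensity_or_le.trans (add_le_add_left
      rangeDensity_or_le _)) _)) _))
  rintro x ⟨n, hn, hx⟩
  have hbad {U : Finset ℕ} (hU : n ∈ U) : ¬ Avoids U r x := fun hav => hav ⟨n, hU, hx⟩
  rcases hS n hn with hn | hn | hn | hn | hn | hn | hn
  · have := hbad hn; tauto
  · have := hbad hn; tauto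
  · have := hbad hn; tauto
  · by_cases hav : Avoids T₃ r x
    · exact .inl <| .inl <| .inl <| .inr ⟨n, hn, hx, hav⟩
    · tauto
  · by_cases hav : Avoids T₂ r x
    · exact .inl <| .inl <| .inr ⟨n, hn, hx, hav⟩
    · tauto
  · by_cases hav : Avoids T₁ r x
    · exact .inl <| .inr ⟨n, hn, hx, hav⟩
    · tauto
  · exact .inr ⟨n, hn, hx⟩

theorem sum_one_div_le_one_of_dvd_prime_pow {p k : ℕ} (hp : p.Prime) {T : Finset ℕ}
    (hT : ∀ n ∈ T, n ∣ p ^ k ∧ 1 < n) : ∑ n ∈ T, (1 : ℚ) / n ≤ 1 := by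
  have hsub : T ⊆ (range k).image fun i => p ^ (i + 1) := by
    intro n hn
    obtain ⟨hd, h1⟩ := hT n hn
    obtain ⟨i, hi, rfl⟩ := (Nat.dvd_prime_pow hp).1 hd
    obtain _ | i := i
    · simp at h1
    · exact mem_image.2 ⟨i, mem_range.2 (by omega), rfl⟩
  have hgeom (m : ℕ) : ∑ i ∈ range m, (1 : ℚ) / 2 ^ (i + 1) = 1 - 1 / 2 ^ m := by
    induction m with
    | zero => simp
    | succ m ih => rw [sum_range_succ, ih, pow_succ]; field_simp; ring
  calc ∑ n ∈ T, (1 : ℚ) / n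
      ≤ ∑ n ∈ (range k).image fun i => p ^ (i + 1), (1 : ℚ) / n :=
        sum_le_sum_of_subset_of_nonneg hsub fun _ _ _ => by positivity
    _ = ∑ i ∈ range k, (1 : ℚ) / ((p ^ (i + 1) : ℕ) : ℚ) :=
        sum_image fun i _ j _ hij => by
          have := Nat.pow_right_injective hp.two_le hij
          omega
    _ ≤ ∑ i ∈ range k, (1 : ℚ) / 2 ^ (i + 1) := by
        refine sum_le_sum fun i _ => ?_
        push_cast
        have : (2 : ℚ) ≤ p := by exact_mod_cast hp.two_le
        gcongr
    _ ≤ 1 := by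
        rw [hgeom]
        linarith [show (0 : ℚ) ≤ 1 / 2 ^ k by positivity]

theorem sum_lt_eq_half_sum {S : Finset ℕ} {g : ℕ → ℕ → ℚ} (hsymm : ∀ x y, g x y = g y x)
    (hdiag : ∀ x ∈ S, g x x = 0) :
    ∑ x ∈ S, ∑ y ∈ S, (if x < y then g x y else 0) = (∑ x ∈ S, ∑ y ∈ S, g x y) / 2 := by
  have hswap : ∑ x ∈ S, ∑ y ∈ S, (if y < x then g x y else 0) =
      ∑ x ∈ S, ∑ y ∈ S, (if x < y then g x y else 0) := by
    rw [sum_comm]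
    simp_rw [hsymm]
  have hsplit : ∑ x ∈ S, ∑ y ∈ S, g x y = ∑ x ∈ S, ∑ y ∈ S, (if x < y then g x y else 0) +
      ∑ x ∈ S, ∑ y ∈ S, (if y < x then g x y else 0) := by
    simp_rw [← sum_add_distrib]
    refine sum_congr rfl fun x hx => sum_congr rfl fun y _ => ?_
    rcases lt_trichotomy x y with h | rfl | h
    · simp [h, h.not_gt]
    · simp [hdiag x hx]
    · simp [h, h.not_gt]
  rw [hsplit, hswap]
  ring

theorem sum_lt_lt_eq_sixth_sum {S : Finset ℕ} {g : ℕ → ℕ → ℕ → ℚ}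
    (h₁₂ : ∀ x y z, g x y z = g y x z) (h₂₃ : ∀ x y z, g x y z = g x z y)
    (hdiag : ∀ x ∈ S, ∀ y, g x x y = 0) :
    ∑ x ∈ S, ∑ y ∈ S, ∑ z ∈ S, (if x < y ∧ y < z then g x y z else 0) =
      (∑ x ∈ S, ∑ y ∈ S, ∑ z ∈ S, g x y z) / 6 := by
  set f : ℕ → ℕ → ℕ → ℚ := fun x y z => if x < y ∧ y < z then g x y z else 0 with hf
  have c₁₂ (k : ℕ → ℕ → ℕ → ℚ) : ∑ x ∈ S, ∑ y ∈ S, ∑ z ∈ S, k y x z =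
      ∑ x ∈ S, ∑ y ∈ S, ∑ z ∈ S, k x y z := sum_comm
  have c₂₃ (k : ℕ → ℕ → ℕ → ℚ) : ∑ x ∈ S, ∑ y ∈ S, ∑ z ∈ S, k x z y =
      ∑ x ∈ S, ∑ y ∈ S, ∑ z ∈ S, k x y z := sum_congr rfl fun _ _ => sum_comm
  have hsplit : ∑ x ∈ S, ∑ y ∈ S, ∑ z ∈ S, g x y z = ∑ x ∈ S, ∑ y ∈ S, ∑ z ∈ S,
      (f x y z + f y x z + f x z y + f y z x + f z x y + f z y x) := by
    refine sum_congr rfl fun x hx => sum_congr rfl fun y hy => sum_congr rfl fun z hz => ?_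
    have e₁ := h₁₂ x y z
    have e₂ := h₂₃ x y z
    have e₃ := h₂₃ y x z
    have e₄ := h₁₂ x z y
    have e₅ := h₁₂ y z x
    have d₁ := hdiag x hx z
    have d₂ := hdiag y hy x
    have d₃ := hdiag x hx y
    simp only [hf]
    rcases lt_trichotomy x y with h | h | h <;> rcases lt_trichotomy y z with h' | h' | h' <;>
      rcases lt_trichotomy x z with h'' | h'' | h'' <;> first | omega | grind
  have i₁ := c₁₂ f
  have i₂ := c₂₃ f
  have i₃ := c₁₂ fun x y z => f x z y
  have i₄ := c₂₃ fun x y z => f y x z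
  have i₅ := c₁₂ fun x y z => f z x y
  simp only [sum_add_distrib] at hsplit
  rw [hsplit]
  linarith

section FiveSmooth

variable {a b c n m k : ℕ}

theorem eq_of_prime_dvd_five_smooth {p : ℕ} (hp : p.Prime) (h : p ∣ 2 ^ a * 3 ^ b * 5 ^ c) :
    p = 2 ∨ p = 3 ∨ p = 5 := by
  rcases hp.dvd_mul.1 h with h | h
  · rcases hp.dvd_mul.1 h with h | h
    · exact .inl ((Nat.prime_dvd_prime_iff_eq hp Nat.prime_two).1 (hp.dvd_of_dvd_pow h))
    · exact .inr (.inl ((Nat.prime_dvd_prime_iff_eq hp Nat.prime_three).1 (hp.dvd_of_dvd_pow h)))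
  · exact .inr (.inr ((Nat.prime_dvd_prime_iff_eq hp Nat.prime_five).1 (hp.dvd_of_dvd_pow h)))

theorem two_or_three_or_five_dvd (h1 : 1 < n) (hn : n ∣ 2 ^ a * 3 ^ b * 5 ^ c) :
    2 ∣ n ∨ 3 ∣ n ∨ 5 ∣ n := by
  obtain ⟨p, hp, hpn⟩ := Nat.exists_prime_and_dvd h1.ne'
  rcases eq_of_prime_dvd_five_smooth hp (hpn.trans hn) with rfl | rfl | rfl <;> tauto

theorem gcd_eq_one_iff_of_dvd_five_smooth (hn : n ∣ 2 ^ a * 3 ^ b * 5 ^ c) :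
    n.gcd m = 1 ↔ ¬ (decide (2 ∣ n) = true ∧ decide (2 ∣ m) = true) ∧
      ¬ (decide (3 ∣ n) = true ∧ decide (3 ∣ m) = true) ∧
      ¬ (decide (5 ∣ n) = true ∧ decide (5 ∣ m) = true) := by
  simp only [decide_eq_true_iff]
  constructor
  · intro h
    refine ⟨?_, ?_, ?_⟩ <;> rintro ⟨h1, h2⟩ <;> simpa [h] using Nat.dvd_gcd h1 h2
  · rintro ⟨h2, h3, h5⟩
    refine Nat.coprime_of_dvd fun p hp hpn hpm => ?_
    rcases eq_of_prime_dvd_five_smooth hp (hpn.trans hn) with rfl | rfl | rfl <;> tauto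

/-- The reciprocal of `n` if the divisibility of `n` by `2`, `3`, `5` is the prescribed one,
and `0` otherwise. -/
def typedInv (u v w : Bool) (n : ℕ) : ℚ :=
  if decide (2 ∣ n) = u ∧ decide (3 ∣ n) = v ∧ decide (5 ∣ n) = w then 1 / n else 0

theorem one_div_eq_sum_typedInv (h : 2 ∣ n ∨ 3 ∣ n ∨ 5 ∣ n) :
    (1 : ℚ) / n = typedInv true false false n + typedInv false true false n +
      typedInv false false true n + typedInv true true false n + typedInv true false true n +
      typedInv false true true n + typedInv true true true n := by
  unfold typedInv
  rw [← decide_eq_true_iff (p := 2 ∣ n), ← decide_eq_true_iff (p := 3 ∣ n),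
    ← decide_eq_true_iff (p := 5 ∣ n)] at h
  generalize decide (2 ∣ n) = u at h ⊢
  generalize decide (3 ∣ n) = v at h ⊢
  generalize decide (5 ∣ n) = w at h ⊢
  revert u v w
  simp

theorem pair_eq_sum_typedInv (hn : n ∣ 2 ^ a * 3 ^ b * 5 ^ c)
    (h : 2 ∣ n ∨ 3 ∣ n ∨ 5 ∣ n) (h' : 2 ∣ m ∨ 3 ∣ m ∨ 5 ∣ m) :
    (if n.gcd m = 1 then (1 : ℚ) / (n * m) else 0) =
      typedInv true false false n * typedInv false true false m +
      typedInv false true false n * typedInv true false false m +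
      typedInv true false false n * typedInv false false true m +
      typedInv false false true n * typedInv true false false m +
      typedInv false true false n * typedInv false false true m +
      typedInv false false true n * typedInv false true false m +
      typedInv true true false n * typedInv false false true m +
      typedInv false false true n * typedInv true true false m +
      typedInv true false true n * typedInv false true false m +
      typedInv false true false n * typedInv true false true m +
      typedInv false true true n * typedInv true false false m +
      typedInv true false false n * typedInv false true true m := by
  simp only [gcd_eq_one_iff_of_dvd_five_smooth hn]
  unfold typedInv
  rw [← decide_eq_true_iff (p := 2 ∣ n), ← decide_eq_true_iff (p := 3 ∣ n),
    ← decide_eq_true_iff (p := 5 ∣ n)] at h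
  rw [← decide_eq_true_iff (p := 2 ∣ m), ← decide_eq_true_iff (p := 3 ∣ m),
    ← decide_eq_true_iff (p := 5 ∣ m)] at h'
  generalize decide (2 ∣ n) = u₁ at h ⊢
  generalize decide (3 ∣ n) = v₁ at h ⊢
  generalize decide (5 ∣ n) = w₁ at h ⊢
  generalize decide (2 ∣ m) = u₂ at h' ⊢
  generalize decide (3 ∣ m) = v₂ at h' ⊢
  generalize decide (5 ∣ m) = w₂ at h' ⊢
  rw [← one_div_mul_one_div]
  cases u₁ <;> cases v₁ <;> cases w₁ <;> simp at h ⊢ <;>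
  cases u₂ <;> cases v₂ <;> cases w₂ <;> simp at h' ⊢

theorem triple_eq_sum_typedInv (hn : n ∣ 2 ^ a * 3 ^ b * 5 ^ c) (hm : m ∣ 2 ^ a * 3 ^ b * 5 ^ c)
    (h : 2 ∣ n ∨ 3 ∣ n ∨ 5 ∣ n) (h' : 2 ∣ m ∨ 3 ∣ m ∨ 5 ∣ m) (h'' : 2 ∣ k ∨ 3 ∣ k ∨ 5 ∣ k) :
    (if n.gcd m = 1 ∧ m.gcd k = 1 ∧ n.gcd k = 1 then (1 : ℚ) / (n * m * k) else 0) =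
      typedInv true false false n * typedInv false true false m * typedInv false false true k +
      typedInv true false false n * typedInv false false true m * typedInv false true false k +
      typedInv false true false n * typedInv true false false m * typedInv false false true k +
      typedInv false true false n * typedInv false false true m * typedInv true false false k +
      typedInv false false true n * typedInv true false false m * typedInv false true false k +
      typedInv false false true n * typedInv false true false m * typedInv true false false k := by
  simp only [gcd_eq_one_iff_of_dvd_five_smooth hn, gcd_eq_one_iff_of_dvd_five_smooth hm]
  unfold typedInv
  rw [← decide_eq_true_iff (p := 2 ∣ n), ← decide_eq_true_iff (p := 3 ∣ n),
    ← decide_eq_true_iff (p := 5 ∣ n)] at h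
  rw [← decide_eq_true_iff (p := 2 ∣ m), ← decide_eq_true_iff (p := 3 ∣ m),
    ← decide_eq_true_iff (p := 5 ∣ m)] at h'
  rw [← decide_eq_true_iff (p := 2 ∣ k), ← decide_eq_true_iff (p := 3 ∣ k),
    ← decide_eq_true_iff (p := 5 ∣ k)] at h''
  generalize decide (2 ∣ n) = u₁ at h ⊢
  generalize decide (3 ∣ n) = v₁ at h ⊢
  generalize decide (5 ∣ n) = w₁ at h ⊢
  generalize decide (2 ∣ m) = u₂ at h' ⊢
  generalize decide (3 ∣ m) = v₂ at h' ⊢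
  generalize decide (5 ∣ m) = w₂ at h' ⊢
  generalize decide (2 ∣ k) = u₃ at h'' ⊢
  generalize decide (3 ∣ k) = v₃ at h'' ⊢
  generalize decide (5 ∣ k) = w₃ at h'' ⊢
  rw [← one_div_mul_one_div, ← one_div_mul_one_div]
  cases u₁ <;> cases v₁ <;> cases w₁ <;> simp at h ⊢ <;>
  cases u₂ <;> cases v₂ <;> cases w₂ <;> simp at h' ⊢ <;>
  cases u₃ <;> cases v₃ <;> cases w₃ <;> simp at h'' ⊢

end FiveSmooth

/-- **Inclusion–exclusion bound for systems of congruences with 5-smooth lcm.**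
Let `S` be a finite set of pairwise distinct moduli, all greater than `1`, whose
least common multiple `L` is of the form `2^a * 3^b * 5^c`, and let `r n` be the
residue of the congruence with modulus `n`.  Then the number of residues
`x ∈ {0, …, L-1}` satisfying at least one of the congruences `x ≡ r n (mod n)`
is at most
`L * (∑ 1/n − ∑_{n<n', gcd = 1} 1/(n n') + ∑_{n<n'<n'', pairwise coprime} 1/(n n' n''))`. -/
theorem incl_excl_density_bound (S : Finset ℕ) (r : ℕ → ℤ) (a b c : ℕ)
    (hmod : ∀ n ∈ S, 1 < n)
    (hlcm : S.lcm id = 2 ^ a * 3 ^ b * 5 ^ c)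
    (L : ℕ) (hL : L = S.lcm id) :
    (((Finset.range L).filter
        (fun x : ℕ => ∃ n ∈ S, (x : ℤ) ≡ r n [ZMOD (n : ℤ)])).card : ℚ) ≤
      (L : ℚ) *
        ((∑ n ∈ S, (1 : ℚ) / n)
          - (∑ n ∈ S, ∑ n' ∈ S,
              if n < n' ∧ Nat.gcd n n' = 1 then (1 : ℚ) / (n * n') else 0)
          + (∑ n ∈ S, ∑ n' ∈ S, ∑ n'' ∈ S,
              if n < n' ∧ n' < n'' ∧ Nat.gcd n n' = 1 ∧ Nat.gcd n' n'' = 1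
                  ∧ Nat.gcd n n'' = 1
              then (1 : ℚ) / (n * n' * n'') else 0)) := by
  have hdvd : ∀ n ∈ S, n ∣ 2 ^ a * 3 ^ b * 5 ^ c := fun n hn => hlcm ▸ dvd_lcm (f := id) hn
  have htype : ∀ n ∈ S, 2 ∣ n ∨ 3 ∣ n ∨ 5 ∣ n := fun n hn =>
    two_or_three_or_five_dvd (hmod n hn) (hdvd n hn)
  rw [hlcm] at hL
  have hL0 : (0 : ℚ) < L := by rw [hL]; positivity
  have hpairs : ∑ n ∈ S, ∑ n' ∈ S,
      (if n < n' ∧ Nat.gcd n n' = 1 then (1 : ℚ) / (n * n') else 0) =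
      (∑ n ∈ S, ∑ n' ∈ S, if Nat.gcd n n' = 1 then (1 : ℚ) / (n * n') else 0) / 2 := by
    simp_rw [ite_and]
    refine sum_lt_eq_half_sum (fun x y => ?_) fun x hx => ?_
    · simp only [Nat.gcd_comm x y, mul_comm (x : ℚ)]
    · simp [(hmod x hx).ne']
  have htriples : ∑ n ∈ S, ∑ n' ∈ S, ∑ n'' ∈ S,
      (if n < n' ∧ n' < n'' ∧ Nat.gcd n n' = 1 ∧ Nat.gcd n' n'' = 1 ∧ Nat.gcd n n'' = 1
        then (1 : ℚ) / (n * n' * n'') else 0) =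
      (∑ n ∈ S, ∑ n' ∈ S, ∑ n'' ∈ S,
        if Nat.gcd n n' = 1 ∧ Nat.gcd n' n'' = 1 ∧ Nat.gcd n n'' = 1
        then (1 : ℚ) / (n * n' * n'') else 0) / 6 := by
    rw [← sum_lt_lt_eq_sixth_sum]
    · simp_rw [← ite_and, and_assoc]
    · intro x y z
      simp only [Nat.gcd_comm y x, mul_comm (y : ℚ) x, and_comm (a := x.gcd z = 1)]
    · intro x y z
      simp only [Nat.gcd_comm z y, mul_right_comm (x : ℚ) z, and_left_comm (a := x.gcd z = 1),
        and_comm (a := x.gcd z = 1), and_left_comm (a := x.gcd y = 1)]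
    · intro x hx y
      simp [(hmod x hx).ne']
  have hpairs' : ∑ n ∈ S, ∑ n' ∈ S, (if Nat.gcd n n' = 1 then (1 : ℚ) / (n * n') else 0) = _ :=
    sum_congr rfl fun n hn => sum_congr rfl fun m hm =>
      pair_eq_sum_typedInv (hdvd n hn) (htype n hn) (htype m hm)
  have htriples' : ∑ n ∈ S, ∑ n' ∈ S, ∑ n'' ∈ S,
      (if Nat.gcd n n' = 1 ∧ Nat.gcd n' n'' = 1 ∧ Nat.gcd n n'' = 1
        then (1 : ℚ) / (n * n' * n'') else 0) = _ :=
    sum_congr rfl fun n hn => sum_congr rfl fun m hm => sum_congr rfl fun k hk =>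
      triple_eq_sum_typedInv (hdvd n hn) (hdvd m hm) (htype n hn) (htype m hm) (htype k hk)
  have hsingles : ∑ n ∈ S, (1 : ℚ) / n = _ :=
    sum_congr rfl fun n hn => one_div_eq_sum_typedInv (htype n hn)
  rw [hpairs, htriples, hpairs', htriples', hsingles]
  simp only [sum_add_distrib, ← mul_sum, ← sum_mul]
  set T : Bool → Bool → Bool → Finset ℕ := fun u v w =>
    S.filter fun n => decide (2 ∣ n) = u ∧ decide (3 ∣ n) = v ∧ decide (5 ∣ n) = w with hT
  have hsum (u v w : Bool) : ∑ n ∈ S, typedInv u v w n = ∑ n ∈ T u v w, (1 : ℚ) / n :=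
    (sum_filter _ _).symm
  simp only [hsum]
  have hc2 {n k : ℕ} (h : ¬ 2 ∣ n) : n.Coprime (2 ^ k) :=
    (((Nat.Prime.coprime_iff_not_dvd Nat.prime_two).2 h).pow_left k).symm
  have hc3 {n k : ℕ} (h : ¬ 3 ∣ n) : n.Coprime (3 ^ k) :=
    (((Nat.Prime.coprime_iff_not_dvd Nat.prime_three).2 h).pow_left k).symm
  have hc5 {n k : ℕ} (h : ¬ 5 ∣ n) : n.Coprime (5 ^ k) :=
    (((Nat.Prime.coprime_iff_not_dvd Nat.prime_five).2 h).pow_left k).symm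
  have h₁ : ∀ n ∈ T true false false, n ∣ 2 ^ a := fun n hn => by
    simp only [hT, mem_filter, decide_eq_true_eq, decide_eq_false_iff_not] at hn
    exact (hc3 hn.2.2.1).dvd_of_dvd_mul_right ((hc5 hn.2.2.2).dvd_of_dvd_mul_right (hdvd n hn.1))
  have h₂ : ∀ n ∈ T false true false, n ∣ 3 ^ b := fun n hn => by
    simp only [hT, mem_filter, decide_eq_true_eq, decide_eq_false_iff_not] at hn
    exact (hc2 hn.2.1).dvd_of_dvd_mul_left ((hc5 hn.2.2.2).dvd_of_dvd_mul_right (hdvd n hn.1))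
  have h₃ : ∀ n ∈ T false false true, n ∣ 5 ^ c := fun n hn => by
    simp only [hT, mem_filter, decide_eq_true_eq, decide_eq_false_iff_not] at hn
    exact ((hc2 hn.2.1).mul_right (hc3 hn.2.2.1)).dvd_of_dvd_mul_left (hdvd n hn.1)
  have h₁₂ : ∀ n ∈ T true true false, n ∣ 2 ^ a * 3 ^ b := fun n hn => by
    simp only [hT, mem_filter, decide_eq_true_eq, decide_eq_false_iff_not] at hn
    exact (hc5 hn.2.2.2).dvd_of_dvd_mul_right (hdvd n hn.1)
  have h₁₃ : ∀ n ∈ T true false true, n ∣ 2 ^ a * 5 ^ c := fun n hn => by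
    simp only [hT, mem_filter, decide_eq_true_eq, decide_eq_false_iff_not] at hn
    refine (hc3 (k := b) hn.2.2.1).dvd_of_dvd_mul_right ?_
    rw [mul_right_comm]
    exact hdvd n hn.1
  have h₂₃ : ∀ n ∈ T false true true, n ∣ 3 ^ b * 5 ^ c := fun n hn => by
    simp only [hT, mem_filter, decide_eq_true_eq, decide_eq_false_iff_not] at hn
    refine (hc2 (k := a) hn.2.1).dvd_of_dvd_mul_left ?_
    rw [← mul_assoc]
    exact hdvd n hn.1
  have hgt {u v w : Bool} : ∀ n ∈ T u v w, 1 < n := fun n hn => hmod n (mem_filter.1 hn).1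
  have key := rangeDensity_covered_le (r := r) (S := S) (T := T true true true)
    (by positivity) (by positivity) (by positivity)
    (Nat.Coprime.pow a b (by norm_num)) (Nat.Coprime.pow a c (by norm_num))
    (Nat.Coprime.pow b c (by norm_num)) (fun n hn => by
      have := htype n hn
      simp only [hT, mem_filter, decide_eq_true_eq, decide_eq_false_iff_not]
      tauto) h₁ h₂ h₃ h₁₂ h₁₃ h₂₃ (fun n hn => hdvd n (mem_filter.1 hn).1)
    (sum_one_div_le_one_of_dvd_prime_pow Nat.prime_two fun n hn => ⟨h₁ n hn, hgt n hn⟩)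
    (sum_one_div_le_one_of_dvd_prime_pow Nat.prime_three fun n hn => ⟨h₂ n hn, hgt n hn⟩)
    (sum_one_div_le_one_of_dvd_prime_pow Nat.prime_five fun n hn => ⟨h₃ n hn, hgt n hn⟩)
  rw [← hL, rangeDensity_eq_card_div, div_le_iff₀' hL0] at key
  refine key.trans_eq ?_
  congr 1
  ring
end

section
/- If C is a distinct covering system in which every modulus is of the form 2^a·3^b·5^c with a, b, c nonnegative integers (that is, every modulus is 5-smooth), then the least modulus of C is at most 9. -/
namespace FiveSmoothCovering

open Finset

section Density

variable {α β γ : Type*}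

/-- The set of triples whose first two coordinates lie in `X` and whose last lies in `J`. -/
def cylinderXY (X : Finset (α × β)) (J : Finset γ) : Finset (α × β × γ) :=
  (X ×ˢ J).map (Equiv.prodAssoc α β γ).toEmbedding

/-- The set of triples whose outer coordinates lie in `Y` and whose middle one lies in `J`. -/
def cylinderXZ (Y : Finset (α × γ)) (J : Finset β) : Finset (α × β × γ) :=
  (J ×ˢ Y).map ((Equiv.prodAssoc β α γ).symm.trans
    (((Equiv.prodComm β α).prodCongr (Equiv.refl γ)).trans (Equiv.prodAssoc α β γ))).toEmbedding

@[simp]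
theorem mem_cylinderXY {X : Finset (α × β)} {J : Finset γ} {i : α} {j : β} {k : γ} :
    (i, j, k) ∈ cylinderXY X J ↔ (i, j) ∈ X ∧ k ∈ J := by
  simp [cylinderXY]

@[simp]
theorem mem_cylinderXZ {Y : Finset (α × γ)} {J : Finset β} {i : α} {j : β} {k : γ} :
    (i, j, k) ∈ cylinderXZ Y J ↔ (i, k) ∈ Y ∧ j ∈ J := by
  simp [cylinderXZ, and_comm]

variable [Fintype α] [Fintype β] [Fintype γ]

theorem dens_prod (s : Finset α) (t : Finset β) : (s ×ˢ t).dens = s.dens * t.dens := by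
  simp [dens_eq_card_div_card, mul_div_mul_comm]

theorem dens_compl_add_dens [DecidableEq α] [Nonempty α] (s : Finset α) :
    sᶜ.dens + s.dens = 1 := by
  rw [← dens_union_of_disjoint disjoint_compl_left, union_comm, union_compl, dens_univ]

theorem dens_cylinderXY (X : Finset (α × β)) (J : Finset γ) :
    (cylinderXY X J).dens = X.dens * J.dens := by
  rw [cylinderXY, dens_map_equiv, dens_prod]

theorem dens_cylinderXZ (Y : Finset (α × γ)) (J : Finset β) :
    (cylinderXZ Y J).dens = Y.dens * J.dens := by
  rw [cylinderXZ, dens_map_equiv, dens_prod, mul_comm]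

theorem density_inequalities_incompatible {p q r e x x' y z w : ℚ}
    (hp : 7 / 8 ≤ p) (hq : 17 / 18 ≤ q) (hr : 19 / 20 ≤ r)
    (he : e ≤ 1 / 2) (hx : x + x' ≤ 1 / 3) (hy : y ≤ 3 / 20)
    (hz : z ≤ 1 / 8) (hw : w ≤ 1 / 8) (hz₀ : 0 ≤ z) (hxe : x ≤ e * q)
    (hglobal : p * (q * r) ≤ (x + x') * r + (e * q - x) * (1 / 5) + y * q + p * z + w)
    (hhalf : e * (q * r) ≤ x * r + (1 / 10 + y) * q + e * z + w) : False := by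
  have hqr : 17 / 18 * (19 / 20) ≤ q * r := by gcongr
  have h₁ : 7 / 8 * (q * r - z) ≤ p * (q * r - z) := by
    gcongr
    linarith
  have h₂ : (x + x') * r ≤ 1 / 3 * r := by gcongr
  have h₃ : y * q ≤ 3 / 20 * q := by gcongr
  have h₄ : 19 / 20 * (7 / 8 * q - 1 / 3) ≤ r * (7 / 8 * q - 1 / 3) := by
    gcongr
    linarith
  have h₅ : e * z ≤ 1 / 2 * (1 / 8) := by gcongr
  have h₆ : 19 / 20 * (e * q - x) ≤ r * (e * q - x) := by gcongr
  linarith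

/-- In a product of three finite sets, cylinders over `P`, `Q`, `R`, `X`, `E ×ˢ F`, `Y`, `Z` together
with a set `W` cannot cover everything when their densities are at most the given bounds. -/
theorem exists_uncovered [DecidableEq α] [DecidableEq β] [DecidableEq γ]
    {P E : Finset α} {Q : Finset β} {R F : Finset γ} {X : Finset (α × β)} {Y : Finset (α × γ)}
    {Z : Finset (β × γ)} {W : Finset (α × β × γ)}
    [Nonempty α] [Nonempty β] [Nonempty γ]
    (hP : (P.dens : ℚ) ≤ 1 / 8) (hQ : (Q.dens : ℚ) ≤ 1 / 18) (hR : (R.dens : ℚ) ≤ 1 / 20)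
    (hE : (E.dens : ℚ) ≤ 1 / 2) (hF : (F.dens : ℚ) ≤ 1 / 5) (hEF : ((E ×ˢ F).dens : ℚ) ≤ 1 / 10)
    (hX : (X.dens : ℚ) ≤ 1 / 3) (hY : (Y.dens : ℚ) ≤ 3 / 20) (hZ : (Z.dens : ℚ) ≤ 1 / 8)
    (hW : (W.dens : ℚ) ≤ 1 / 8) :
    ∃ i j k, i ∉ P ∧ j ∉ Q ∧ k ∉ R ∧ (i, j) ∉ X ∧ ¬ (i ∈ E ∧ k ∈ F) ∧ (i, k) ∉ Y ∧
      (j, k) ∉ Z ∧ (i, j, k) ∉ W := by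
  by_contra! hcov
  obtain ⟨H, H_def⟩ : ∃ H, H = (E \ P) ×ˢ Qᶜ := ⟨_, rfl⟩
  obtain ⟨X₁, X₁_def⟩ : ∃ X₁, X₁ = X ∩ H := ⟨_, rfl⟩
  obtain ⟨X₂, X₂_def⟩ : ∃ X₂, X₂ = (X ∩ Pᶜ ×ˢ Qᶜ) \ H := ⟨_, rfl⟩
  have hX₁ : X₁ ⊆ H := X₁_def ▸ inter_subset_right
  have hglobal : Pᶜ ×ˢ Qᶜ ×ˢ Rᶜ ⊆ cylinderXY (X₁ ∪ X₂) Rᶜ ∪ cylinderXY (H \ X₁) F ∪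
      cylinderXZ Y Qᶜ ∪ Pᶜ ×ˢ Z ∪ W := by
    rintro ⟨i, j, k⟩ h
    have := hcov i j k
    simp only [X₁_def, X₂_def, H_def, mem_union, mem_cylinderXY, mem_cylinderXZ, mem_product,
      mem_compl, mem_inter, mem_sdiff] at h ⊢
    tauto
  have hhalf : (E \ P) ×ˢ Qᶜ ×ˢ Rᶜ ⊆ cylinderXY X₁ Rᶜ ∪ cylinderXZ (E ×ˢ F ∪ Y) Qᶜ ∪
      (E \ P) ×ˢ Z ∪ W := by
    rintro ⟨i, j, k⟩ h
    have := hcov i j k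
    simp only [X₁_def, H_def, mem_union, mem_cylinderXY, mem_cylinderXZ, mem_product, mem_compl,
      mem_inter, mem_sdiff] at h ⊢
    tauto
  have hdisj : Disjoint X₁ X₂ := X₂_def ▸ disjoint_sdiff.mono_left hX₁
  have hX₁₂ : ((X₁ ∪ X₂).dens : ℚ) ≤ X.dens := by
    rw [X₁_def, X₂_def]
    exact_mod_cast dens_le_dens
      (union_subset inter_subset_left (sdiff_subset.trans inter_subset_left))
  have hpc : (Pᶜ.dens : ℚ) + P.dens = 1 := by exact_mod_cast dens_compl_add_dens P
  have hqc : (Qᶜ.dens : ℚ) + Q.dens = 1 := by exact_mod_cast dens_compl_add_dens Q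
  have hrc : (Rᶜ.dens : ℚ) + R.dens = 1 := by exact_mod_cast dens_compl_add_dens R
  have hH : (H.dens : ℚ) = (E \ P).dens * Qᶜ.dens := by rw [H_def, dens_prod, NNRat.cast_mul]
  have hdiff : ((H \ X₁).dens : ℚ) + X₁.dens = H.dens := by
    exact_mod_cast dens_sdiff_add_dens_eq_dens hX₁
  have hEP : ((E \ P).dens : ℚ) ≤ E.dens := by exact_mod_cast dens_le_dens sdiff_subset
  have hXle : (X₁.dens : ℚ) ≤ H.dens := by exact_mod_cast dens_le_dens hX₁
  have hEFY : ((E ×ˢ F ∪ Y).dens : ℚ) ≤ (E ×ˢ F).dens + Y.dens := by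
    exact_mod_cast dens_union_le _ _
  have hglobal' : (Pᶜ.dens : ℚ) * (Qᶜ.dens * Rᶜ.dens) ≤ (X₁ ∪ X₂).dens * Rᶜ.dens +
      (H \ X₁).dens * F.dens + Y.dens * Qᶜ.dens + Pᶜ.dens * Z.dens + W.dens := by
    norm_cast
    rw [← dens_prod Qᶜ, ← dens_prod, ← dens_prod Pᶜ Z, ← dens_cylinderXY (X₁ ∪ X₂),
      ← dens_cylinderXY (H \ X₁), ← dens_cylinderXZ]
    refine (dens_le_dens hglobal).trans ?_
    iterate 4 refine (dens_union_le _ _).trans ?_; gcongr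
  have hhalf' : ((E \ P).dens : ℚ) * (Qᶜ.dens * Rᶜ.dens) ≤ X₁.dens * Rᶜ.dens +
      (E ×ˢ F ∪ Y).dens * Qᶜ.dens + (E \ P).dens * Z.dens + W.dens := by
    norm_cast
    rw [← dens_prod Qᶜ, ← dens_prod, ← dens_prod (E \ P) Z, ← dens_cylinderXY X₁,
      ← dens_cylinderXZ]
    refine (dens_le_dens hhalf).trans ?_
    iterate 3 refine (dens_union_le _ _).trans ?_; gcongr
  have hunion : ((X₁ ∪ X₂).dens : ℚ) = X₁.dens + X₂.dens := by
    exact_mod_cast dens_union_of_disjoint hdisj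
  refine density_inequalities_incompatible (p := Pᶜ.dens) (q := Qᶜ.dens) (r := Rᶜ.dens)
    (e := (E \ P).dens) (x := X₁.dens) (x' := X₂.dens) (y := Y.dens) (z := Z.dens) (w := W.dens)
    (by linarith) (by linarith) (by linarith) (by linarith) (by linarith)
    hY hZ hW (by positivity) (by linarith) ?_ ?_
  · have : ((H \ X₁).dens : ℚ) * F.dens ≤ (H \ X₁).dens * (1 / 5) := by gcongr
    rw [← hunion, ← hH, ← hdiff, add_sub_cancel_right]
    linarith
  · have : ((E ×ˢ F ∪ Y).dens : ℚ) * Qᶜ.dens ≤ (1 / 10 + Y.dens) * Qᶜ.dens := by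
      gcongr; linarith
    linarith

end Density

/-- The elements of `Fin N` that are congruent to `r` modulo `d`. -/
def residueClass (N d : ℕ) (r : ℤ) : Finset (Fin N) := {i | (i : ℤ) ≡ r [ZMOD d]}

@[simp]
theorem mem_residueClass {N d : ℕ} {r : ℤ} {i : Fin N} :
    i ∈ residueClass N d r ↔ (i : ℤ) ≡ r [ZMOD d] := by
  simp [residueClass]

theorem mem_residueClass_of_modEq {p N a n : ℕ} {i : Fin (p ^ N)} {x r : ℤ} (ha : a ≤ N)
    (hn : p ^ a ∣ n) (hi : x ≡ (i : ℕ) [ZMOD (p ^ N : ℕ)]) (hx : x ≡ r [ZMOD n]) :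
    i ∈ residueClass (p ^ N) (p ^ a) r :=
  mem_residueClass.2 <| (hi.of_dvd (Int.natCast_dvd_natCast.2 (pow_dvd_pow p ha))).symm.trans
    (hx.of_dvd (Int.natCast_dvd_natCast.2 hn))

theorem dens_residueClass {N d : ℕ} (hN : 0 < N) (h : d ∣ N) (r : ℤ) :
    (residueClass N d r).dens = 1 / d := by
  obtain ⟨k, rfl⟩ := h
  have hd : 0 < d := Nat.pos_of_mul_pos_right hN
  have hk : 0 < k := Nat.pos_of_mul_pos_left hN
  have hcard : #(residueClass (d * k) d r) =
      #{x ∈ Ico (0 : ℤ) ((d * k : ℕ) : ℤ) | x ≡ r [ZMOD d]} := by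
    refine card_bij (fun i _ => (i : ℤ)) ?_ ?_ ?_
    · intro i hi
      have := i.isLt
      simp only [mem_residueClass, mem_filter, mem_Ico] at hi ⊢
      exact ⟨by omega, hi⟩
    · intro i _ j _ h
      exact Fin.ext (by exact_mod_cast h)
    · intro x hx
      simp only [mem_filter, mem_Ico] at hx
      exact ⟨⟨x.toNat, by omega⟩, by simp [hx.1.1, hx.2], by simp [hx.1.1]⟩
  have hk' : #(residueClass (d * k) d r) = k := by
    have h := Int.Ico_filter_modEq_card 0 ((d * k : ℕ) : ℤ) (r := (d : ℤ)) (by exact_mod_cast hd) r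
    have e : (((d * k : ℕ) : ℤ) - r : ℚ) / (d : ℤ) = ((0 : ℤ) - r : ℚ) / (d : ℤ) + (k : ℤ) := by
      push_cast
      field_simp
      ring
    rw [← hcard, e, Int.ceil_add_intCast] at h
    omega
  rw [dens_eq_card_div_card, hk']
  simp
  field_simp

theorem dens_residueClass_pow {p N a : ℕ} (hp : 0 < p) (ha : a ≤ N) (r : ℤ) :
    ((residueClass (p ^ N) (p ^ a) r).dens : ℚ) = (1 / p : ℚ) ^ a := by
  rw [dens_residueClass (by positivity) (pow_dvd_pow p ha)]
  simp

theorem dens_biUnion_le_cast {ι α : Type*} [Fintype α] [DecidableEq α] (s : Finset ι)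
    (t : ι → Finset α) {f : ι → ℚ} (h : ∀ i ∈ s, ((t i).dens : ℚ) ≤ f i) :
    ((s.biUnion t).dens : ℚ) ≤ ∑ i ∈ s, f i :=
  calc ((s.biUnion t).dens : ℚ) ≤ ((∑ i ∈ s, (t i).dens : ℚ≥0) : ℚ) := by
        exact_mod_cast dens_biUnion_le
    _ ≤ ∑ i ∈ s, f i := by
        push_cast
        exact sum_le_sum h

theorem exists_modEq_of_coprime {m n k : ℕ} (hmn : m.Coprime n) (hmk : m.Coprime k)
    (hnk : n.Coprime k) (x y z : ℕ) :
    ∃ u : ℤ, u ≡ x [ZMOD m] ∧ u ≡ y [ZMOD n] ∧ u ≡ z [ZMOD k] := by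
  obtain ⟨v, hv₁, hv₂⟩ := Nat.chineseRemainder hmn x y
  obtain ⟨u, hu₁, hu₂⟩ := Nat.chineseRemainder (hmk.mul_left hnk) v z
  refine ⟨u, ?_, ?_, ?_⟩ <;> rw [Int.natCast_modEq_iff]
  · exact (hu₁.of_mul_right n).trans hv₁
  · exact (hu₁.of_mul_left m).trans hv₂
  · exact hu₂

/-- One residue class for each modulus that divides `30 ^ N` and is at least `10` does not cover
the integers. -/
theorem exists_not_modEq_of_five_smooth (N : ℕ) (hN : 1 ≤ N) (r : ℕ → ℤ) :
    ∃ x : ℤ, ∀ a ≤ N, ∀ b ≤ N, ∀ c ≤ N, 10 ≤ 2 ^ a * 3 ^ b * 5 ^ c →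
      ¬ x ≡ r (2 ^ a * 3 ^ b * 5 ^ c) [ZMOD (2 ^ a * 3 ^ b * 5 ^ c : ℕ)] := by
  let A (a b c : ℕ) : Finset (Fin (2 ^ N)) :=
    residueClass (2 ^ N) (2 ^ a) (r (2 ^ a * 3 ^ b * 5 ^ c))
  let B (a b c : ℕ) : Finset (Fin (3 ^ N)) :=
    residueClass (3 ^ N) (3 ^ b) (r (2 ^ a * 3 ^ b * 5 ^ c))
  let C (a b c : ℕ) : Finset (Fin (5 ^ N)) :=
    residueClass (5 ^ N) (5 ^ c) (r (2 ^ a * 3 ^ b * 5 ^ c))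
  have hA (a b c : ℕ) (h : a ≤ N) : ((A a b c).dens : ℚ) = (1 / 2) ^ a := by
    exact_mod_cast dens_residueClass_pow (p := 2) (by norm_num) h _
  have hB (a b c : ℕ) (h : b ≤ N) : ((B a b c).dens : ℚ) = (1 / 3) ^ b := by
    exact_mod_cast dens_residueClass_pow (p := 3) (by norm_num) h _
  have hC (a b c : ℕ) (h : c ≤ N) : ((C a b c).dens : ℚ) = (1 / 5) ^ c := by
    exact_mod_cast dens_residueClass_pow (p := 5) (by norm_num) h _
  have sum₂ (k : ℕ) : ∑ a ∈ Ico k (N + 1), (1 / 2 : ℚ) ^ a ≤ (1 / 2) ^ k / (1 - 1 / 2) :=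
    geom_sum_Ico_le_of_lt_one (by norm_num) (by norm_num)
  have sum₃ (k : ℕ) : ∑ a ∈ Ico k (N + 1), (1 / 3 : ℚ) ^ a ≤ (1 / 3) ^ k / (1 - 1 / 3) :=
    geom_sum_Ico_le_of_lt_one (by norm_num) (by norm_num)
  have sum₅ (k : ℕ) : ∑ a ∈ Ico k (N + 1), (1 / 5 : ℚ) ^ a ≤ (1 / 5) ^ k / (1 - 1 / 5) :=
    geom_sum_Ico_le_of_lt_one (by norm_num) (by norm_num)
  have sum₂₁ := sum₂ 1
  have sum₃₁ := sum₃ 1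
  have sum₅₁ := sum₅ 1
  norm_num1 at sum₂₁ sum₃₁ sum₅₁
  let I := Ico 1 (N + 1)
  have hI : (1, 1) ∈ I ×ˢ I := by simp [I]; omega
  obtain ⟨i, j, k, hP, hQ, hR, hX, hEF, hY, hZ, hW⟩ := exists_uncovered
    (P := (Ico 4 (N + 1)).biUnion fun a => A a 0 0)
    (Q := (Ico 3 (N + 1)).biUnion fun b => B 0 b 0)
    (R := (Ico 2 (N + 1)).biUnion fun c => C 0 0 c)
    (E := A 1 0 1) (F := C 1 0 1)
    (X := ((I ×ˢ I).erase (1, 1)).biUnion fun s => A s.1 s.2 0 ×ˢ B s.1 s.2 0)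
    (Y := ((I ×ˢ I).erase (1, 1)).biUnion fun s => A s.1 0 s.2 ×ˢ C s.1 0 s.2)
    (Z := (I ×ˢ I).biUnion fun s => B 0 s.1 s.2 ×ˢ C 0 s.1 s.2)
    (W := (I ×ˢ I ×ˢ I).biUnion fun s =>
      A s.1 s.2.1 s.2.2 ×ˢ B s.1 s.2.1 s.2.2 ×ˢ C s.1 s.2.1 s.2.2)
    (by
      refine (dens_biUnion_le_cast _ _ fun a ha => (hA a 0 0 ?_).le).trans ((sum₂ 4).trans ?_)
      · rw [mem_Ico] at ha; omega
      · norm_num)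
    (by
      refine (dens_biUnion_le_cast _ _ fun a ha => (hB 0 a 0 ?_).le).trans ((sum₃ 3).trans ?_)
      · rw [mem_Ico] at ha; omega
      · norm_num)
    (by
      refine (dens_biUnion_le_cast _ _ fun a ha => (hC 0 0 a ?_).le).trans ((sum₅ 2).trans ?_)
      · rw [mem_Ico] at ha; omega
      · norm_num)
    (by rw [hA _ _ _ hN]; norm_num) (by rw [hC _ _ _ hN]; norm_num)
    (by rw [dens_prod, NNRat.cast_mul, hA _ _ _ hN, hC _ _ _ hN]; norm_num)
    (by
      refine (dens_biUnion_le_cast _ _ (f := fun s => (1 / 2) ^ s.1 * (1 / 3) ^ s.2) ?_).trans ?_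
      · rintro ⟨a, b⟩ h
        simp only [I, mem_erase, mem_product, mem_Ico] at h
        rw [dens_prod, NNRat.cast_mul, hA _ _ _ (by omega), hB _ _ _ (by omega)]
      · rw [sum_erase_eq_sub hI, sum_product, ← sum_mul_sum]
        have := mul_le_mul sum₂₁ sum₃₁ (by positivity) (by norm_num)
        norm_num1 at this ⊢
        linarith)
    (by
      refine (dens_biUnion_le_cast _ _ (f := fun s => (1 / 2) ^ s.1 * (1 / 5) ^ s.2) ?_).trans ?_
      · rintro ⟨a, b⟩ h
        simp only [I, mem_erase, mem_product, mem_Ico] at h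
        rw [dens_prod, NNRat.cast_mul, hA _ _ _ (by omega), hC _ _ _ (by omega)]
      · rw [sum_erase_eq_sub hI, sum_product, ← sum_mul_sum]
        have := mul_le_mul sum₂₁ sum₅₁ (by positivity) (by norm_num)
        norm_num1 at this ⊢
        linarith)
    (by
      refine (dens_biUnion_le_cast _ _ (f := fun s => (1 / 3) ^ s.1 * (1 / 5) ^ s.2) ?_).trans ?_
      · rintro ⟨a, b⟩ h
        simp only [I, mem_product, mem_Ico] at h
        rw [dens_prod, NNRat.cast_mul, hB _ _ _ (by omega), hC _ _ _ (by omega)]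
      · rw [sum_product, ← sum_mul_sum]
        have := mul_le_mul sum₃₁ sum₅₁ (by positivity) (by norm_num)
        norm_num1 at this ⊢
        linarith)
    (by
      refine (dens_biUnion_le_cast _ _
        (f := fun s => (1 / 2) ^ s.1 * ((1 / 3) ^ s.2.1 * (1 / 5) ^ s.2.2)) ?_).trans ?_
      · rintro ⟨a, b, c⟩ h
        simp only [I, mem_product, mem_Ico] at h
        dsimp only
        rw [dens_prod, dens_prod, NNRat.cast_mul, NNRat.cast_mul, hA _ _ _ (by omega),
          hB _ _ _ (by omega), hC _ _ _ (by omega)]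
      · rw [sum_product]
        dsimp only
        rw [← sum_mul_sum, sum_product, ← sum_mul_sum]
        have := mul_le_mul sum₂₁ (mul_le_mul sum₃₁ sum₅₁ (by positivity) (by norm_num))
          (by positivity) (by norm_num)
        norm_num1 at this ⊢
        linarith)
  obtain ⟨x, hxi, hxj, hxk⟩ := exists_modEq_of_coprime
    (Nat.Coprime.pow N N (by norm_num : Nat.Coprime 2 3))
    (Nat.Coprime.pow N N (by norm_num : Nat.Coprime 2 5))
    (Nat.Coprime.pow N N (by norm_num : Nat.Coprime 3 5)) i j k
  refine ⟨x, fun a ha b hb c hc h10 hx => ?_⟩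
  have hi : i ∈ A a b c :=
    mem_residueClass_of_modEq ha ((Dvd.intro _ rfl).mul_right _) hxi hx
  have hj : j ∈ B a b c :=
    mem_residueClass_of_modEq hb ((Dvd.intro_left _ rfl).mul_right _) hxj hx
  have hk : k ∈ C a b c :=
    mem_residueClass_of_modEq hc (Dvd.intro_left _ rfl) hxk hx
  simp only [I, mem_biUnion, mem_erase, mem_product, mem_Ico, Prod.exists, Prod.mk.injEq, ne_eq,
    not_exists, not_and] at hP hQ hR hX hEF hY hZ hW
  rcases Nat.eq_zero_or_pos a with rfl | ha₀ <;> rcases Nat.eq_zero_or_pos b with rfl | hb₀ <;>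
    rcases Nat.eq_zero_or_pos c with rfl | hc₀
  · norm_num at h10
  · refine hR c ⟨?_, by omega⟩ hk
    by_contra!
    interval_cases c; norm_num at h10
  · refine hQ b ⟨?_, by omega⟩ hj
    by_contra!
    interval_cases b <;> norm_num at h10
  · exact hZ b c ⟨⟨hb₀, by omega⟩, hc₀, by omega⟩ hj hk
  · refine hP a ⟨?_, by omega⟩ hi
    by_contra!
    interval_cases a <;> norm_num at h10
  · by_cases h : a = 1 ∧ c = 1
    · obtain ⟨rfl, rfl⟩ := h
      exact hEF hi hk
    · exact hY a c (by omega) hi hk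
  · refine hX a b ⟨?_, by omega⟩ hi hj
    rintro rfl rfl
    norm_num at h10
  · exact hW a b c ⟨⟨ha₀, by omega⟩, ⟨hb₀, by omega⟩, hc₀, by omega⟩ hi hj hk

end FiveSmoothCovering

/-- If `C` is a distinct covering system (given by a finite set `S` of pairwise
distinct moduli, all `> 1`, and residues `r`) in which every modulus is of the
form `2^a * 3^b * 5^c`, then the least modulus `m` of `C` is at most `9`. -/
theorem min_modulus_le_nine_of_five_smooth (S : Finset ℕ) (r : ℕ → ℤ)
    (hmod : ∀ n ∈ S, 1 < n)
    (hcov : ∀ x : ℤ, ∃ n ∈ S, x ≡ r n [ZMOD (n : ℤ)])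
    (hsmooth : ∀ n ∈ S, ∃ a b c : ℕ, n = 2 ^ a * 3 ^ b * 5 ^ c)
    (m : ℕ) (hm : m ∈ S) (hmin : ∀ n ∈ S, m ≤ n) :
    m ≤ 9 := by
  by_contra! hm9
  have hexp {p k n d e : ℕ} (hp : 1 < p) (hn : n ≤ S.sup id) (h : n = p ^ k * (d * e))
      (hpos : 0 < n) : k ≤ S.sup id + 1 := by
    have h₁ : p ^ k ≤ n := Nat.le_of_dvd hpos (h ▸ Dvd.intro _ rfl)
    have h₂ := k.lt_pow_self hp
    omega
  obtain ⟨x, hx⟩ := FiveSmoothCovering.exists_not_modEq_of_five_smooth (S.sup id + 1) (by omega) r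
  obtain ⟨n, hn, hxn⟩ := hcov x
  obtain ⟨a, b, c, habc⟩ := hsmooth n hn
  have hle : n ≤ S.sup id := Finset.le_sup (f := id) hn
  have hpos : 0 < n := (hmod n hn).le
  have h10 : 10 ≤ n := hm9.trans_le (hmin n hn)
  subst habc
  exact hx a (hexp (by norm_num) hle (mul_assoc _ _ _) hpos)
    b (hexp (p := 3) (d := 2 ^ a) (e := 5 ^ c) (by norm_num) hle (by ring) hpos)
    c (hexp (p := 5) (d := 2 ^ a) (e := 3 ^ b) (by norm_num) hle (by ring) hpos) h10 hxn
end

section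
/- There exists a distinct covering system whose least modulus is 8 and whose moduli have least common multiple equal to 2^8·3^3·5^2 = 172800. -/
/-- The congruences `x ≡ a (mod n)`, listed as pairs `(n, a)`, of a covering system whose moduli are
all the divisors of `172800` that are at least `8`. -/
def coveringCongruences : List (ℕ × ℕ) :=
  [(8, 4), (9, 8), (10, 9), (12, 10), (15, 0), (16, 8), (18, 5), (20, 1), (24, 18), (25, 18),
   (27, 20), (30, 25), (32, 0), (36, 14), (40, 11), (45, 22), (48, 30), (50, 23), (54, 11),
   (60, 57), (64, 48), (72, 38), (75, 3), (80, 31), (90, 7), (96, 6), (100, 83), (108, 2),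
   (120, 27), (128, 16), (135, 110), (144, 54), (150, 63), (160, 71), (180, 127), (192, 183),
   (200, 33), (216, 146), (225, 163), (240, 207), (256, 80), (270, 137), (288, 150), (300, 103),
   (320, 151), (360, 37), (384, 208), (400, 133), (432, 246), (450, 313), (480, 327),
   (540, 217), (576, 534), (600, 253), (640, 631), (675, 488), (720, 217), (768, 720),
   (800, 333), (864, 822), (900, 463), (960, 87), (1080, 577), (1152, 848), (1200, 553),
   (1280, 311), (1350, 353), (1440, 913), (1600, 733), (1728, 1398), (1800, 13), (1920, 573),
   (2160, 2017), (2304, 464), (2400, 1153), (2700, 1136), (2880, 1393), (3200, 1533),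
   (3456, 2999), (3600, 2713), (3840, 3511), (4320, 433), (4800, 3913), (5400, 1153),
   (5760, 5713), (6400, 3953), (6912, 6313), (7200, 4513), (8640, 6032), (9600, 3133),
   (10800, 2713), (11520, 7633), (14400, 9533), (17280, 14353), (19200, 11953), (21600, 17113),
   (28800, 14353), (34560, 14833), (43200, 19153), (57600, 40753), (86400, 9911),
   (172800, 105553)]

/-- Decides whether the congruences in `cs` cover the residue class `a` modulo `m`, by splitting the
class successively into `p` subclasses for the entries `p` of a list, and discarding the congruences
that are incompatible with the class under consideration. -/
def coversClass : List ℕ → ℕ → ℕ → List (ℕ × ℕ) → Bool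
  | [], m, a, cs => cs.any fun c => m % c.1 == 0 && a % c.1 == c.2 % c.1
  | p :: ps, m, a, cs =>
    (cs.any fun c => m % c.1 == 0 && a % c.1 == c.2 % c.1) ||
      (p != 0 && (List.range p).all fun i =>
        coversClass ps (m * p) (a + m * i)
          (cs.filter fun c =>
            (a + m * i) % (m * p).gcd c.1 == c.2 % (m * p).gcd c.1))

theorem exists_modEq_of_any {m a : ℕ} {cs : List (ℕ × ℕ)}
    (h : (cs.any fun c => m % c.1 == 0 && a % c.1 == c.2 % c.1) = true) (t : ℤ) :
    ∃ c ∈ cs, a + m * t ≡ c.2 [ZMOD c.1] := by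
  simp only [List.any_eq_true, Bool.and_eq_true, beq_iff_eq] at h
  obtain ⟨c, hc, hm, ha⟩ := h
  have hm' : (m : ℤ) * t ≡ 0 [ZMOD c.1] :=
    Int.modEq_zero_iff_dvd.2 ((Int.natCast_dvd_natCast.2 (Nat.dvd_of_mod_eq_zero hm)).mul_right t)
  have ha' : (a : ℤ) ≡ c.2 [ZMOD c.1] := Int.natCast_modEq_iff.2 ha
  exact ⟨c, hc, by simpa using ha'.add hm'⟩

theorem exists_modEq_of_coversClass (ps : List ℕ) {m a : ℕ} {cs : List (ℕ × ℕ)}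
    (h : coversClass ps m a cs = true) (t : ℤ) :
    ∃ c ∈ cs, a + m * t ≡ c.2 [ZMOD c.1] := by
  induction ps generalizing m a cs t with
  | nil => exact exists_modEq_of_any h t
  | cons p ps ih =>
    rw [coversClass, Bool.or_eq_true] at h
    rcases h with h | h
    · exact exists_modEq_of_any h t
    · simp only [Bool.and_eq_true, bne_iff_ne, List.all_eq_true, List.mem_range] at h
      obtain ⟨hp, h⟩ := h
      have hp' : (0 : ℤ) < p := by exact_mod_cast Nat.pos_of_ne_zero hp
      obtain ⟨i, hi⟩ := Int.eq_ofNat_of_zero_le (Int.emod_nonneg t hp'.ne')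
      have hip : i < p := by exact_mod_cast hi ▸ Int.emod_lt_of_pos t hp'
      obtain ⟨c, hc, hct⟩ := ih (h i hip) (t / p)
      refine ⟨c, List.mem_of_mem_filter hc, ?_⟩
      have ht : t = i + p * (t / p) := by rw [← hi, Int.emod_add_mul_ediv]
      have hx : (a : ℤ) + m * t = (a + m * i : ℕ) + (m * p : ℕ) * (t / p) := by
        push_cast
        linear_combination (m : ℤ) * ht
      rwa [hx]

theorem coversClass_coveringCongruences :
    coversClass [3, 2, 3, 2, 5, 2, 2, 2, 3, 5, 2, 2, 2] 1 0 coveringCongruences = true := by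
  decide +kernel


/-- There exists a distinct covering system whose least modulus is 8 and whose moduli have least common multiple 2^8 * 3^3 * 5^2 = 172800. -/
theorem exists_covering_m8_L172800 :
    ∃ (S : Finset ℕ) (r : ℕ → ℤ),
      (∀ n ∈ S, 1 < n) ∧
      (∀ x : ℤ, ∃ n ∈ S, x ≡ r n [ZMOD (n : ℤ)]) ∧
      (8 ∈ S ∧ ∀ n ∈ S, 8 ≤ n) ∧
      S.lcm id = 2 ^ 8 * 3 ^ 3 * 5 ^ 2 := by
  have hmod : ∀ n ∈ (coveringCongruences.map Prod.fst).toFinset, 8 ≤ n ∧ n ∣ 172800 := by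
    simp only [List.mem_toFinset]
    decide +kernel
  have hres : ∀ c ∈ coveringCongruences, (coveringCongruences.lookup c.1).getD 0 = c.2 := by
    decide +kernel
  have hmem : ∀ c ∈ coveringCongruences, c.1 ∈ (coveringCongruences.map Prod.fst).toFinset :=
    fun c hc => List.mem_toFinset.2 (List.mem_map_of_mem hc)
  refine ⟨(coveringCongruences.map Prod.fst).toFinset,
    fun n => ((coveringCongruences.lookup n).getD 0 : ℕ),
    fun n hn => by have := (hmod n hn).1; omega, fun x => ?_,
    ⟨hmem (8, 4) (by decide +kernel), fun n hn => (hmod n hn).1⟩, ?_⟩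
  · obtain ⟨c, hc, hx⟩ := exists_modEq_of_coversClass _ coversClass_coveringCongruences x
    refine ⟨c.1, hmem c hc, ?_⟩
    simpa only [hres c hc, Nat.cast_zero, Nat.cast_one, zero_add, one_mul] using hx
  · norm_num only
    exact Nat.dvd_antisymm (Finset.lcm_dvd fun n hn => (hmod n hn).2)
      (Finset.dvd_lcm (f := id) (hmem (172800, 105553) (by decide +kernel)))
end

section
/- There exists an infinite sequence of congruences x ≡ r_k (mod n_k), k = 1, 2, ..., with pairwise distinct moduli n_k, each of the form 2^u·3^v·5^w with u, v, w nonnegative integers satisfying v ≤ 2 and w ≤ 1, whose least modulus is 6 (every n_k ≥ 6 and 6 occurs among the moduli), such that every integer satisfies at least one of the congruences, and moreover, writing g(k) = lcm(n_1, ..., n_k) and f(k) = #{x : 0 ≤ x < g(k), x satisfies at least one of the first k congruences}, one has f(k)/g(k) → 1 as k → ∞. -/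
/-- The moduli of the finite part of the covering. -/
def baseModulus : Fin 19 → ℕ :=
  ![8, 6, 12, 24, 9, 18, 36, 72, 10, 20, 40, 15, 30, 60, 120, 45, 90, 180, 360]

/-- The residues of the finite part of the covering. -/
def baseResidue : Fin 19 → ℕ :=
  ![1, 0, 10, 16, 2, 14, 26, 8, 7, 19, 31, 0, 13, 55, 63, 5, 35, 143, 203]

/-- The odd parts of the moduli: the divisors of `45`. -/
def oddPart : Fin 6 → ℕ := ![1, 3, 9, 5, 15, 45]

/-- The class `holeResidue i` modulo `8 * oddPart i` is missed by the finite part and is covered by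
infinitely many congruences. -/
def holeResidue : Fin 6 → ℕ := ![5, 4, 44, 11, 3, 23]

/-- The partial sums `1 + 4 + ⋯ + 4 ^ (j - 1)`, which converge to `-1/3` in the `2`-adic
integers. -/
def thirdApprox (j : ℕ) : ℤ := ∑ i ∈ Finset.range j, 4 ^ i

/-- The moduli of the covering, indexed by the finite part and the six infinite chains. -/
def coverModulus : Fin 19 ⊕ ℕ × Fin 6 → ℕ
  | .inl b => baseModulus b
  | .inr (j, i) => 8 * oddPart i * 2 ^ (j + 1)

/-- The residues of the covering. -/
def coverResidue : Fin 19 ⊕ ℕ × Fin 6 → ℤ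
  | .inl b => baseResidue b
  | .inr (j, i) => holeResidue i + 8 * oddPart i * (thirdApprox (j + 1) + 2 ^ j)

theorem three_mul_thirdApprox_add_one (j : ℕ) : 3 * thirdApprox j + 1 = 4 ^ j := by
  induction j with
  | zero => simp [thirdApprox]
  | succ j ih =>
    rw [thirdApprox, Finset.sum_range_succ, ← thirdApprox]
    linear_combination ih

/-- An integer avoiding the first `J` classes of the binary chain is close to `-1/3`. -/
theorem modEq_thirdApprox_of_avoids {y : ℤ} (J : ℕ)
    (h : ∀ j < J, ¬ y ≡ thirdApprox (j + 1) + 2 ^ j [ZMOD 2 ^ (j + 1)]) :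
    y ≡ thirdApprox J [ZMOD 2 ^ J] := by
  induction J with
  | zero => simp [Int.modEq_one]
  | succ J ih =>
    obtain ⟨q, hq⟩ := (ih fun j hj => h j (by omega)).symm.dvd
    have hstep : thirdApprox (J + 1) = thirdApprox J + 2 ^ J * 2 ^ J := by
      rw [thirdApprox, Finset.sum_range_succ, ← thirdApprox, ← mul_pow]
      norm_num
    rcases Int.even_or_odd' (q - 2 ^ J) with ⟨m, hm | hm⟩
    · refine (Int.modEq_iff_dvd.2 ⟨m, ?_⟩).symm
      rw [hstep, pow_succ]
      linear_combination hq + 2 ^ J * hm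
    · refine absurd (Int.modEq_iff_dvd.2 ⟨m, ?_⟩).symm (h J (by omega))
      rw [hstep, pow_succ]
      linear_combination hq + 2 ^ J * hm

/-- The binary chain covers every integer. -/
theorem exists_modEq_thirdApprox_add (y : ℤ) :
    ∃ j, y ≡ thirdApprox (j + 1) + 2 ^ j [ZMOD 2 ^ (j + 1)] := by
  by_contra! h
  have hdvd (J : ℕ) : (2 : ℤ) ^ J ∣ 3 * y + 1 := by
    have h1 := (modEq_thirdApprox_of_avoids J fun j _ => h j).symm.dvd
    have h2 : (2 : ℤ) ^ J ∣ 4 ^ J := pow_dvd_pow_of_dvd (by norm_num) J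
    rw [← three_mul_thirdApprox_add_one] at h2
    have h3 := (h1.mul_left 3).add h2
    ring_nf at h3 ⊢
    exact h3
  have hlt : (3 * y + 1).natAbs < 2 ^ (3 * y + 1).natAbs := Nat.lt_two_pow_self
  have hz : 3 * y + 1 = 0 :=
    Int.eq_zero_of_abs_lt_dvd (hdvd (3 * y + 1).natAbs) (by
      rw [Int.abs_eq_natAbs]; exact_mod_cast hlt)
  omega

theorem baseModulus_dvd (b : Fin 19) : baseModulus b ∣ 360 := by
  revert b; decide

theorem eight_mul_oddPart_dvd (i : Fin 6) : 8 * oddPart i ∣ 360 := by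
  revert i; decide

theorem base_or_hole_of_lt :
    ∀ x < 360, (∃ b, x ≡ baseResidue b [MOD baseModulus b]) ∨
      ∃ i, x ≡ holeResidue i [MOD 8 * oddPart i] := by
  decide +kernel

/-- Every integer is covered by the finite part or lies in one of the six holes. -/
theorem base_or_hole (x : ℤ) :
    (∃ b, x ≡ baseResidue b [ZMOD baseModulus b]) ∨
      ∃ i, x ≡ holeResidue i [ZMOD (8 * oddPart i : ℕ)] := by
  obtain ⟨y, hy⟩ := Int.eq_ofNat_of_zero_le (Int.emod_nonneg x (by norm_num : (360 : ℤ) ≠ 0))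
  have hlt : y < 360 := by have := Int.emod_lt_of_pos x (by norm_num : (0 : ℤ) < 360); omega
  have hxy : x ≡ y [ZMOD (360 : ℕ)] := by rw [← hy]; exact (Int.mod_modEq x 360).symm
  refine (base_or_hole_of_lt y hlt).imp ?_ ?_
  · rintro ⟨b, hb⟩
    exact ⟨b, (hxy.of_dvd (Int.natCast_dvd_natCast.2 (baseModulus_dvd b))).trans
      (Int.natCast_modEq_iff.2 hb)⟩
  · rintro ⟨i, hi⟩
    exact ⟨i, (hxy.of_dvd (Int.natCast_dvd_natCast.2 (eight_mul_oddPart_dvd i))).trans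
      (Int.natCast_modEq_iff.2 hi)⟩

/-- Chain congruences for `x = c + m * y` amount to congruences for `y`. -/
theorem modEq_coverResidue_inr {i : Fin 6} {y : ℤ} {j : ℕ}
    (h : y ≡ thirdApprox (j + 1) + 2 ^ j [ZMOD 2 ^ (j + 1)]) :
    holeResidue i + 8 * oddPart i * y ≡ coverResidue (.inr (j, i))
      [ZMOD coverModulus (.inr (j, i))] := by
  have := (h.mul_left' (c := 8 * (oddPart i : ℤ))).add_left (holeResidue i : ℤ)
  simpa [coverModulus, coverResidue] using this

theorem exists_eq_of_hole {x : ℤ} {i : Fin 6}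
    (h : x ≡ holeResidue i [ZMOD (8 * oddPart i : ℕ)]) :
    ∃ y : ℤ, x = holeResidue i + 8 * oddPart i * y := by
  obtain ⟨y, hy⟩ := h.symm.dvd
  refine ⟨y, ?_⟩
  push_cast at hy
  linear_combination hy

theorem exists_modEq_coverResidue (x : ℤ) : ∃ a, x ≡ coverResidue a [ZMOD coverModulus a] := by
  rcases base_or_hole x with ⟨b, hb⟩ | ⟨i, hi⟩
  · exact ⟨.inl b, hb⟩
  · obtain ⟨y, rfl⟩ := exists_eq_of_hole hi
    obtain ⟨j, hj⟩ := exists_modEq_thirdApprox_add y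
    exact ⟨.inr (j, i), modEq_coverResidue_inr hj⟩

/-- An integer missed by the finite part and by the first `J + 1` members of every chain lies in one
of six classes whose moduli are those of the last members used. -/
theorem exists_modEq_of_avoids {x : ℤ} (J : ℕ)
    (hb : ∀ b, ¬ x ≡ coverResidue (.inl b) [ZMOD coverModulus (.inl b)])
    (hc : ∀ j ≤ J, ∀ i, ¬ x ≡ coverResidue (.inr (j, i)) [ZMOD coverModulus (.inr (j, i))]) :
    ∃ i, x ≡ holeResidue i + 8 * oddPart i * thirdApprox (J + 1)
      [ZMOD coverModulus (.inr (J, i))] := by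
  rcases base_or_hole x with ⟨b, h⟩ | ⟨i, hi⟩
  · exact absurd h (hb b)
  · obtain ⟨y, rfl⟩ := exists_eq_of_hole hi
    have hy := modEq_thirdApprox_of_avoids (J + 1) fun j hj h =>
      hc j (by omega) i (modEq_coverResidue_inr h)
    refine ⟨i, ?_⟩
    have := (hy.mul_left' (c := 8 * (oddPart i : ℤ))).add_left (holeResidue i : ℤ)
    simpa [coverModulus] using this

theorem oddPart_pos (i : Fin 6) : 0 < oddPart i := by
  revert i; decide

theorem coprime_oddPart (i : Fin 6) (a : ℕ) : (oddPart i).Coprime (2 ^ a) := by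
  refine Nat.Coprime.pow_right a ?_
  revert i; decide

theorem oddPart_injective : Function.Injective oddPart := by decide

theorem baseModulus_injective : Function.Injective baseModulus := by decide +kernel

theorem baseModulus_ne_chain (b : Fin 19) (j : ℕ) (i : Fin 6) :
    baseModulus b ≠ 8 * oddPart i * 2 ^ (j + 1) := by
  intro h
  have h16 : 16 ∣ 360 := (Dvd.intro (oddPart i * 2 ^ j) (by rw [h]; ring)).trans (baseModulus_dvd b)
  omega

theorem coverModulus_injective : Function.Injective coverModulus := by
  rintro (b | ⟨j, i⟩) (b' | ⟨j', i'⟩) h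
  · exact congrArg _ (baseModulus_injective h)
  · exact absurd h (baseModulus_ne_chain b j' i')
  · exact absurd h.symm (baseModulus_ne_chain b' j i)
  · have h' : oddPart i * 2 ^ (j + 1) = oddPart i' * 2 ^ (j' + 1) := by
      simpa [coverModulus, mul_assoc] using h
    have hi : i = i' := oddPart_injective <| Nat.dvd_antisymm
      ((coprime_oddPart i _).dvd_of_dvd_mul_right (Dvd.intro _ h'))
      ((coprime_oddPart i' _).dvd_of_dvd_mul_right (Dvd.intro _ h'.symm))
    subst hi
    have := Nat.pow_right_injective le_rfl (Nat.eq_of_mul_eq_mul_left (oddPart_pos i) h')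
    simp_all

theorem baseModulus_eq (b : Fin 19) :
    ∃ u ≤ 3, ∃ v ≤ 2, ∃ w ≤ 1, baseModulus b = 2 ^ u * 3 ^ v * 5 ^ w := by
  revert b; decide +kernel

theorem oddPart_eq (i : Fin 6) : ∃ v ≤ 2, ∃ w ≤ 1, oddPart i = 3 ^ v * 5 ^ w := by
  revert i; decide +kernel

theorem coverModulus_eq (a : Fin 19 ⊕ ℕ × Fin 6) :
    ∃ u v w : ℕ, v ≤ 2 ∧ w ≤ 1 ∧ coverModulus a = 2 ^ u * 3 ^ v * 5 ^ w := by
  rcases a with b | ⟨j, i⟩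
  · obtain ⟨u, -, v, hv, w, hw, h⟩ := baseModulus_eq b
    exact ⟨u, v, w, hv, hw, h⟩
  · obtain ⟨v, hv, w, hw, h⟩ := oddPart_eq i
    exact ⟨j + 4, v, w, hv, hw, by rw [coverModulus, h]; ring⟩

theorem coverModulus_inr_ge (j : ℕ) (i : Fin 6) : 8 * 2 ^ j ≤ coverModulus (.inr (j, i)) := by
  rw [coverModulus, mul_assoc]
  exact Nat.mul_le_mul_left 8 ((Nat.pow_le_pow_right two_pos j.le_succ).trans
    (Nat.le_mul_of_pos_left _ (oddPart_pos i)))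

theorem six_le_coverModulus (a : Fin 19 ⊕ ℕ × Fin 6) : 6 ≤ coverModulus a := by
  rcases a with b | ⟨j, i⟩
  · change 6 ≤ baseModulus b
    revert b; decide
  · have := coverModulus_inr_ge j i
    have := Nat.one_le_two_pow (n := j)
    omega

/-- A residue class modulo `m` has density `1 / m` in `{0, …, g - 1}` when `m ∣ g`. -/
theorem card_filter_modEq_mul {g m : ℕ} (hm : 0 < m) (h : m ∣ g) (a : ℤ) :
    ((Finset.range g).filter fun x : ℕ => (x : ℤ) ≡ a [ZMOD m]).card * m = g := by
  obtain ⟨t, rfl⟩ := h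
  have hc := Int.Ico_filter_modEq_card 0 ((m * t : ℕ) : ℤ) (r := m) (by exact_mod_cast hm) a
  have hm' : (m : ℚ) ≠ 0 := by positivity
  have hceil : ⌈(((m * t : ℕ) : ℤ) - a : ℚ) / ((m : ℤ) : ℚ)⌉ =
      ⌈(((0 : ℤ) : ℚ) - a) / ((m : ℤ) : ℚ)⌉ + t := by
    rw [← Int.ceil_add_natCast]
    congr 1
    push_cast
    field_simp
    ring
  rw [hceil] at hc
  have himg : ((Finset.range (m * t)).filter fun x : ℕ => (x : ℤ) ≡ a [ZMOD m]).card =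
      ((Finset.Ico (0 : ℤ) ((m * t : ℕ) : ℤ)).filter fun x => x ≡ a [ZMOD m]).card := by
    refine Finset.card_bij (fun x _ => (x : ℤ)) ?_ (fun _ _ _ _ h => by exact_mod_cast h) ?_
    · intro x hx
      simp only [Finset.mem_filter, Finset.mem_range, Finset.mem_Ico] at hx ⊢
      exact ⟨⟨by positivity, by exact_mod_cast hx.1⟩, hx.2⟩
    · intro y hy
      simp only [Finset.mem_filter, Finset.mem_Ico] at hy
      lift y to ℕ using hy.1.1
      exact ⟨y, by simpa using ⟨by exact_mod_cast hy.1.2, hy.2⟩, rfl⟩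
  have : ((Finset.range (m * t)).filter fun x : ℕ => (x : ℤ) ≡ a [ZMOD m]).card = t := by
    rw [himg]
    have : (0 : ℤ) ≤ t := by positivity
    omega
  rw [this, mul_comm]

/-- If everything missed by the congruences with index below `k` lies in a class modulo `m i` for
one of finitely many `i`, where each `m i ≥ M` divides `g`, then the missed set has at most
`card ι * g / M` elements in `{0, …, g - 1}`. -/
theorem card_missed_mul_le {ι : Type*} [Fintype ι] {g M : ℕ} (p : ℕ → Prop) [DecidablePred p]
    (m : ι → ℕ) (a : ι → ℤ) (hM : 0 < M) (hm : ∀ i, M ≤ m i) (hg : ∀ i, m i ∣ g)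
    (hp : ∀ x, ¬ p x → ∃ i, (x : ℤ) ≡ a i [ZMOD m i]) :
    ((Finset.range g).filter fun x => ¬ p x).card * M ≤ Fintype.card ι * g := by
  classical
  have hsub : ((Finset.range g).filter fun x => ¬ p x) ⊆ Finset.univ.biUnion fun i =>
      (Finset.range g).filter fun x : ℕ => (x : ℤ) ≡ a i [ZMOD m i] := by
    intro x hx
    simp only [Finset.mem_filter] at hx
    obtain ⟨i, hi⟩ := hp x hx.2
    simp only [Finset.mem_biUnion, Finset.mem_filter]
    exact ⟨i, Finset.mem_univ i, hx.1, hi⟩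
  calc _ ≤ (∑ i, ((Finset.range g).filter fun x : ℕ => (x : ℤ) ≡ a i [ZMOD m i]).card) * M :=
        Nat.mul_le_mul_right _ ((Finset.card_le_card hsub).trans Finset.card_biUnion_le)
    _ = ∑ i, ((Finset.range g).filter fun x : ℕ => (x : ℤ) ≡ a i [ZMOD m i]).card * M :=
        Finset.sum_mul ..
    _ ≤ ∑ _i : ι, g := Finset.sum_le_sum fun i _ =>
        (Nat.mul_le_mul_left _ (hm i)).trans
          (card_filter_modEq_mul (hM.trans_le (hm i)) (hg i) (a i)).le
    _ = Fintype.card ι * g := by simp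

/-- The density covered by initial segments tends to `1`, for any enumeration of the covering. -/
theorem tendsto_density (e : ℕ ≃ Fin 19 ⊕ ℕ × Fin 6) :
    Filter.Tendsto
      (fun k =>
        ((((Finset.range ((Finset.range k).lcm fun l => coverModulus (e l))).filter
              (fun x : ℕ => ∃ i < k,
                (x : ℤ) ≡ coverResidue (e i) [ZMOD (coverModulus (e i) : ℤ)])).card : ℝ)
          / (((Finset.range k).lcm fun l => coverModulus (e l) : ℕ) : ℝ)))
      Filter.atTop (nhds 1) := by
  classical
  rw [Metric.tendsto_atTop]
  intro ε hε
  obtain ⟨J, hJ⟩ := exists_pow_lt_of_lt_one hε (by norm_num : (1 / 2 : ℝ) < 1)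
  obtain ⟨K, hK⟩ : ∃ K, ∀ a ∈ (Finset.univ.disjSum (Finset.range (J + 1) ×ˢ Finset.univ) :
      Finset (Fin 19 ⊕ ℕ × Fin 6)), e.symm a < K :=
    ⟨_, fun a ha => Nat.lt_succ_of_le (Finset.le_sup (f := e.symm) ha)⟩
  refine ⟨K, fun k hk => ?_⟩
  have hb (b : Fin 19) : e.symm (.inl b) < k := (hK _ (by simp)).trans_le hk
  have hc (j : ℕ) (hj : j ≤ J) (i : Fin 6) : e.symm (.inr (j, i)) < k :=
    (hK _ (by simpa [Nat.lt_succ_iff] using hj)).trans_le hk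
  set g := (Finset.range k).lcm fun l => coverModulus (e l) with hg
  set p : ℕ → Prop := fun x =>
    ∃ i < k, (x : ℤ) ≡ coverResidue (e i) [ZMOD (coverModulus (e i) : ℤ)]
  have hgpos : 0 < g := Nat.pos_of_ne_zero fun h => by
    rw [hg, Finset.lcm_eq_zero_iff] at h
    obtain ⟨l, -, hl⟩ := h
    have := six_le_coverModulus (e l)
    omega
  have hcard := card_missed_mul_le (ι := Fin 6) (g := g) (M := 8 * 2 ^ J) p
    (fun i => coverModulus (.inr (J, i)))
    (fun i => holeResidue i + 8 * oddPart i * thirdApprox (J + 1)) (by positivity)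
    (coverModulus_inr_ge J)
    (fun i => by
      have := Finset.dvd_lcm (f := fun l => coverModulus (e l))
        (Finset.mem_range.2 (hc J le_rfl i))
      simpa using this)
    (fun x hx => exists_modEq_of_avoids J
      (fun b h => hx ⟨_, hb b, by simpa using h⟩)
      (fun j hj i h => hx ⟨_, hc j hj i, by simpa using h⟩))
  have hsum := Finset.card_filter_add_card_filter_not (s := Finset.range g) p
  rw [Finset.card_range] at hsum
  set A := ((Finset.range g).filter p).card
  set B := ((Finset.range g).filter fun x => ¬ p x).card
  have hsum' : (A : ℝ) + B = g := by exact_mod_cast hsum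
  have hcard' : (B : ℝ) * (8 * 2 ^ J) ≤ 6 * g := by simpa using (by exact_mod_cast hcard :
    (B : ℝ) * (8 * 2 ^ J) ≤ Fintype.card (Fin 6) * g)
  have hg' : (0 : ℝ) < g := by exact_mod_cast hgpos
  have hdist : (A : ℝ) / g - 1 = -(B / g) := by
    field_simp
    linarith
  rw [Real.dist_eq, hdist, abs_neg, abs_of_nonneg (by positivity)]
  refine lt_of_le_of_lt ?_ hJ
  rw [one_div, inv_pow, ← one_div, div_le_div_iff₀ hg' (by positivity)]
  linarith

/-- There is a strong distinct infinite covering system with least modulus `6`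
whose moduli are all of the form `2^u * 3^v * 5^w` with `v ≤ 2` and `w ≤ 1`:
an infinite sequence of congruences `x ≡ r k (mod n k)` with pairwise distinct
moduli of the stated form, with all moduli at least `6` and `6` occurring among
them, covering every integer, and such that, writing
`g k = lcm (n 0, …, n (k-1))` and `f k` for the number of `x ∈ {0, …, g k - 1}`
satisfying at least one of the first `k` congruences, `f k / g k → 1`. -/
theorem exists_strong_infinite_covering_m6 :
    ∃ (n : ℕ → ℕ) (r : ℕ → ℤ),
      Function.Injective n ∧
      (∀ k, ∃ u v w : ℕ, v ≤ 2 ∧ w ≤ 1 ∧ n k = 2 ^ u * 3 ^ v * 5 ^ w) ∧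
      (∀ k, 6 ≤ n k) ∧ (∃ k, n k = 6) ∧
      (∀ x : ℤ, ∃ k, x ≡ r k [ZMOD (n k : ℤ)]) ∧
      Filter.Tendsto
        (fun k =>
          ((((Finset.range ((Finset.range k).lcm n)).filter
                (fun x : ℕ => ∃ i < k, (x : ℤ) ≡ r i [ZMOD (n i : ℤ)])).card : ℝ)
            / (((Finset.range k).lcm n : ℕ) : ℝ)))
        Filter.atTop (nhds 1) := by
  obtain ⟨e⟩ : Nonempty (ℕ ≃ Fin 19 ⊕ ℕ × Fin 6) := inferInstance
  refine ⟨fun k => coverModulus (e k), fun k => coverResidue (e k),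
    coverModulus_injective.comp e.injective, fun k => coverModulus_eq (e k),
    fun k => six_le_coverModulus (e k), ⟨e.symm (.inl 1), by simp [coverModulus, baseModulus]⟩,
    fun x => ?_, ?_⟩
  · obtain ⟨a, ha⟩ := exists_modEq_coverResidue x
    exact ⟨e.symm a, by simpa using ha⟩
  · convert tendsto_density e
end

section
/- If C is a distinct covering system with least modulus 2 whose moduli have least common multiple L = 2^a·3^b·5^c, where a, b, c are positive integers with a ≥ b ≥ c, then a ≥ 2. -/
/-- Fewer than `p` residue classes modulo `p` cannot cover the integers. -/
theorem exists_forall_not_modEq {ι : Type*} (T : Finset ι) (r : ι → ℤ) (p : ℕ)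
    (hT : T.card < p) : ∃ w : ℤ, ∀ i ∈ T, ¬ w ≡ r i [ZMOD (p : ℤ)] := by
  have : NeZero p := ⟨by omega⟩
  have hcard : (T.image fun i => (r i : ZMod p)).card < Fintype.card (ZMod p) := by
    rw [ZMod.card]
    exact Finset.card_image_le.trans_lt hT
  obtain ⟨z, hz⟩ : ∃ z, z ∉ T.image fun i => (r i : ZMod p) := by
    by_contra! h
    rw [Finset.eq_univ_iff_forall.mpr h, Finset.card_univ] at hcard
    exact lt_irrefl _ hcard
  obtain ⟨w, rfl⟩ := ZMod.intCast_surjective z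
  refine ⟨w, fun i hi hw => hz (Finset.mem_image.mpr ⟨i, hi, ?_⟩)⟩
  exact ((ZMod.intCast_eq_intCast_iff w (r i) p).mpr hw).symm

/-- Distinct moduli greater than 1 that divide 30 cannot form a covering system. -/
theorem exists_not_modEq_of_dvd_thirty (r : ℕ → ℤ) :
    ∃ x : ℤ, ∀ n : ℕ, 1 < n → n ∣ 30 → ¬ x ≡ r n [ZMOD (n : ℤ)] := by
  obtain ⟨u, hu⟩ := exists_forall_not_modEq {2} r 2 (by decide)
  obtain ⟨v, hv⟩ := exists_forall_not_modEq {3, 6} r 3 (by decide)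
  obtain ⟨w, hw⟩ := exists_forall_not_modEq {5, 10, 15, 30} r 5 (by decide)
  have hu' : 15 * u + 10 * v + 6 * w ≡ u [ZMOD (2 : ℕ)] := by
    rw [Int.ModEq]; omega
  have hv' : 15 * u + 10 * v + 6 * w ≡ v [ZMOD (3 : ℕ)] := by
    rw [Int.ModEq]; omega
  have hw' : 15 * u + 10 * v + 6 * w ≡ w [ZMOD (5 : ℕ)] := by
    rw [Int.ModEq]; omega
  refine ⟨15 * u + 10 * v + 6 * w, fun n hn hdvd h => ?_⟩
  have reduce {p : ℕ} (hp : p ∣ n) := h.of_dvd (Int.natCast_dvd_natCast.mpr hp)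
  have hmem : n ∈ Nat.divisors 30 := Nat.mem_divisors.mpr ⟨hdvd, by decide⟩
  rw [show Nat.divisors 30 = {1, 2, 3, 5, 6, 10, 15, 30} by decide] at hmem
  simp only [Finset.mem_insert, Finset.mem_singleton] at hmem
  rcases hmem with rfl | rfl | rfl | rfl | rfl | rfl | rfl | rfl
  · exact absurd hn (lt_irrefl 1)
  · exact hu _ (by decide) (hu'.symm.trans (reduce (by decide)))
  · exact hv _ (by decide) (hv'.symm.trans (reduce (by decide)))
  · exact hw _ (by decide) (hw'.symm.trans (reduce (by decide)))
  · exact hv _ (by decide) (hv'.symm.trans (reduce (by decide)))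
  · exact hw _ (by decide) (hw'.symm.trans (reduce (by decide)))
  · exact hw _ (by decide) (hw'.symm.trans (reduce (by decide)))
  · exact hw _ (by decide) (hw'.symm.trans (reduce (by decide)))

/-- If C is a distinct covering system with least modulus 2 whose moduli have lcm 2^a * 3^b * 5^c with a ≥ b ≥ c ≥ 1, then a ≥ 2. -/
theorem m2_implies_a_ge_two (S : Finset ℕ) (r : ℕ → ℤ) (a b c : ℕ)
    (hmod : ∀ n ∈ S, 1 < n)
    (hcov : ∀ x : ℤ, ∃ n ∈ S, x ≡ r n [ZMOD (n : ℤ)])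
    (hm : 2 ∈ S) (hmin : ∀ n ∈ S, 2 ≤ n)
    (hlcm : S.lcm id = 2 ^ a * 3 ^ b * 5 ^ c)
    (ha : 1 ≤ a) (hb : 1 ≤ b) (hc : 1 ≤ c) (hab : b ≤ a) (hbc : c ≤ b) :
    2 ≤ a := by
  by_contra! ha'
  obtain rfl : a = 1 := by omega
  obtain rfl : b = 1 := by omega
  obtain rfl : c = 1 := by omega
  obtain ⟨x, hx⟩ := exists_not_modEq_of_dvd_thirty r
  obtain ⟨n, hn, hxn⟩ := hcov x
  refine hx n (hmod n hn) ?_ hxn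
  simpa [hlcm] using Finset.dvd_lcm (f := id) hn
end

section
/- If C is a distinct covering system with least modulus 3 whose moduli have least common multiple L = 2^a·3^b·5^c, where a, b, c are positive integers with a ≥ b ≥ c, and if a = 2, then b ≥ 2. -/
/-- The residues modulo `60` that are divisible by none of `3`, `4` and `5`. -/
def sieved : Finset ℕ :=
  (Finset.range 60).filter fun x => x % 3 ≠ 0 ∧ x % 4 ≠ 0 ∧ x % 5 ≠ 0

/-- The members of `sieved` in the residue class of `q` modulo `n`. -/
def sievedClass (n q : ℕ) : Finset ℕ :=
  sieved.filter fun x => x % n = q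

theorem card_sieved : sieved.card = 24 := by decide

/-- Although the classes modulo `6` and `10` can have `8` and `4` elements respectively,
they then overlap, so they never have more than `10` elements together. -/
theorem card_sievedClass_six_union_ten :
    ∀ p < 6, ∀ q < 10, (sievedClass 6 p ∪ sievedClass 10 q).card ≤ 10 := by decide

theorem card_sievedClass_twelve : ∀ q < 12, (sievedClass 12 q).card ≤ 4 := by decide

theorem card_sievedClass_fifteen : ∀ q < 15, (sievedClass 15 q).card ≤ 3 := by decide

theorem card_sievedClass_twenty : ∀ q < 20, (sievedClass 20 q).card ≤ 2 := by decide

theorem card_sievedClass_thirty : ∀ q < 30, (sievedClass 30 q).card ≤ 2 := by decide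

theorem card_sievedClass_sixty : ∀ q < 60, (sievedClass 60 q).card ≤ 1 := by decide

/-- Residue classes modulo `6, 10, 12, 15, 20, 30, 60` do not cover `sieved`. -/
theorem exists_mem_sieved_not_covered (q : ℕ → ℕ) (hq : ∀ n, 0 < n → q n < n) :
    ∃ x ∈ sieved, ∀ n ∈ ({6, 10, 12, 15, 20, 30, 60} : Finset ℕ), x % n ≠ q n := by
  by_contra! h
  have hsub : sieved ⊆ sievedClass 6 (q 6) ∪ sievedClass 10 (q 10) ∪ sievedClass 12 (q 12) ∪
      sievedClass 15 (q 15) ∪ sievedClass 20 (q 20) ∪ sievedClass 30 (q 30) ∪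
      sievedClass 60 (q 60) := by
    intro x hx
    obtain ⟨n, hn, hxn⟩ := h x hx
    have hmem : x ∈ sievedClass n (q n) := Finset.mem_filter.mpr ⟨hx, hxn⟩
    simp only [Finset.mem_insert, Finset.mem_singleton] at hn
    simp only [Finset.mem_union]
    rcases hn with rfl | rfl | rfl | rfl | rfl | rfl | rfl <;> simp only [hmem, true_or, or_true]
  have hcard := Finset.card_le_card hsub
  have h6 := card_sievedClass_six_union_ten _ (hq 6 (by norm_num)) _ (hq 10 (by norm_num))
  have h12 := card_sievedClass_twelve _ (hq 12 (by norm_num))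
  have h15 := card_sievedClass_fifteen _ (hq 15 (by norm_num))
  have h20 := card_sievedClass_twenty _ (hq 20 (by norm_num))
  have h30 := card_sievedClass_thirty _ (hq 30 (by norm_num))
  have h60 := card_sievedClass_sixty _ (hq 60 (by norm_num))
  rw [card_sieved] at hcard
  grw [Finset.card_union_le, Finset.card_union_le, Finset.card_union_le, Finset.card_union_le,
    Finset.card_union_le, h6, h12, h15, h20, h30, h60] at hcard
  omega

/-- The divisors of `60` that are at least `3` are not the moduli of a distinct covering system. -/
theorem exists_not_modEq_of_dvd_sixty (r : ℕ → ℤ) :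
    ∃ x : ℤ, ∀ n : ℕ, n ∣ 60 → 3 ≤ n → ¬ x ≡ r n [ZMOD (n : ℤ)] := by
  -- By the Chinese remainder theorem, translate so that the classes modulo 3, 4, 5 contain 0.
  obtain ⟨t, ht⟩ : ∃ t, t = 40 * r 3 + 45 * r 4 + 36 * r 5 := ⟨_, rfl⟩
  obtain ⟨x, hx, hxn⟩ := exists_mem_sieved_not_covered (fun n => ((r n - t) % n).toNat)
    (fun n hn => by
      have := Int.emod_lt_of_pos (r n - t) (Int.natCast_pos.mpr hn)
      have := Int.emod_nonneg (r n - t) (Int.natCast_pos.mpr hn).ne'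
      omega)
  obtain ⟨-, h3, h4, h5⟩ := Finset.mem_filter.mp hx
  refine ⟨x + t, fun n hn hn3 hmod => ?_⟩
  by_cases hn5 : n ≤ 5
  · interval_cases n <;> simp only [Int.ModEq, Nat.cast_ofNat] at hmod <;> omega
  · have hmem : n ∈ ({6, 10, 12, 15, 20, 30, 60} : Finset ℕ) := by
      have hle := Nat.le_of_dvd (by norm_num) hn
      interval_cases n <;> revert hn <;> decide
    refine hxn n hmem ?_
    have hx' : (x : ℤ) ≡ r n - t [ZMOD n] := by simpa using hmod.sub_right t
    rw [← hx'.eq]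
    norm_cast


/-- If C is a distinct covering system with least modulus 3 whose moduli have lcm 2^a * 3^b * 5^c with a ≥ b ≥ c ≥ 1, and a = 2, then b ≥ 2. -/
theorem m3_a2_implies_b_ge_two (S : Finset ℕ) (r : ℕ → ℤ) (a b c : ℕ)
    (hmod : ∀ n ∈ S, 1 < n)
    (hcov : ∀ x : ℤ, ∃ n ∈ S, x ≡ r n [ZMOD (n : ℤ)])
    (hm : 3 ∈ S) (hmin : ∀ n ∈ S, 3 ≤ n)
    (hlcm : S.lcm id = 2 ^ a * 3 ^ b * 5 ^ c)
    (ha : 1 ≤ a) (hb : 1 ≤ b) (hc : 1 ≤ c) (hab : b ≤ a) (hbc : c ≤ b)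
    (hA : a = 2) :
    2 ≤ b := by
  by_contra hb2
  obtain rfl : b = 1 := by omega
  obtain rfl : c = 1 := by omega
  subst hA
  obtain ⟨x, hx⟩ := exists_not_modEq_of_dvd_sixty r
  obtain ⟨n, hn, hxn⟩ := hcov x
  have hdvd : n ∣ S.lcm id := Finset.dvd_lcm (f := id) hn
  rw [hlcm] at hdvd
  exact hx n (by simpa using hdvd) (hmin n hn) hxn
end

section
/- There exists a distinct covering system with least modulus 3 whose moduli have least common multiple equal to 2^2·3^2·5 = 180 and which contains no congruence with modulus 5 and no congruence with modulus 180. -/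
/-- The moduli of the covering: all divisors of `180` other than `1`, `2`, `5` and `180`. -/
def coveringModuli : Finset ℕ := {3, 4, 6, 9, 10, 12, 15, 18, 20, 30, 36, 45, 60, 90}

/-- The residue attached to each modulus in `coveringModuli`. -/
def coveringResidue (n : ℕ) : ℤ :=
  match n with
  | 6 => 5
  | 9 => 7
  | 10 => 5
  | 12 => 2
  | 15 => 13
  | 18 => 10
  | 20 => 7
  | 30 => 19
  | 36 => 22
  | 45 => 1
  | 60 => 37
  | 90 => 31
  | _ => 0

/-- Congruences whose moduli divide `L > 0` cover `ℤ` as soon as they cover `0, …, L - 1`. -/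
theorem exists_modEq_of_forall_lt {S : Finset ℕ} {r : ℕ → ℤ} {L : ℕ} (hL : 0 < L)
    (hdvd : ∀ n ∈ S, n ∣ L)
    (hcover : ∀ k < L, ∃ n ∈ S, (k : ℤ) ≡ r n [ZMOD (n : ℤ)]) (x : ℤ) :
    ∃ n ∈ S, x ≡ r n [ZMOD (n : ℤ)] := by
  have hL' : (0 : ℤ) < L := by exact_mod_cast hL
  obtain ⟨k, hk⟩ := Int.eq_ofNat_of_zero_le (Int.emod_nonneg x hL'.ne')
  have hlt : k < L := by
    have := Int.emod_lt_of_pos x hL'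
    omega
  obtain ⟨n, hn, hkn⟩ := hcover k hlt
  have hx : x ≡ k [ZMOD (L : ℤ)] := hk ▸ (Int.mod_modEq x L).symm
  exact ⟨n, hn, (hx.of_dvd (Int.natCast_dvd_natCast.mpr (hdvd n hn))).trans hkn⟩

theorem coveringModuli_cover_lt :
    ∀ k : ℕ, k < 180 → ∃ n ∈ coveringModuli, (k : ℤ) ≡ coveringResidue n [ZMOD (n : ℤ)] := by
  decide +kernel

/-- There exists a distinct covering system with least modulus 3, lcm of moduli 2^2 * 3^2 * 5 = 180, containing no congruence with modulus 5 and none with modulus 180. -/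
theorem exists_covering_m3_L180_no5_no180 :
    ∃ (S : Finset ℕ) (r : ℕ → ℤ),
      (∀ n ∈ S, 1 < n) ∧
      (∀ x : ℤ, ∃ n ∈ S, x ≡ r n [ZMOD (n : ℤ)]) ∧
      (3 ∈ S ∧ ∀ n ∈ S, 3 ≤ n) ∧
      S.lcm id = 2 ^ 2 * 3 ^ 2 * 5 ∧
      5 ∉ S ∧ 180 ∉ S := by
  refine ⟨coveringModuli, coveringResidue, by decide, ?_, by decide, by decide +kernel,
    by decide, by decide⟩
  exact exists_modEq_of_forall_lt (L := 180) (by norm_num) (by decide) coveringModuli_cover_lt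
end

section
/- If C is a distinct covering system with least modulus 4 whose moduli have least common multiple L = 2^a·3^b·5^c, where a, b, c are positive integers with a ≥ b ≥ c, and if a = 3, then b ≥ 2. -/
/-- A residue class modulo `d` meets an interval of length `d * k` in at most `k` integers. -/
theorem card_Ico_filter_modEq_le (d k : ℕ) (hd : 0 < d) (v : ℤ) :
    ((Finset.Ico (0 : ℤ) (d * k : ℕ)).filter (fun x => x ≡ v [ZMOD (d : ℤ)])).card ≤ k := by
  have hd' : (0 : ℤ) < d := by exact_mod_cast hd
  have h := Int.Ico_filter_modEq_card (a := 0) (b := ((d * k : ℕ) : ℤ)) hd' v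
  have hq : ((d : ℤ) : ℚ) ≠ 0 := by exact_mod_cast hd.ne'
  have e : ((((d * k : ℕ) : ℤ) : ℚ) - (v : ℚ)) / ((d : ℤ) : ℚ)
      = (((0 : ℤ) : ℚ) - (v : ℚ)) / ((d : ℤ) : ℚ) + (k : ℕ) := by
    push_cast at hq ⊢
    field_simp
    ring
  rw [e, Int.ceil_add_natCast] at h
  omega

/-- If every integer lies in a class with modulus in `A ∪ 5 • D`, where `A` and `D` consist of
divisors of 24, then the part of `[0, 24)` missed by the moduli in `A` is covered, five times over,
by the classes of the moduli `5 * d` reduced modulo `d`. -/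
theorem five_mul_card_le_sum_card_filter (A D : Finset ℕ) (r : ℕ → ℤ) (R : Finset ℤ)
    (hA : ∀ n ∈ A, n ∣ 24) (hD : ∀ d ∈ D, d ∣ 24)
    (hR : ∀ x ∈ R, ∀ n ∈ A, ¬ x ≡ r n [ZMOD (n : ℤ)])
    (hcov : ∀ x : ℤ, (∃ n ∈ A, x ≡ r n [ZMOD (n : ℤ)]) ∨
      ∃ d ∈ D, x ≡ r (5 * d) [ZMOD ((5 * d : ℕ) : ℤ)]) :
    5 * R.card ≤ ∑ d ∈ D, (R.filter (fun x => x ≡ r (5 * d) [ZMOD (d : ℤ)])).card := by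
  have hshift : ∀ x j : ℤ, ∀ n : ℕ, n ∣ 24 → 25 * x - 24 * j ≡ x [ZMOD (n : ℤ)] := by
    intro x j n hn
    have hn' : (n : ℤ) ∣ 24 := by exact_mod_cast hn
    refine (Int.modEq_iff_dvd.2 ?_).symm
    exact (hn'.mul_right (x - j)).trans (dvd_of_eq (by ring))
  have hsub : R ×ˢ Finset.Ico (0 : ℤ) 5 ⊆ D.biUnion (fun d =>
      (R.filter (fun x => x ≡ r (5 * d) [ZMOD (d : ℤ)])) ×ˢ {r (5 * d) % 5}) := by
    rintro ⟨x, j⟩ hxj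
    obtain ⟨hx, hj⟩ := Finset.mem_product.1 hxj
    rcases hcov (25 * x - 24 * j) with ⟨n, hn, h⟩ | ⟨d, hd, h⟩
    · exact absurd ((hshift x j n (hA n hn)).symm.trans h) (hR x hx n hn)
    · push_cast at h
      have h5 : (25 * x - 24 * j) % 5 = r (5 * d) % 5 := h.of_mul_right _
      have hj' := Finset.mem_Ico.1 hj
      simp only [Finset.mem_biUnion, Finset.mem_product, Finset.mem_filter, Finset.mem_singleton]
      exact ⟨d, hd, ⟨hx, (hshift x j d (hD d hd)).symm.trans (h.of_mul_left _)⟩, by omega⟩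
  calc 5 * R.card = (R ×ˢ Finset.Ico (0 : ℤ) 5).card := by simp [mul_comm]
    _ ≤ _ := Finset.card_le_card hsub
    _ ≤ _ := Finset.card_biUnion_le
    _ = _ := by simp

/-- There is no distinct covering system with least modulus at least 4 whose moduli divide 120. -/
theorem not_covering_of_dvd_120 (S : Finset ℕ) (r : ℕ → ℤ)
    (hcov : ∀ x : ℤ, ∃ n ∈ S, x ≡ r n [ZMOD (n : ℤ)])
    (hmin : ∀ n ∈ S, 4 ≤ n) (hdvd : ∀ n ∈ S, n ∣ 120) : False := by
  let A : Finset ℕ := {4, 6, 8, 12, 24}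
  let D : Finset ℕ := {1, 2, 3, 4, 6, 8, 12, 24}
  have hS : ∀ n ∈ S, n ∈ A ∨ ∃ d ∈ D, n = 5 * d := by
    have key : ∀ n ∈ Nat.divisors 120, 4 ≤ n → n ∈ A ∨ ∃ d ∈ D, n = 5 * d := by decide +kernel
    exact fun n hn => key n (Nat.mem_divisors.2 ⟨hdvd n hn, by norm_num⟩) (hmin n hn)
  have hA : ∀ n ∈ A, n ∣ 24 := by decide
  have hD : ∀ d ∈ D, d ∣ 24 := by decide
  have hclass : ∀ n : ℕ, n ∣ 24 → ∀ v : ℤ,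
      ((Finset.Ico (0 : ℤ) 24).filter (fun x => x ≡ v [ZMOD (n : ℤ)])).card ≤ 24 / n := by
    intro n hn v
    have := card_Ico_filter_modEq_le n (24 / n) (Nat.pos_of_dvd_of_pos hn (by norm_num)) v
    rwa [Nat.mul_div_cancel' hn] at this
  let R := (Finset.Ico (0 : ℤ) 24).filter (fun x => ∀ n ∈ A, ¬ x ≡ r n [ZMOD (n : ℤ)])
  have hRsub : R ⊆ Finset.Ico (0 : ℤ) 24 := Finset.filter_subset _ _
  have hRclass : ∀ n : ℕ, n ∣ 24 → ∀ v : ℤ,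
      (R.filter (fun x => x ≡ v [ZMOD (n : ℤ)])).card ≤ 24 / n := fun n hn v =>
    (Finset.card_le_card (Finset.filter_subset_filter _ hRsub)).trans (hclass n hn v)
  have hRcard : 24 ≤ R.card + 16 := by
    have hsub : Finset.Ico (0 : ℤ) 24 ⊆ R ∪ A.biUnion (fun n =>
        (Finset.Ico (0 : ℤ) 24).filter (fun x => x ≡ r n [ZMOD (n : ℤ)])) := by
      intro x hx
      by_cases h : ∀ n ∈ A, ¬ x ≡ r n [ZMOD (n : ℤ)]
      · exact Finset.mem_union_left _ (Finset.mem_filter.2 ⟨hx, h⟩)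
      · push Not at h
        obtain ⟨n, hn, h⟩ := h
        exact Finset.mem_union_right _
          (Finset.mem_biUnion.2 ⟨n, hn, Finset.mem_filter.2 ⟨hx, h⟩⟩)
    calc 24 = (Finset.Ico (0 : ℤ) 24).card := by simp
      _ ≤ _ := Finset.card_le_card hsub
      _ ≤ _ := Finset.card_union_le _ _
      _ ≤ R.card + ∑ n ∈ A, 24 / n := by
        gcongr
        exact Finset.card_biUnion_le.trans (Finset.sum_le_sum fun n hn => hclass n (hA n hn) _)
      _ = R.card + 16 := by simp [A]
  have hfive := five_mul_card_le_sum_card_filter A D r R hA hD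
    (fun x hx => (Finset.mem_filter.1 hx).2) (by
      intro x
      obtain ⟨n, hn, hx⟩ := hcov x
      rcases hS n hn with h | ⟨d, hd, rfl⟩
      · exact Or.inl ⟨n, h, hx⟩
      · exact Or.inr ⟨d, hd, hx⟩)
  let F : ℕ → Finset ℤ := fun d => R.filter (fun x => x ≡ r (5 * d) [ZMOD (d : ℤ)])
  have hsum : 5 * R.card ≤ (F 1).card + ((F 2).card + ((F 3).card + ((F 4).card +
      ((F 6).card + ((F 8).card + ((F 12).card + (F 24).card)))))) := by
    simpa [D, F] using hfive
  have h1 : (F 1).card ≤ R.card := Finset.card_filter_le _ _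
  have h23 : (F 2).card + (F 3).card ≤ R.card + 4 := by
    rw [← Finset.card_union_add_card_inter]
    refine add_le_add (Finset.card_le_card
      (Finset.union_subset (Finset.filter_subset _ _) (Finset.filter_subset _ _))) ?_
    rcases (F 2 ∩ F 3).eq_empty_or_nonempty with h | ⟨y, hy⟩
    · simp [h]
    refine (Finset.card_le_card fun x hx => ?_).trans (hRclass 6 (by norm_num) y)
    obtain ⟨hy2, hy3⟩ := Finset.mem_inter.1 hy
    obtain ⟨hx2, hx3⟩ := Finset.mem_inter.1 hx
    have h2 := (Finset.mem_filter.1 hx2).2.trans (Finset.mem_filter.1 hy2).2.symm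
    have h3 := (Finset.mem_filter.1 hx3).2.trans (Finset.mem_filter.1 hy3).2.symm
    refine Finset.mem_filter.2 ⟨(Finset.mem_filter.1 hx2).1, ?_⟩
    simp only [Int.ModEq] at h2 h3 ⊢
    omega
  have h4 : (F 4).card ≤ 6 := hRclass 4 (by norm_num) _
  have h6 : (F 6).card ≤ 4 := hRclass 6 (by norm_num) _
  have h8 : (F 8).card ≤ 3 := hRclass 8 (by norm_num) _
  have h12 : (F 12).card ≤ 2 := hRclass 12 (by norm_num) _
  have h24 : (F 24).card ≤ 1 := hRclass 24 (by norm_num) _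
  omega

/-- If C is a distinct covering system with least modulus 4 whose moduli have lcm 2^a * 3^b * 5^c with a ≥ b ≥ c ≥ 1, and a = 3, then b ≥ 2. -/
theorem m4_a3_implies_b_ge_two (S : Finset ℕ) (r : ℕ → ℤ) (a b c : ℕ)
    (hmod : ∀ n ∈ S, 1 < n)
    (hcov : ∀ x : ℤ, ∃ n ∈ S, x ≡ r n [ZMOD (n : ℤ)])
    (hm : 4 ∈ S) (hmin : ∀ n ∈ S, 4 ≤ n)
    (hlcm : S.lcm id = 2 ^ a * 3 ^ b * 5 ^ c)
    (ha : 1 ≤ a) (hb : 1 ≤ b) (hc : 1 ≤ c) (hab : b ≤ a) (hbc : c ≤ b)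
    (hA : a = 3) :
    2 ≤ b := by
  by_contra hlt
  obtain rfl : b = 1 := by omega
  obtain rfl : c = 1 := by omega
  subst hA
  refine not_covering_of_dvd_120 S r hcov hmin fun n hn => ?_
  have h : n ∣ S.lcm id := Finset.dvd_lcm (f := id) hn
  rw [hlcm] at h
  simpa using h
end

section
/- If C is a distinct covering system with least modulus 4 whose moduli have least common multiple L = 2^a·3^b·5^c, where a, b, c are positive integers with a ≥ b ≥ c, and if b = 1, then a ≥ 5. -/
/-!
Fix a residue `u` modulo 16 that is met by none of the classes modulo 4, 8 and 16. The integers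
in this residue form a `3 × 5` grid of residues modulo 15, in which the moduli `3 * 2 ^ i` give
rows, the moduli `5 * 2 ^ i` columns and the moduli `15 * 2 ^ i` points. Counting the grid gives
`GridCoverable` for the numbers of rows, columns and points. That this holds for all `u` is refuted
on the binary tree of residues modulo `2 ^ d`, `d ≤ 4`: classes of modulus `2 ^ (i + 1) * M` are
indexed by the level `i` and by the type `q = 0, 1, 2, 3` (for `M = 1, 3, 5, 15`), and a set of
classes is encoded as a bit mask in which bit `4 * i + q` stands for the class `(i, q)`.
-/

namespace CoveringTwoFortyDivisors

/-- A `3 × 5` grid may be covered by `h` rows, `k + 1` columns and `p + 1` points. -/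
def GridCoverable (h k p : ℕ) : Prop := (3 - h) * (4 - k) ≤ 1 + p

/-- The number of classes of type `q` and level below `d` that contain `v`. -/
def count (c : ℕ → ℕ → ℕ) (q d v : ℕ) : ℕ :=
  ((Finset.range d).filter fun i => v % 2 ^ (i + 1) = c i q).card

/-- The residue `v` modulo `2 ^ d` lies in a class of modulus a power of two. -/
def Removed (c : ℕ → ℕ → ℕ) (d v : ℕ) : Prop := ∃ i < d, v % 2 ^ (i + 1) = c i 0

/-- All classes in the mask `m` have level at least `d` and are contained in `v` modulo `2 ^ d`. -/
def Fits (c : ℕ → ℕ → ℕ) (d v m : ℕ) : Prop :=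
  ∀ j, m.testBit j = true → 4 * d ≤ j ∧ j < 16 ∧ c (j / 4) (j % 4) % 2 ^ d = v

/-- The position of a class relative to the two children of a residue: outside (`0`), in the left
child (`1`) or in the right child (`2`). -/
def side (d v e : ℕ) : ℕ := if e = v then 1 else if e = v + 2 ^ d then 2 else 0

/-- The masks in the family of a child, which is `[0]` when the child is removed. -/
def childFamily (F : ℕ → ℕ → ℕ → List ℕ) (h k p t a₀ a₁ a₂ a₃ : ℕ) : List ℕ :=
  bif a₀.beq t then [0] else F (h + (a₁.beq t).toNat) (k + (a₂.beq t).toNat) (p + (a₃.beq t).toNat)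

/-- The mask of the classes of level `d` that are used by one of the children. -/
def levelMask (d a₀ a₁ a₂ a₃ : ℕ) : ℕ :=
  2 ^ (4 * d) * ((bif a₀.beq 0 then 0 else 1) ||| (bif a₁.beq 0 then 0 else 2) |||
    (bif a₂.beq 0 then 0 else 4) ||| (bif a₃.beq 0 then 0 else 8))

/-- The masks that suffice at depth `d`, given families `F` of masks for the depth `d + 1`. -/
def join (F : ℕ → ℕ → ℕ → List ℕ) (d h k p : ℕ) : List ℕ :=
  [0, 1, 2].flatMap fun a₀ => [0, 1, 2].flatMap fun a₁ =>
  [0, 1, 2].flatMap fun a₂ => [0, 1, 2].flatMap fun a₃ =>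
    (childFamily F h k p 1 a₀ a₁ a₂ a₃).flatMap fun x =>
      ((childFamily F h k p 2 a₀ a₁ a₂ a₃).filter fun y => (x &&& y).beq 0).map fun y =>
        x ||| y ||| levelMask d a₀ a₁ a₂ a₃

/-- The residue `v` modulo `2 ^ d` is removed, or the classes inside it contain some mask of the
family `F` for the numbers of classes around it. -/
def Served (c : ℕ → ℕ → ℕ) (F : ℕ → ℕ → ℕ → List ℕ) (d v : ℕ) : Prop :=
  Removed c d v ∨ ∃ m ∈ F (count c 1 d v) (count c 2 d v) (count c 3 d v), Fits c d v m

lemma count_le (c : ℕ → ℕ → ℕ) (q d v : ℕ) : count c q d v ≤ d :=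
  (Finset.card_filter_le _ _).trans (by simp)

lemma add_two_pow_mod (d v i : ℕ) (hi : i < d) : (v + 2 ^ d) % 2 ^ (i + 1) = v % 2 ^ (i + 1) := by
  obtain ⟨k, rfl⟩ : ∃ k, d = i + 1 + k := ⟨d - (i + 1), by omega⟩
  rw [pow_add, Nat.add_mul_mod_self_left]

lemma side_mem (d v e : ℕ) : side d v e ∈ [0, 1, 2] := by
  unfold side; split_ifs <;> simp

lemma side_eq_one {d v e : ℕ} : (side d v e).beq 1 = decide (v = e) := by
  have := Nat.two_pow_pos d
  rw [Bool.eq_iff_iff, Nat.beq_eq, decide_eq_true_iff]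
  unfold side; split_ifs <;> constructor <;> intro <;> first | contradiction | omega

lemma side_eq_two {d v e : ℕ} : (side d v e).beq 2 = decide (v + 2 ^ d = e) := by
  have := Nat.two_pow_pos d
  rw [Bool.eq_iff_iff, Nat.beq_eq, decide_eq_true_iff]
  unfold side; split_ifs <;> constructor <;> intro <;> first | contradiction | omega

lemma count_succ_left (c : ℕ → ℕ → ℕ) (q : ℕ) {d v : ℕ} (hv : v < 2 ^ d) :
    count c q (d + 1) v = count c q d v + ((side d v (c d q)).beq 1).toNat := by
  have : v % 2 ^ (d + 1) = v := Nat.mod_eq_of_lt (by rw [pow_succ]; omega)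
  rw [side_eq_one]
  unfold count
  rw [Finset.range_add_one, Finset.filter_insert, this]
  by_cases h : v = c d q <;> simp [h]

lemma count_succ_right (c : ℕ → ℕ → ℕ) (q : ℕ) {d v : ℕ} (hv : v < 2 ^ d) :
    count c q (d + 1) (v + 2 ^ d) = count c q d v + ((side d v (c d q)).beq 2).toNat := by
  have h1 : (v + 2 ^ d) % 2 ^ (d + 1) = v + 2 ^ d := Nat.mod_eq_of_lt (by rw [pow_succ]; omega)
  have h2 : (Finset.range d).filter (fun i => (v + 2 ^ d) % 2 ^ (i + 1) = c i q) =
      (Finset.range d).filter fun i => v % 2 ^ (i + 1) = c i q :=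
    Finset.filter_congr fun i hi => by rw [add_two_pow_mod d v i (Finset.mem_range.1 hi)]
  rw [side_eq_two]
  unfold count
  rw [Finset.range_add_one, Finset.filter_insert, h1, h2]
  by_cases h : v + 2 ^ d = c d q <;> simp [h]

lemma exists_mem_childFamily {c : ℕ → ℕ → ℕ} {F : ℕ → ℕ → ℕ → List ℕ} {d v w t : ℕ}
    (hs : Served c F (d + 1) w)
    (hr : Removed c (d + 1) w → Removed c d v ∨ (side d v (c d 0)).beq t = true)
    (hcount : ∀ q, count c q (d + 1) w = count c q d v + ((side d v (c d q)).beq t).toNat)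
    (hv : ¬ Removed c d v) :
    ∃ m ∈ childFamily F (count c 1 d v) (count c 2 d v) (count c 3 d v) t
      (side d v (c d 0)) (side d v (c d 1)) (side d v (c d 2)) (side d v (c d 3)),
      Fits c (d + 1) w m := by
  unfold childFamily
  cases h : (side d v (c d 0)).beq t with
  | true => exact ⟨0, by simp, by intro j; simp⟩
  | false =>
    rcases hs with hs | ⟨m, hm, hf⟩
    · rcases hr hs with h' | h'
      · exact absurd h' hv
      · simp [h] at h'
    · exact ⟨m, by simpa only [hcount, cond_false] using hm, hf⟩

lemma levelMask_testBit {d a₀ a₁ a₂ a₃ j : ℕ} (h : (levelMask d a₀ a₁ a₂ a₃).testBit j = true) :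
    j = 4 * d ∧ a₀ ≠ 0 ∨ j = 4 * d + 1 ∧ a₁ ≠ 0 ∨ j = 4 * d + 2 ∧ a₂ ≠ 0 ∨
      j = 4 * d + 3 ∧ a₃ ≠ 0 := by
  have key : ∀ (a b e : ℕ), (bif a.beq 0 then 0 else 2 ^ b).testBit e = true → e = b ∧ a ≠ 0 := by
    intro a b e h
    cases h' : a.beq 0 with
    | true => simp [h'] at h
    | false =>
      rw [h', cond_false, Nat.testBit_two_pow] at h
      exact ⟨by simpa using (of_decide_eq_true h).symm, by rintro rfl; simp at h'⟩
  unfold levelMask at h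
  rw [Nat.testBit_two_pow_mul] at h
  simp only [Nat.testBit_or, Bool.and_eq_true, Bool.or_eq_true, decide_eq_true_eq] at h
  obtain ⟨h0, ((h | h) | h) | h⟩ := h
  · have := key a₀ 0 _ h; omega
  · have := key a₁ 1 _ h; omega
  · have := key a₂ 2 _ h; omega
  · have := key a₃ 3 _ h; omega

/-- If both children of a residue are served by `F`, the residue is served by `join F`. -/
theorem Served.join {c : ℕ → ℕ → ℕ} {F : ℕ → ℕ → ℕ → List ℕ} {d v : ℕ} (hd : d < 4)
    (hv : v < 2 ^ d) (hL : Served c F (d + 1) v) (hR : Served c F (d + 1) (v + 2 ^ d)) :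
    Served c (join F d) d v := by
  by_cases hrem : Removed c d v
  · exact Or.inl hrem
  have hvL : v % 2 ^ (d + 1) = v := Nat.mod_eq_of_lt (by rw [pow_succ]; omega)
  have hvR : (v + 2 ^ d) % 2 ^ (d + 1) = v + 2 ^ d := Nat.mod_eq_of_lt (by rw [pow_succ]; omega)
  obtain ⟨x, hx, hxf⟩ := exists_mem_childFamily (t := 1) hL (by
    rintro ⟨i, hi, h⟩
    rcases Nat.lt_succ_iff_lt_or_eq.1 hi with hi | rfl
    · exact Or.inl ⟨i, hi, h⟩
    · exact Or.inr (by rw [side_eq_one]; simpa [hvL] using h))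
    (fun q => count_succ_left c q hv) hrem
  obtain ⟨y, hy, hyf⟩ := exists_mem_childFamily (t := 2) hR (by
    rintro ⟨i, hi, h⟩
    rcases Nat.lt_succ_iff_lt_or_eq.1 hi with hi | rfl
    · exact Or.inl ⟨i, hi, by rwa [add_two_pow_mod d v i hi] at h⟩
    · exact Or.inr (by rw [side_eq_two]; simpa [hvR] using h))
    (fun q => count_succ_right c q hv) hrem
  have hpos := Nat.two_pow_pos d
  have hxy : x &&& y = 0 := by
    apply Nat.eq_of_testBit_eq
    intro j
    rw [Nat.testBit_and, Nat.zero_testBit, Bool.and_eq_false_iff]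
    by_contra! hcon
    have h1 := (hxf j (by simpa using hcon.1)).2.2
    have h2 := (hyf j (by simpa using hcon.2)).2.2
    omega
  refine Or.inr ⟨x ||| y ||| levelMask d (side d v (c d 0)) (side d v (c d 1)) (side d v (c d 2))
    (side d v (c d 3)), ?_, ?_⟩
  · unfold CoveringTwoFortyDivisors.join
    refine List.mem_flatMap.2 ⟨_, side_mem d v (c d 0), List.mem_flatMap.2 ⟨_, side_mem d v (c d 1),
      List.mem_flatMap.2 ⟨_, side_mem d v (c d 2), List.mem_flatMap.2 ⟨_, side_mem d v (c d 3),
      List.mem_flatMap.2 ⟨x, hx, List.mem_map.2 ⟨y, List.mem_filter.2 ⟨hy, ?_⟩, rfl⟩⟩⟩⟩⟩⟩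
    simp [hxy]
  · intro j hj
    have hmod : ∀ e, e % 2 ^ d = e % 2 ^ (d + 1) % 2 ^ d := fun e =>
      (Nat.mod_mod_of_dvd e (pow_dvd_pow 2 (Nat.le_succ d))).symm
    have hside : ∀ e, side d v e ≠ 0 → e % 2 ^ d = v := by
      intro e he
      unfold side at he
      split_ifs at he with h1 h2
      · rw [h1, Nat.mod_eq_of_lt hv]
      · rw [h2, Nat.add_mod_right, Nat.mod_eq_of_lt hv]
      · simp at he
    simp only [Nat.testBit_or, Bool.or_eq_true] at hj
    rcases hj with (hj | hj) | hj
    · obtain ⟨h1, h2, h3⟩ := hxf j hj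
      exact ⟨by omega, h2, by rw [hmod, h3, Nat.mod_eq_of_lt hv]⟩
    · obtain ⟨h1, h2, h3⟩ := hyf j hj
      exact ⟨by omega, h2, by rw [hmod, h3, Nat.add_mod_right, Nat.mod_eq_of_lt hv]⟩
    · rcases levelMask_testBit hj with ⟨rfl, h⟩ | ⟨rfl, h⟩ | ⟨rfl, h⟩ | ⟨rfl, h⟩
      · refine ⟨by omega, by omega, ?_⟩
        rw [show 4 * d / 4 = d by omega, show 4 * d % 4 = 0 by omega]
        exact hside _ h
      · refine ⟨by omega, by omega, ?_⟩
        rw [show (4 * d + 1) / 4 = d by omega, show (4 * d + 1) % 4 = 1 by omega]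
        exact hside _ h
      · refine ⟨by omega, by omega, ?_⟩
        rw [show (4 * d + 2) / 4 = d by omega, show (4 * d + 2) % 4 = 2 by omega]
        exact hside _ h
      · refine ⟨by omega, by omega, ?_⟩
        rw [show (4 * d + 3) / 4 = d by omega, show (4 * d + 3) % 4 = 3 by omega]
        exact hside _ h

/-- A family may be replaced by one that contains a submask of each of its members. -/
theorem Served.mono {c : ℕ → ℕ → ℕ} {F G : ℕ → ℕ → ℕ → List ℕ} {d v : ℕ}
    (hFG : ∀ h ≤ d, ∀ k ≤ d, ∀ p ≤ d, ∀ m ∈ F h k p, ∃ n ∈ G h k p, n &&& m = n)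
    (hF : Served c F d v) : Served c G d v := by
  rcases hF with hF | ⟨m, hm, hf⟩
  · exact Or.inl hF
  · obtain ⟨n, hn, hnm⟩ := hFG _ (count_le c 1 d v) _ (count_le c 2 d v) _ (count_le c 3 d v) m hm
    refine Or.inr ⟨n, hn, fun j hj => hf j ?_⟩
    rw [← hnm, Nat.testBit_and, Bool.and_eq_true] at hj
    exact hj.2

/-- The minimal masks at depth 4. -/
def leafFamily (h k p : ℕ) : List ℕ := bif ((3 - h) * (4 - k)).ble (1 + p) then [0] else []

/-- The minimal masks at depth 3, listed at position `16 * h + 4 * k + p`. -/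
def pairTable : List (List ℕ) := [
  [], [], [], [],
  [], [], [61440], [28672],
  [61440], [53248, 28672], [20480, 57344, 45056], [24576, 20480, 12288],
  [20480, 57344, 45056], [49152, 40960, 36864, 24576, 20480, 12288], [0], [0],
  [], [61440], [45056, 28672], [12288],
  [61440], [45056, 28672], [12288, 57344, 53248], [24576, 20480, 12288],
  [53248, 45056, 28672], [24576, 20480, 12288], [49152, 40960, 36864, 24576, 20480, 12288], [0],
  [49152, 40960, 36864, 24576, 20480, 12288], [0], [0], [0],
  [12288], [12288, 57344, 53248], [49152, 40960, 36864, 24576, 20480, 12288], [0],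
  [12288, 57344, 53248], [49152, 40960, 36864, 24576, 20480, 12288], [0], [0],
  [49152, 40960, 36864, 24576, 20480, 12288], [0], [0], [0],
  [0], [0], [0], [0],
  [0], [0], [0], [0],
  [0], [0], [0], [0],
  [0], [0], [0], [0],
  [0], [0], [0], [0]]

/-- The minimal masks at depth 2, listed at position `9 * h + 3 * k + p`. -/
def quarterTable : List (List ℕ) := [
    [64256, 32512, 63232, 48896], [62208, 47872, 31488, 46848, 16128, 30464, 64768, 57088, 61184],
    [45824, 29440, 14080, 15104, 62720, 32000, 55040, 59136, 28416, 24320],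
    [62720, 32000, 56576, 62208, 46848, 55040, 30464, 47872, 31488, 28416, 16128, 24320], [54528,
    29952, 23808, 45824, 29440, 26368, 22272, 14080, 15104, 63744, 60672, 48384, 44800, 40704,
    52992, 60160, 56064], [21760, 13056, 3840, 61696, 30976, 58624, 46336, 58112, 54016, 50944,
    42752, 38656, 26368, 27392, 23296, 27904, 15616, 65024],
    [21760, 3840, 61696, 30976, 55552, 54016, 45824, 29440, 58624, 46336, 14080, 50944, 42752,
    38656, 26368, 27392, 23296, 15104, 52480, 44288, 40192, 27904, 15616, 65024], [3328, 1792,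
    53504, 28928, 25344, 21248, 13056, 50432, 42240, 38144, 25856, 21760, 13568, 22784, 56320,
    31744, 54784, 30208, 24064, 59648, 47360, 51968, 39680, 43776, 28160, 15872], [1280, 21504,
    3584, 20736, 2816, 58368, 46080, 27648, 15360, 23040, 25344, 50688, 26880, 13056, 38400,
    14592, 57600, 45312, 49920, 41728, 42496, 26112, 37632, 13824, 61952, 59904, 47616],
    [13056, 63744, 32000, 62720, 48384, 44800, 40704, 52992, 59136, 55040, 56064, 60160, 28416,
    24320], [13056, 3840, 61696, 30976, 47360, 46336, 58112, 54016, 29952, 22272, 50944, 42752,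
    38656, 26368, 23296, 51968, 43776, 39680, 27392, 15616, 60672, 56576, 65024], [1792, 2816,
    45312, 28928, 49920, 41728, 37632, 25344, 21248, 13056, 13568, 14592, 47616, 31232, 46592,
    30208, 15872, 58624, 54528, 27904, 23808, 60928, 56832],
    [13056, 3840, 61696, 30976, 47360, 54528, 58112, 54016, 46336, 29952, 22272, 50944, 42752,
    38656, 26368, 23296, 27392, 51968, 43776, 39680, 27904, 23808, 15616, 65024], [1792, 2816,
    45312, 28928, 49920, 41728, 37632, 25344, 21248, 13056, 25856, 21760, 13568, 14592, 47616,
    31232, 46592, 30208, 15872, 40192, 44288, 59648, 55552, 52480, 28160, 24064], [768, 12800,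
    3584, 12544, 3328, 15360, 57856, 53760, 42240, 25856, 50688, 26880, 38400, 22016, 23040,
    57600, 53504, 50432, 42496, 26112, 27136, 38144, 21760, 22784, 62464, 56320, 60416],
    [3328, 1792, 2816, 41728, 25344, 42240, 25856, 26880, 13056, 13568, 14592, 53504, 45312,
    28928, 49920, 50432, 37632, 21248, 38144, 21760, 22784, 56320, 48128, 55808, 31744, 47616,
    31232, 54784, 46592, 52736, 24064, 40448, 28160, 44544, 30208, 15872], [768, 1280, 1536,
    25600, 21504, 13312, 24832, 20736, 12544, 25088, 20992, 12800, 52224, 44032, 39936, 51456,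
    43264, 39168, 51712, 43520, 39424, 63488], [1536, 2560, 3072, 768, 1280, 2304, 51200, 43008,
    38912, 26624, 22528, 14336, 50176, 41984, 37888, 49664, 37376, 20992, 21504, 49408, 41216,
    37120, 24832, 20736, 12544, 41472, 25088, 25600, 12800, 13312, 61440],
    [768, 12800, 12544, 59904, 55808, 58880, 58624, 54528, 54784, 59648, 55552, 52480, 44288,
    40192, 27904, 23808, 52736, 44544, 40448, 28160, 24064, 64512], [768, 12800, 3584, 12544,
    3328, 15360, 57856, 53760, 42240, 25856, 50688, 43264, 26880, 51712, 38400, 22016, 39424,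
    23040, 57600, 53504, 50432, 42496, 26112, 51456, 43520, 27136, 38144, 21760, 39168, 22784,
    63488, 62464, 56320, 60416], [1536, 2560, 3072, 768, 1280, 2304, 51200, 43008, 38912, 26624,
    22528, 14336, 50176, 41984, 37888, 49664, 37376, 20992, 21504, 49408, 41216, 37120, 24832,
    20736, 12544, 41472, 25088, 25600, 12800, 13312, 61440],
    [768, 12800, 3584, 12544, 3328, 15360, 57856, 53760, 42240, 25856, 50688, 43264, 26880, 51712,
    38400, 22016, 39424, 23040, 57600, 53504, 50432, 42496, 26112, 51456, 43520, 27136, 38144,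
    21760, 39168, 22784, 63488, 62464, 56320, 60416], [1536, 2560, 3072, 768, 1280, 2304, 51200,
    43008, 38912, 26624, 22528, 14336, 50176, 41984, 37888, 49664, 37376, 20992, 21504, 49408,
    41216, 37120, 24832, 20736, 12544, 41472, 25088, 25600, 12800, 13312, 61440], [0],
    [1536, 2560, 3072, 768, 1280, 2304, 51200, 43008, 38912, 26624, 22528, 14336, 50176, 41984,
    37888, 49664, 37376, 20992, 21504, 49408, 41216, 37120, 24832, 20736, 12544, 41472, 25088,
    25600, 12800, 13312, 61440], [0], [0]]

/-- The minimal masks at depth 3. -/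
def pairFamily (h k p : ℕ) : List ℕ := pairTable.getD (16 * h + 4 * k + p) []

/-- The minimal masks at depth 2. -/
def quarterFamily (h k p : ℕ) : List ℕ := quarterTable.getD (9 * h + 3 * k + p) []

/-- `w` if the mask `m` contains the bit of value `b`, and `0` otherwise. -/
def bitWeight (m b w : ℕ) : ℕ := bif (Nat.land m b).beq 0 then 0 else w

/-- The total weight of the classes in a mask. -/
def weight (m : ℕ) : ℕ :=
  bitWeight m 16 10 + bitWeight m 32 4 + bitWeight m 64 3 + bitWeight m 128 2 +
  bitWeight m 256 5 + bitWeight m 512 4 + bitWeight m 1024 3 + bitWeight m 2048 1 +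
  bitWeight m 4096 2 + bitWeight m 8192 2 + bitWeight m 16384 2 + bitWeight m 32768 1

/-- `P` holds for all triples of numbers below `n`. -/
def allBelow (n : ℕ) (P : ℕ → ℕ → ℕ → Bool) : Bool :=
  (List.range n).all fun h => (List.range n).all fun k => (List.range n).all fun p => P h k p

lemma allBelow_spec {n : ℕ} {P : ℕ → ℕ → ℕ → Bool} (H : allBelow (n + 1) P = true) :
    ∀ h ≤ n, ∀ k ≤ n, ∀ p ≤ n, P h k p = true := by
  intro h hh k hk p hp
  simp only [allBelow, List.all_eq_true, List.mem_range] at H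
  exact H h (by omega) k (by omega) p (by omega)

lemma exists_submask_of_check {n : ℕ} {F G : ℕ → ℕ → ℕ → List ℕ}
    (H : allBelow (n + 1) (fun h k p =>
      (F h k p).all fun m => (G h k p).any fun x => (x &&& m).beq x) = true) :
    ∀ h ≤ n, ∀ k ≤ n, ∀ p ≤ n, ∀ m ∈ F h k p, ∃ x ∈ G h k p, x &&& m = x := by
  intro h hh k hk p hp m hm
  have := List.all_eq_true.1 (allBelow_spec H h hh k hk p hp) m hm
  obtain ⟨x, hx, hxm⟩ := List.any_eq_true.1 this
  exact ⟨x, hx, Nat.eq_of_beq_eq_true hxm⟩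

lemma pairFamily_spec : ∀ h ≤ 3, ∀ k ≤ 3, ∀ p ≤ 3, ∀ m ∈ join leafFamily 3 h k p,
    ∃ x ∈ pairFamily h k p, x &&& m = x :=
  exists_submask_of_check (by decide +kernel)

lemma quarterFamily_spec : ∀ h ≤ 2, ∀ k ≤ 2, ∀ p ≤ 2, ∀ m ∈ join pairFamily 2 h k p,
    ∃ x ∈ quarterFamily h k p, x &&& m = x :=
  exists_submask_of_check (by decide +kernel)

lemma half_weight_check : allBelow 2 (fun h k p => (join quarterFamily 1 h k p).all fun m =>
    Nat.ble 27 (5 * h + 3 * k + 3 * p + weight m)) = true := by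
  decide +kernel

lemma weight_add_le {m n : ℕ} (h : ∀ j, m.testBit j = true → n.testBit j = true → False) :
    weight m + weight n ≤ 39 := by
  have key : ∀ j w, bitWeight m (2 ^ j) w + bitWeight n (2 ^ j) w ≤ w := by
    intro j w
    have hj := h j
    have hb : ∀ x, bitWeight x (2 ^ j) w = bif x.testBit j then w else 0 := by
      intro x
      unfold bitWeight
      rw [show Nat.land x (2 ^ j) = (x.testBit j).toNat * 2 ^ j from Nat.and_two_pow x j]
      have := (Nat.two_pow_pos j).ne'
      cases x.testBit j <;> cases h0 : (2 ^ j).beq 0 <;> simp_all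
    rw [hb, hb]
    cases h1 : m.testBit j <;> cases h2 : n.testBit j <;> simp_all
  have h4 := key 4 10
  have h5 := key 5 4
  have h6 := key 6 3
  have h7 := key 7 2
  have h8 := key 8 5
  have h9 := key 9 4
  have h10 := key 10 3
  have h11 := key 11 1
  have h12 := key 12 2
  have h13 := key 13 2
  have h14 := key 14 2
  have h15 := key 15 1
  norm_num only at h4 h5 h6 h7 h8 h9 h10 h11 h12 h13 h14 h15
  unfold weight
  omega

/-- No placement of the classes serves all residues modulo 16. -/
theorem exists_not_gridCoverable (c : ℕ → ℕ → ℕ) (hc : 2 ≤ c 0 0) :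
    ∃ u < 16, ¬ Removed c 4 u ∧ ¬ GridCoverable (count c 1 4 u) (count c 2 4 u) (count c 3 4 u) := by
  by_contra! hcon
  have hleaf : ∀ u < 2 ^ 4, Served c leafFamily 4 u := by
    intro u hu
    by_cases hr : Removed c 4 u
    · exact Or.inl hr
    · refine Or.inr ⟨0, ?_, by intro j; simp⟩
      have := hcon u hu hr
      unfold GridCoverable at this
      simp [leafFamily, Nat.ble_eq_true_of_le this]
  have hpair : ∀ u < 2 ^ 3, Served c pairFamily 3 u := fun u hu =>
    (Served.join (by norm_num) hu (hleaf _ (by omega)) (hleaf _ (by omega))).mono pairFamily_spec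
  have hquarter : ∀ u < 2 ^ 2, Served c quarterFamily 2 u := fun u hu =>
    (Served.join (by norm_num) hu (hpair _ (by omega)) (hpair _ (by omega))).mono quarterFamily_spec
  have hhalf : ∀ u < 2 ^ 1, ∃ m, Fits c 1 u m ∧
      27 ≤ 5 * count c 1 1 u + 3 * count c 2 1 u + 3 * count c 3 1 u + weight m := by
    intro u hu
    rcases Served.join (by norm_num) hu (hquarter _ (by omega)) (hquarter _ (by omega)) with
      ⟨i, hi, h⟩ | ⟨m, hm, hf⟩
    · obtain rfl : i = 0 := by omega
      omega
    · have := List.all_eq_true.1 (allBelow_spec half_weight_check _ (count_le c 1 1 u) _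
        (count_le c 2 1 u) _ (count_le c 3 1 u)) m hm
      exact ⟨m, hf, Nat.le_of_ble_eq_true this⟩
  obtain ⟨m, hm, hm'⟩ := hhalf 0 (by norm_num)
  obtain ⟨n, hn, hn'⟩ := hhalf 1 (by norm_num)
  have hw := weight_add_le (m := m) (n := n) (fun j h1 h2 => by
    have h3 := (hm j h1).2.2
    have h4 := (hn j h2).2.2
    omega)
  have hcount : ∀ q, count c q 1 0 + count c q 1 1 ≤ 1 := by
    intro q
    have h0 := count_succ_left c q (d := 0) (v := 0) (by norm_num)
    have h1 := count_succ_right c q (d := 0) (v := 0) (by norm_num)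
    rw [side_eq_one] at h0
    rw [side_eq_two] at h1
    have hz : count c q 0 0 = 0 := by unfold count; rfl
    simp only [zero_add, pow_zero, hz] at h0 h1
    rw [h0, h1]
    rcases Nat.eq_zero_or_pos (c 0 q) with h | h
    · simp [h]
    · rw [decide_eq_false (by omega : ¬ 0 = c 0 q), Bool.toNat_false, zero_add]
      exact Bool.toNat_le _
  have := hcount 1
  have := hcount 2
  have := hcount 3
  omega

/-- The odd part of the moduli of type `q`. -/
def oddPart (q : ℕ) : ℕ := if q = 0 then 1 else if q = 1 then 3 else if q = 2 then 5 else 15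

lemma eq_of_dvd_twoForty {n : ℕ} (hn : n ∣ 240) (h4 : 4 ≤ n) :
    n = 5 ∨ n = 15 ∨ ∃ i < 4, ∃ q < 4, ¬ (i = 0 ∧ q = 0) ∧ n = 2 ^ (i + 1) * oddPart q := by
  have key : ∀ n ∈ Nat.divisors 240, 4 ≤ n →
      n = 5 ∨ n = 15 ∨ ∃ i < 4, ∃ q < 4, ¬ (i = 0 ∧ q = 0) ∧ n = 2 ^ (i + 1) * oddPart q := by
    decide +kernel
  exact key n (Nat.mem_divisors.2 ⟨hn, by norm_num⟩) h4

lemma gridCoverable_of_cover {h k p : ℕ} (A : Finset (ZMod 3)) (B : Finset (ZMod 5))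
    (P : Finset (ZMod 3 × ZMod 5)) (hA : A.card ≤ h) (hB : B.card ≤ k + 1) (hP : P.card ≤ p + 1)
    (hcov : ∀ y z, y ∈ A ∨ z ∈ B ∨ (y, z) ∈ P) : GridCoverable h k p := by
  have hsub : Aᶜ ×ˢ Bᶜ ⊆ P := by
    rintro ⟨y, z⟩ hyz
    simp only [Finset.mem_product, Finset.mem_compl] at hyz
    have := hcov y z
    tauto
  have hcard := Finset.card_le_card hsub
  rw [Finset.card_product, Finset.card_compl, Finset.card_compl, ZMod.card, ZMod.card] at hcard
  calc (3 - h) * (4 - k) ≤ (3 - A.card) * (5 - B.card) := Nat.mul_le_mul (by omega) (by omega)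
    _ ≤ 1 + p := by omega

/-- One residue class for each divisor of 240 that is at least 4 does not cover the integers. -/
theorem not_cover_of_dvd_twoForty (r : ℕ → ℤ) :
    ¬ ∀ x : ℤ, ∃ n : ℕ, n ∣ 240 ∧ 4 ≤ n ∧ x ≡ r n [ZMOD (n : ℤ)] := by
  intro hcov
  let N : ℕ → ℕ → ℕ := fun i q => 2 ^ (i + 1) * oddPart q
  let c : ℕ → ℕ → ℕ := fun i q =>
    if i = 0 ∧ q = 0 then 2 else (r (N i q) % 2 ^ (i + 1)).toNat
  obtain ⟨u, hu, hrem, hgrid⟩ := exists_not_gridCoverable c (by simp [c])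
  apply hgrid
  let hits : ℕ → Finset ℕ := fun q =>
    (Finset.range 4).filter fun i => u % 2 ^ (i + 1) = c i q
  have himage : ∀ {α : Type} [DecidableEq α] (q : ℕ) (f : ℕ → α),
      ((hits q).image f).card ≤ count c q 4 u := fun q f => Finset.card_image_le
  refine gridCoverable_of_cover ((hits 1).image fun i => (r (N i 1) : ZMod 3))
    (insert (r 5 : ZMod 5) ((hits 2).image fun i => (r (N i 2) : ZMod 5)))
    (insert ((r 15 : ZMod 3), (r 15 : ZMod 5))
      ((hits 3).image fun i => ((r (N i 3) : ZMod 3), (r (N i 3) : ZMod 5))))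
    (himage 1 _) ((Finset.card_insert_le _ _).trans (Nat.succ_le_succ (himage 2 _)))
    ((Finset.card_insert_le _ _).trans (Nat.succ_le_succ (himage 3 _))) ?_
  intro y z
  obtain ⟨x, hx2, hx3, hx5⟩ : ∃ x : ℤ, x ≡ u [ZMOD 16] ∧ (x : ZMod 3) = y ∧ (x : ZMod 5) = z := by
    refine ⟨225 * u + 160 * y.val + 96 * z.val, ?_, ?_, ?_⟩
    · rw [Int.modEq_iff_dvd]; omega
    · push_cast
      rw [ZMod.natCast_zmod_val, show (225 : ZMod 3) = 0 from rfl, show (160 : ZMod 3) = 1 from rfl,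
        show (96 : ZMod 3) = 0 from rfl]
      ring
    · push_cast
      rw [ZMod.natCast_zmod_val, show (225 : ZMod 5) = 0 from rfl, show (160 : ZMod 5) = 0 from rfl,
        show (96 : ZMod 5) = 1 from rfl]
      ring
  have hcast : ∀ {n : ℕ} (M : ℕ), x ≡ r n [ZMOD (n : ℤ)] → M ∣ n →
      (x : ZMod M) = (r n : ZMod M) := fun M h hM =>
    (ZMod.intCast_eq_intCast_iff _ _ _).2 (h.of_dvd (Int.natCast_dvd_natCast.2 hM))
  obtain ⟨n, hn, hn4, hxn⟩ := hcov x
  rcases eq_of_dvd_twoForty hn hn4 with rfl | rfl | ⟨i, hi, q, hq, hiq, rfl⟩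
  · exact Or.inr (Or.inl (Finset.mem_insert.2 (Or.inl (hx5.symm.trans (hcast 5 hxn dvd_rfl)))))
  · refine Or.inr (Or.inr (Finset.mem_insert.2 (Or.inl ?_)))
    rw [← hcast 3 hxn (by norm_num), ← hcast 5 hxn (by norm_num), hx3, hx5]
  · have hhit : u % 2 ^ (i + 1) = c i q := by
      have h1 : x ≡ r (N i q) [ZMOD 2 ^ (i + 1)] :=
        hxn.of_dvd (by push_cast; exact dvd_mul_right _ _)
      have h2 : x ≡ u [ZMOD 2 ^ (i + 1)] := hx2.of_dvd (by
        rw [show (16 : ℤ) = 2 ^ 4 by norm_num]; exact pow_dvd_pow 2 (by omega))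
      have h3 : ((u % 2 ^ (i + 1) : ℕ) : ℤ) = r (N i q) % 2 ^ (i + 1) := by
        push_cast; exact h2.symm.trans h1
      simp only [c, if_neg hiq, ← h3, Int.toNat_natCast]
    have hmem : i ∈ hits q := Finset.mem_filter.2 ⟨Finset.mem_range.2 hi, hhit⟩
    have hdvd : ∀ M, M ∣ oddPart q → M ∣ 2 ^ (i + 1) * oddPart q := fun M h => h.mul_left _
    interval_cases q
    · exact absurd ⟨i, hi, hhit⟩ hrem
    · left
      refine Finset.mem_image.2 ⟨i, hmem, ?_⟩
      rw [← hx3]; exact (hcast 3 hxn (hdvd 3 (by decide))).symm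
    · right; left
      refine Finset.mem_insert_of_mem (Finset.mem_image.2 ⟨i, hmem, ?_⟩)
      rw [← hx5]; exact (hcast 5 hxn (hdvd 5 (by decide))).symm
    · right; right
      refine Finset.mem_insert_of_mem (Finset.mem_image.2 ⟨i, hmem, ?_⟩)
      rw [← hx3, ← hx5]
      exact Prod.ext (hcast 3 hxn (hdvd 3 (by decide))).symm (hcast 5 hxn (hdvd 5 (by decide))).symm

end CoveringTwoFortyDivisors

/-- If C is a distinct covering system with least modulus 4 whose moduli have lcm 2^a * 3^b * 5^c with a ≥ b ≥ c ≥ 1, and b = 1, then a ≥ 5. -/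
theorem m4_b1_implies_a_ge_five (S : Finset ℕ) (r : ℕ → ℤ) (a b c : ℕ)
    (hmod : ∀ n ∈ S, 1 < n)
    (hcov : ∀ x : ℤ, ∃ n ∈ S, x ≡ r n [ZMOD (n : ℤ)])
    (hm : 4 ∈ S) (hmin : ∀ n ∈ S, 4 ≤ n)
    (hlcm : S.lcm id = 2 ^ a * 3 ^ b * 5 ^ c)
    (ha : 1 ≤ a) (hb : 1 ≤ b) (hc : 1 ≤ c) (hab : b ≤ a) (hbc : c ≤ b)
    (hB : b = 1) :
    5 ≤ a := by
  by_contra! hlt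
  obtain rfl : c = 1 := by omega
  subst hB
  refine CoveringTwoFortyDivisors.not_cover_of_dvd_twoForty r fun x => ?_
  obtain ⟨n, hn, hx⟩ := hcov x
  refine ⟨n, ?_, hmin n hn, hx⟩
  have h1 : n ∣ 2 ^ a * 3 ^ 1 * 5 ^ 1 := hlcm ▸ Finset.dvd_lcm (f := id) hn
  have h2 : 2 ^ a * 3 ^ 1 * 5 ^ 1 ∣ 2 ^ 4 * 3 ^ 1 * 5 ^ 1 :=
    mul_dvd_mul (mul_dvd_mul (pow_dvd_pow 2 (by omega)) dvd_rfl) dvd_rfl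
  exact h1.trans (h2.trans (by norm_num))
end

section
/- If C is a distinct covering system with least modulus 5 whose moduli have least common multiple L = 2^a·3^b·5^c, where a, b, c are positive integers with a ≥ b ≥ c, and if a = 3, then b ≥ 3 and c ≥ 2. -/
/-! ### Sets of natural numbers encoded as base `256` numerals -/

/-- The numeral whose base `256` digits are the indicator function of `U`. -/
def code (U : Finset ℕ) : ℕ := ∑ x ∈ U, 256 ^ x

lemma testBit_sum_two_pow (s : Finset ℕ) (i : ℕ) :
    (∑ k ∈ s, 2 ^ k).testBit i = true ↔ i ∈ s := by
  rw [← Nat.mem_bitIndices, ← List.mem_toFinset, Finset.toFinset_bitIndices_sum_two_pow]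

lemma land_sum_two_pow (s t : Finset ℕ) :
    (∑ k ∈ s, 2 ^ k) &&& (∑ k ∈ t, 2 ^ k) = ∑ k ∈ s ∩ t, 2 ^ k := by
  refine Nat.eq_of_testBit_eq fun i => ?_
  rw [Nat.testBit_land, Bool.eq_iff_iff, Bool.and_eq_true]
  simp only [testBit_sum_two_pow, Finset.mem_inter]

lemma code_eq_sum_two_pow (U : Finset ℕ) : code U = ∑ k ∈ U.image (8 * ·), 2 ^ k := by
  rw [Finset.sum_image (by intro x _ y _ h; simpa using h)]
  simp only [code, pow_mul]
  norm_num

lemma land_code (U V : Finset ℕ) : code U &&& code V = code (U ∩ V) := by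
  simp only [code_eq_sum_two_pow, land_sum_two_pow]
  rw [Finset.image_inter _ _ (fun x y h => by simpa using h)]

lemma code_eq_zero {U : Finset ℕ} (h : code U = 0) : U = ∅ := by
  simpa [code, Finset.eq_empty_iff_forall_notMem] using h

lemma two_fifty_six_pow_modEq (x d : ℕ) : 256 ^ x ≡ 256 ^ (x % d) [MOD 256 ^ d - 1] := by
  have h : 256 ^ d ≡ 1 [MOD 256 ^ d - 1] :=
    ((Nat.modEq_iff_dvd' (Nat.one_le_pow _ _ (by norm_num))).2 dvd_rfl).symm
  conv_lhs => rw [← Nat.div_add_mod x d, pow_add, pow_mul]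
  simpa using (h.pow (x / d)).mul_right (256 ^ (x % d))

/-- Reducing the numeral of `U` modulo `256 ^ d - 1` counts the residue classes of `U` mod `d`. -/
lemma code_mod {U : Finset ℕ} {d : ℕ} (hU : U.card < 255) (hd : 0 < d) :
    code U % (256 ^ d - 1) = ∑ r ∈ Finset.range d, (U.filter (· % d = r)).card * 256 ^ r := by
  have hsum : ∑ x ∈ U, 256 ^ (x % d)
      = ∑ r ∈ Finset.range d, (U.filter (· % d = r)).card * 256 ^ r := by
    rw [← Finset.sum_fiberwise_of_maps_to (t := Finset.range d) (g := (· % d))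
      (fun x _ => Finset.mem_range.2 (Nat.mod_lt x hd))]
    refine Finset.sum_congr rfl fun r _ => ?_
    rw [Finset.sum_congr rfl (g := fun _ => 256 ^ r)
      (fun x hx => by rw [(Finset.mem_filter.1 hx).2])]
    simp
  have hmod : code U ≡ ∑ x ∈ U, 256 ^ (x % d) [MOD 256 ^ d - 1] :=
    Nat.ModEq.sum fun x _ => two_fifty_six_pow_modEq x d
  rw [hsum] at hmod
  rw [hmod]
  refine Nat.mod_eq_of_lt ?_
  have hgeom : ∑ r ∈ Finset.range d, 255 * 256 ^ r = 256 ^ d - 1 := by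
    have := Nat.geomSum_eq (m := 256) (by norm_num) d
    rw [← Finset.mul_sum, this]
    exact Nat.mul_div_cancel' (by simpa using Nat.sub_dvd_pow_sub_pow 256 1 d)
  rw [← hgeom]
  refine Finset.sum_lt_sum_of_nonempty ⟨0, Finset.mem_range.2 hd⟩ fun r _ => ?_
  exact Nat.mul_lt_mul_of_pos_right ((Finset.card_filter_le _ _).trans_lt hU) (by positivity)

/-! ### A pruned exhaustive search over residue classes -/

/-- The largest of the lowest `n` digits of `F` in base `256`. -/
def maxDigit (n F : ℕ) : ℕ :=
  Nat.rec (fun _ => 0) (fun _ ih F =>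
    (fun m k => cond (Nat.ble m k) k m) (ih (Nat.div F 256)) (Nat.mod F 256)) n F

lemma maxDigit_succ (n F : ℕ) :
    maxDigit (n + 1) F = max (maxDigit n (F / 256)) (F % 256) := by
  change cond (Nat.ble (maxDigit n (F / 256)) (F % 256)) (F % 256) (maxDigit n (F / 256)) = _
  rcases le_total (maxDigit n (F / 256)) (F % 256) with h | h
  · rw [Nat.ble_eq_true_of_le h, max_eq_right h, cond_true]
  · cases hb : Nat.ble (maxDigit n (F / 256)) (F % 256)
    · rw [cond_false, max_eq_left h]
    · rw [cond_true, max_eq_right (Nat.le_of_ble_eq_true hb)]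

lemma le_maxDigit (n : ℕ) (a : ℕ → ℕ) (ha : ∀ i, a i < 256) {i : ℕ} (hi : i < n) :
    a i ≤ maxDigit n (∑ j ∈ Finset.range n, a j * 256 ^ j) := by
  induction n generalizing a i with
  | zero => omega
  | succ n ih =>
    have hsplit : ∑ j ∈ Finset.range (n + 1), a j * 256 ^ j
        = 256 * ∑ j ∈ Finset.range n, a (j + 1) * 256 ^ j + a 0 := by
      rw [Finset.sum_range_succ', Finset.mul_sum]
      simp only [pow_succ, pow_zero, mul_one]
      congr 1
      exact Finset.sum_congr rfl fun j _ => by ring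
    have h0 := ha 0
    rw [maxDigit_succ, hsplit]
    cases i with
    | zero => exact le_max_of_le_right (by omega)
    | succ i =>
      refine le_max_of_le_left ?_
      rw [show (256 * ∑ j ∈ Finset.range n, a (j + 1) * 256 ^ j + a 0) / 256
        = ∑ j ∈ Finset.range n, a (j + 1) * 256 ^ j by omega]
      exact ih (fun j => a (j + 1)) (fun j => ha _) (by omega)

/-- An upper bound for the number of elements in one class mod `d` of the subset of `[0, N)` with
numeral `F`; it is the exact maximum when `d ≤ c`. -/
def maxClass (N c F d : ℕ) : ℕ :=
  bif Nat.ble d c then maxDigit d (Nat.mod F (Nat.sub (Nat.pow 256 d) 1)) else Nat.div N d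

def maxClassSum (N c F : ℕ) : List ℕ → ℕ
  | [] => 0
  | d :: D => Nat.add (maxClass N c F d) (maxClassSum N c F D)

/-- The numeral of the class of `r` mod `d` in `[0, N)`. -/
def classCode (N d r : ℕ) : ℕ :=
  Nat.mul (Nat.pow 256 r) (Nat.div (Nat.sub (Nat.pow 256 N) 1) (Nat.sub (Nat.pow 256 d) 1))

def removeClass (N d r F : ℕ) : ℕ := Nat.sub F (Nat.land F (classCode N d r))

def allBelow (p : ℕ → Bool) : ℕ → Bool
  | 0 => true
  | n + 1 => p n && allBelow p n

def pruned (N c a b : ℕ) (T D : List ℕ) (F : ℕ) : Bool :=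
  Nat.blt (Nat.add (Nat.mul a (maxClassSum N c F D)) (Nat.mul b (maxClassSum N c F T)))
    (Nat.mul a (Nat.mod F 255))

/-- Search for classes to the moduli in `D` whose removal from the set with numeral `F` leaves a
set `V` such that `a * |V|` is at most `b` times the size of a union of classes of `V`, one for each
modulus in `T`. The value `true` means that there are none. -/
def refute (N c a b : ℕ) (T : List ℕ) : List ℕ → ℕ → Bool
  | [], F => pruned N c a b T [] F
  | d :: D, F => pruned N c a b T (d :: D) F ||
      (refute N c a b T D F && allBelow (fun r =>
        Nat.beq (Nat.land F (classCode N d r)) 0 || refute N c a b T D (removeClass N d r F)) d)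

lemma allBelow_iff (p : ℕ → Bool) (n : ℕ) : allBelow p n = true ↔ ∀ r < n, p r = true := by
  induction n with
  | zero => simp [allBelow]
  | succ n ih => rw [allBelow, Bool.and_eq_true, ih, Nat.forall_lt_succ_right, and_comm]

lemma classCode_eq {N d r : ℕ} (hdN : d ∣ N) (hr : r < d) :
    classCode N d r = code ((Finset.range N).filter (· % d = r)) := by
  obtain ⟨q, rfl⟩ := hdN
  have himage : (Finset.range (d * q)).filter (· % d = r)
      = (Finset.range q).image (fun i => r + d * i) := by
    ext x
    simp only [Finset.mem_filter, Finset.mem_range, Finset.mem_image]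
    constructor
    · rintro ⟨hx, rfl⟩
      exact ⟨x / d, Nat.div_lt_of_lt_mul hx, Nat.mod_add_div x d⟩
    · rintro ⟨i, hi, rfl⟩
      refine ⟨?_, by simp [Nat.mod_eq_of_lt hr]⟩
      calc r + d * i < d * (i + 1) := by rw [Nat.mul_succ]; omega
        _ ≤ d * q := Nat.mul_le_mul_left d hi
  have hd : 0 < d := by omega
  have hpow : 2 ≤ 256 ^ d := (Nat.pow_le_pow_right (n := 256) (by norm_num) hd).trans' (by norm_num)
  rw [himage, code, Finset.sum_image (by
    intro x _ y _ h
    exact Nat.eq_of_mul_eq_mul_left hd (Nat.add_left_cancel h))]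
  simp only [pow_add, pow_mul, ← Finset.mul_sum, Nat.geomSum_eq hpow]
  rw [← pow_mul]
  rfl

section Soundness

variable {N d : ℕ} {U : Finset ℕ}

lemma land_classCode (hU : U ⊆ Finset.range N) (hdN : d ∣ N) {r : ℕ} (hr : r < d) :
    Nat.land (code U) (classCode N d r) = code (U.filter (· % d = r)) := by
  rw [classCode_eq hdN hr]
  change code U &&& _ = _
  rw [land_code, Finset.inter_filter, Finset.inter_eq_left.2 hU]

lemma removeClass_code (hU : U ⊆ Finset.range N) (hdN : d ∣ N) {r : ℕ} (hr : r < d) :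
    removeClass N d r (code U) = code (U.filter (· % d ≠ r)) := by
  rw [removeClass, land_classCode hU hdN hr]
  have := Finset.sum_filter_add_sum_filter_not U (· % d = r) (256 ^ ·)
  change code U - code (U.filter (· % d = r)) = code (U.filter (¬ · % d = r))
  simp only [code]
  omega

lemma card_filter_mod_le (hU : U ⊆ Finset.range N) (hdN : d ∣ N) (r : ℕ) :
    (U.filter (· % d = r)).card ≤ N / d := by
  have : (U.filter (· % d = r)).card ≤ (Finset.range (N / d)).card := by
    refine Finset.card_le_card_of_injOn (· / d) ?_ ?_
    · intro x hx
      have hx := Finset.mem_range.1 (hU (Finset.mem_filter.1 hx).1)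
      simpa using Nat.div_lt_div_of_lt_of_dvd hdN hx
    · intro x hx y hy h
      have hx := (Finset.mem_filter.1 hx).2
      have hy := (Finset.mem_filter.1 hy).2
      rw [← Nat.div_add_mod x d, ← Nat.div_add_mod y d, hx, hy, show x / d = y / d from h]
  simpa using this

lemma card_lt_of_subset_range (hN : N < 255) (hU : U ⊆ Finset.range N) : U.card < 255 :=
  (Finset.card_le_card hU).trans_lt (by simpa using hN)

lemma card_filter_le_maxClass (hN : N < 255) (hU : U ⊆ Finset.range N) (hd : 0 < d)
    (hdN : d ∣ N) (c r : ℕ) : (U.filter (· % d = r % d)).card ≤ maxClass N c (code U) d := by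
  have hcard := card_lt_of_subset_range hN hU
  rw [maxClass]
  cases Nat.ble d c
  · exact card_filter_mod_le hU hdN _
  · rw [cond_true]
    change _ ≤ maxDigit d (code U % (256 ^ d - 1))
    rw [code_mod hcard hd]
    exact le_maxDigit d (fun r => (U.filter (· % d = r)).card)
      (fun i => by have := Finset.card_filter_le U (· % d = i); omega) (Nat.mod_lt r hd)

lemma code_mod_255 (hN : N < 255) (hU : U ⊆ Finset.range N) : code U % 255 = U.card := by
  simpa [Nat.mod_one] using code_mod (card_lt_of_subset_range hN hU) one_pos

lemma sum_card_filter_le_maxClassSum (hN : N < 255) (hU : U ⊆ Finset.range N) (c : ℕ)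
    (D : List ℕ) (hD : ∀ d ∈ D, 0 < d ∧ d ∣ N) (s : ℕ → ℕ) :
    (D.map fun d => (U.filter (· % d = s d % d)).card).sum ≤ maxClassSum N c (code U) D := by
  induction D with
  | nil => simp [maxClassSum]
  | cons d D ih =>
    simp only [List.forall_mem_cons] at hD
    rw [List.map_cons, List.sum_cons]
    exact Nat.add_le_add (card_filter_le_maxClass hN hU hD.1.1 hD.1.2 c _) (ih hD.2)

lemma card_le_card_filter_add (U : Finset ℕ) (D : List ℕ) (s : ℕ → ℕ) :
    U.card ≤ (U.filter fun x => ∀ d ∈ D, x % d ≠ s d % d).card +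
      (D.map fun d => (U.filter (· % d = s d % d)).card).sum := by
  induction D with
  | nil => simp
  | cons d D ih =>
    have hsub : (U.filter fun x => ∀ e ∈ D, x % e ≠ s e % e) ⊆
        (U.filter fun x => ∀ e ∈ d :: D, x % e ≠ s e % e) ∪ U.filter (· % d = s d % d) := by
      intro x
      simp only [Finset.mem_filter, Finset.mem_union, List.forall_mem_cons]
      tauto
    have := (Finset.card_le_card hsub).trans (Finset.card_union_le _ _)
    rw [List.map_cons, List.sum_cons]
    omega

lemma lt_of_pruned {c a b : ℕ} {T D : List ℕ} (hN : N < 255) (hU : U ⊆ Finset.range N)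
    (hT : ∀ d ∈ T, 0 < d ∧ d ∣ N) (hD : ∀ d ∈ D, 0 < d ∧ d ∣ N)
    (h : pruned N c a b T D (code U) = true) (r s : ℕ → ℕ) :
    b * (T.map fun d => ((U.filter fun x => ∀ e ∈ D, x % e ≠ r e % e).filter
      (· % d = s d % d)).card).sum < a * (U.filter fun x => ∀ e ∈ D, x % e ≠ r e % e).card := by
  have hlt : a * maxClassSum N c (code U) D + b * maxClassSum N c (code U) T
      < a * (code U % 255) :=
    Nat.lt_of_succ_le (Nat.le_of_ble_eq_true h)
  rw [code_mod_255 hN hU] at hlt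
  have hcard := Nat.mul_le_mul_left a ((card_le_card_filter_add U D r).trans
    (Nat.add_le_add_left (sum_card_filter_le_maxClassSum hN hU c D hD r) _))
  have hmono : (T.map fun d => ((U.filter fun x => ∀ e ∈ D, x % e ≠ r e % e).filter
      (· % d = s d % d)).card).sum ≤ maxClassSum N c (code U) T :=
    (List.sum_le_sum fun d _ => Finset.card_le_card
      (Finset.filter_subset_filter _ (Finset.filter_subset _ _))).trans
      (sum_card_filter_le_maxClassSum hN hU c T hT s)
  have hmono := Nat.mul_le_mul_left b hmono
  rw [mul_add] at hcard
  omega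

lemma lt_of_refute {c a b : ℕ} {T D : List ℕ} (hN : N < 255) (hU : U ⊆ Finset.range N)
    (hT : ∀ d ∈ T, 0 < d ∧ d ∣ N) (hD : ∀ d ∈ D, 0 < d ∧ d ∣ N)
    (h : refute N c a b T D (code U) = true) (r s : ℕ → ℕ) :
    b * (T.map fun d => ((U.filter fun x => ∀ e ∈ D, x % e ≠ r e % e).filter
      (· % d = s d % d)).card).sum < a * (U.filter fun x => ∀ e ∈ D, x % e ≠ r e % e).card := by
  induction D generalizing U with
  | nil => exact lt_of_pruned hN hU hT hD h r s
  | cons d D ih =>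
    rw [refute, Bool.or_eq_true, Bool.and_eq_true, allBelow_iff] at h
    rcases h with h | ⟨hskip, hall⟩
    · exact lt_of_pruned hN hU hT hD h r s
    · obtain ⟨hd, hD⟩ := List.forall_mem_cons.1 hD
      have hr := Nat.mod_lt (r d) hd.1
      have hfilter : (U.filter fun x => ∀ e ∈ d :: D, x % e ≠ r e % e)
          = (U.filter (· % d ≠ r d % d)).filter fun x => ∀ e ∈ D, x % e ≠ r e % e := by
        rw [Finset.filter_filter]
        simp only [List.forall_mem_cons]
      have hall := hall _ hr
      rw [Bool.or_eq_true, Nat.beq_eq, land_classCode hU hd.2 hr,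
        removeClass_code hU hd.2 hr] at hall
      rw [hfilter]
      rcases hall with hempty | hrec
      · have hempty := Finset.filter_eq_empty_iff.1 (code_eq_zero hempty)
        rw [Finset.filter_true_of_mem (p := (· % d ≠ r d % d)) (fun x hx => hempty hx)]
        exact ih hU hD hskip
      · exact ih ((Finset.filter_subset _ _).trans hU) hD hrec

end Soundness

/-! ### Uncovered sets left by the moduli prime to `5` -/

lemma exists_uncovered {N c a b p q : ℕ} {T D : List ℕ} (hN : N < 255) (hp : 0 < p ∧ p ∣ N)
    (hq : 0 < q ∧ q ∣ N) (hT : T.toFinset = N.divisors.erase 1) (hTn : T.Nodup)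
    (hD : ∀ n ∈ N.divisors, 5 ≤ n → n = p ∨ n = q ∨ n ∈ D) (hDN : ∀ d ∈ D, 0 < d ∧ d ∣ N)
    (h : refute N c a b T D (removeClass N q 0 (removeClass N p 0 (classCode N 1 0))) = true)
    {ρ : ℕ → ℕ} (hρp : ρ p % p = 0) (hρq : ρ q % q = 0) :
    ∃ U ⊆ Finset.range N, (∀ x ∈ U, ∀ n ∈ N.divisors, 5 ≤ n → x % n ≠ ρ n % n) ∧
      ∀ s : ℕ → ℕ, b * ∑ d ∈ N.divisors.erase 1, (U.filter (· % d = s d % d)).card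
        < a * U.card := by
  have hall : (Finset.range N).filter (· % 1 = 0) = Finset.range N :=
    Finset.filter_true_of_mem fun x _ => Nat.mod_one x
  set V := ((Finset.range N).filter (· % p ≠ 0)).filter (· % q ≠ 0) with hV
  have hVN : V ⊆ Finset.range N := (Finset.filter_subset _ _).trans (Finset.filter_subset _ _)
  rw [classCode_eq (one_dvd N) one_pos, hall, removeClass_code subset_rfl hp.2 hp.1,
    removeClass_code (Finset.filter_subset _ _) hq.2 hq.1] at h
  have hTN : ∀ d ∈ T, 0 < d ∧ d ∣ N := fun d hd => by
    have hd : d ∈ N.divisors := Finset.mem_of_mem_erase (hT ▸ List.mem_toFinset.2 hd)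
    exact ⟨Nat.pos_of_mem_divisors hd, Nat.dvd_of_mem_divisors hd⟩
  refine ⟨V.filter fun x => ∀ e ∈ D, x % e ≠ ρ e % e, (Finset.filter_subset _ _).trans hVN,
    ?_, fun s => ?_⟩
  · intro x hx n hn hn5
    simp only [hV, Finset.mem_filter] at hx
    rcases hD n hn hn5 with rfl | rfl | hnD
    · rw [hρp]; exact hx.1.1.2
    · rw [hρq]; exact hx.1.2
    · exact hx.2 n hnD
  · rw [← hT, List.sum_toFinset _ hTn]
    exact lt_of_refute hN hVN hTN hDN h ρ s

set_option maxRecDepth 100000 in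
lemma exists_uncovered_216 {ρ : ℕ → ℕ} (h8 : ρ 8 % 8 = 0) (h27 : ρ 27 % 27 = 0) :
    ∃ U ⊆ Finset.range 216, (∀ x ∈ U, ∀ n ∈ Nat.divisors 216, 5 ≤ n → x % n ≠ ρ n % n) ∧
      ∀ s : ℕ → ℕ, 1 * ∑ d ∈ (Nat.divisors 216).erase 1, (U.filter (· % d = s d % d)).card
        < 4 * U.card :=
  exists_uncovered (c := 24) (T := [2, 3, 4, 6, 8, 9, 12, 18, 24, 27, 36, 54, 72, 108, 216])
    (D := [6, 9, 12, 18, 24, 36, 54, 72, 108, 216]) (by norm_num) (by norm_num) (by norm_num)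
    (by decide +kernel) (by decide) (by decide +kernel) (by decide) (by decide +kernel) h8 h27

set_option maxRecDepth 100000 in
lemma exists_uncovered_72 {ρ : ℕ → ℕ} (h8 : ρ 8 % 8 = 0) (h9 : ρ 9 % 9 = 0) :
    ∃ U ⊆ Finset.range 72, (∀ x ∈ U, ∀ n ∈ Nat.divisors 72, 5 ≤ n → x % n ≠ ρ n % n) ∧
      ∀ s : ℕ → ℕ, 5 * ∑ d ∈ (Nat.divisors 72).erase 1, (U.filter (· % d = s d % d)).card
        < 16 * U.card :=
  exists_uncovered (c := 18) (T := [2, 3, 4, 6, 8, 9, 12, 18, 24, 36, 72])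
    (D := [6, 12, 18, 24, 36, 72]) (by norm_num) (by norm_num) (by norm_num)
    (by decide +kernel) (by decide) (by decide +kernel) (by decide) (by decide +kernel) h8 h9

/-! ### Counting over the residue classes mod `5` and `25` -/

lemma exists_eq_five_pow_mul {N k n : ℕ} (hN : N ≠ 0) (hn : n ∣ N * 5 ^ k) :
    ∃ i ≤ k, ∃ d ∈ N.divisors, n = 5 ^ i * d := by
  obtain ⟨d, e, hd, he, rfl⟩ := (Nat.dvd_mul).1 hn
  obtain ⟨i, hi, rfl⟩ := (Nat.dvd_prime_pow Nat.prime_five).1 he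
  exact ⟨i, hi, d, Nat.mem_divisors.2 ⟨hd, hN⟩, mul_comm _ _⟩

lemma add_mul_mod_of_dvd {d N : ℕ} (hd : d ∣ N) (x k : ℕ) : (x + N * k) % d = x % d := by
  simp [Nat.add_mod, Nat.mod_eq_zero_of_dvd (hd.mul_right k)]

lemma mod_eq_of_mul_mod_eq {y s m d : ℕ} (h : y % (m * d) = s % (m * d)) :
    y % m = s % m ∧ y % d = s % d :=
  ⟨Nat.ModEq.of_mul_right d h, Nat.ModEq.of_mul_left m h⟩

lemma not_cover_1080 {ρ : ℕ → ℕ} (h8 : ρ 8 % 8 = 0) (h27 : ρ 27 % 27 = 0)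
    (hcov : ∀ y : ℕ, ∃ n, n ∣ 216 * 5 ^ 1 ∧ 5 ≤ n ∧ y % n = ρ n % n) : False := by
  obtain ⟨U, hUN, hU, hlt⟩ := exists_uncovered_216 h8 h27
  have hlt := hlt fun d => ρ (5 * d)
  set T := (Nat.divisors 216).erase 1
  set J := (Finset.range 5).erase (ρ 5 % 5) with hJ
  have hJcard : J.card = 4 := by
    rw [Finset.card_erase_of_mem (Finset.mem_range.2 (Nat.mod_lt _ (by norm_num)))]; rfl
  have hsub : U ×ˢ J ⊆
      T.biUnion fun d => (U.filter (· % d = ρ (5 * d) % d)) ×ˢ {ρ (5 * d) % 5} := by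
    rintro ⟨x, j⟩ hxj
    obtain ⟨hx, hj⟩ := Finset.mem_product.1 hxj
    simp only [hJ, Finset.mem_erase, Finset.mem_range] at hx hj
    have hxN := Finset.mem_range.1 (hUN hx)
    obtain ⟨n, hn, hn5, hy⟩ := hcov (x + 216 * (j + 4 * x))
    have hy5 : (x + 216 * (j + 4 * x)) % 5 = j := by omega
    have hyd : ∀ d ∈ Nat.divisors 216, (x + 216 * (j + 4 * x)) % d = x % d := fun d hd =>
      add_mul_mod_of_dvd (Nat.dvd_of_mem_divisors hd) _ _
    obtain ⟨i, hi, d, hd, rfl⟩ := exists_eq_five_pow_mul (by norm_num) hn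
    interval_cases i
    · rw [pow_zero, one_mul] at hy hn5
      exact absurd ((hyd d hd).symm.trans hy) (hU x hx d hd hn5)
    · rw [pow_one] at hy
      obtain ⟨hj', hx'⟩ := mod_eq_of_mul_mod_eq hy
      rw [hy5] at hj'
      rw [hyd d hd] at hx'
      refine Finset.mem_biUnion.2 ⟨d, Finset.mem_erase.2 ⟨?_, hd⟩, ?_⟩
      · rintro rfl
        exact hj.1 hj'
      · simp [hx, hx', hj']
  have hcard := (Finset.card_le_card hsub).trans Finset.card_biUnion_le
  simp only [Finset.card_product, hJcard, Finset.card_singleton, mul_one] at hcard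
  omega

lemma not_cover_1800 {ρ : ℕ → ℕ} (h8 : ρ 8 % 8 = 0) (h9 : ρ 9 % 9 = 0)
    (hcov : ∀ y : ℕ, ∃ n, n ∣ 72 * 5 ^ 2 ∧ 5 ≤ n ∧ y % n = ρ n % n) : False := by
  obtain ⟨U, hUN, hU, hlt⟩ := exists_uncovered_72 h8 h9
  set T := (Nat.divisors 72).erase 1
  set A : ℕ → Finset ℕ := fun d => U.filter (· % d = ρ (5 * d) % d)
  set C : ℕ → Finset ℕ := fun d => U.filter (· % d = ρ (25 * d) % d)
  have hlt5 : 5 * ∑ d ∈ T, (A d).card < 16 * U.card := hlt fun d => ρ (5 * d)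
  have hlt25 : 5 * ∑ d ∈ T, (C d).card < 16 * U.card := hlt fun d => ρ (25 * d)
  have hρ5 : ρ 5 % 5 < 5 := Nat.mod_lt _ (by norm_num)
  have hρ25 : ρ 25 % 25 < 25 := Nat.mod_lt _ (by norm_num)
  let fiber : ℕ → Finset ℕ := fun j => (Finset.range 25).filter (· % 5 = j)
  have hfiber : ∀ j < 5, (fiber j).card = 5 := by decide
  -- each pair of a point of `U` and a class mod `25` is met by a modulus `5 * d` or `25 * d`
  have hmeet : ∀ x ∈ U, ∀ k < 25, k % 5 ≠ ρ 5 % 5 →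
      (∃ d ∈ T, x ∈ A d ∧ k % 5 = ρ (5 * d) % 5) ∨
      (∃ d ∈ T, x ∈ C d ∧ k = ρ (25 * d) % 25) ∨ k = ρ 25 % 25 := by
    intro x hx k hk hk5
    obtain ⟨n, hn, hn5, hy⟩ := hcov (x + 72 * (8 * (k + 24 * x)))
    have hy25 : (x + 72 * (8 * (k + 24 * x))) % 25 = k := by omega
    have hy5 : (x + 72 * (8 * (k + 24 * x))) % 5 = k % 5 := by omega
    have hyd : ∀ d ∈ Nat.divisors 72, (x + 72 * (8 * (k + 24 * x))) % d = x % d := fun d hd =>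
      add_mul_mod_of_dvd (Nat.dvd_of_mem_divisors hd) _ _
    obtain ⟨i, hi, d, hd, rfl⟩ := exists_eq_five_pow_mul (by norm_num) hn
    have hdT : d = 1 ∨ d ∈ T := or_iff_not_imp_left.2 fun h => Finset.mem_erase.2 ⟨h, hd⟩
    interval_cases i
    · rw [pow_zero, one_mul] at hy hn5
      exact absurd ((hyd d hd).symm.trans hy) (hU x hx d hd hn5)
    · rw [pow_one] at hy
      obtain ⟨hk', hx'⟩ := mod_eq_of_mul_mod_eq hy
      rw [hy5] at hk'
      rw [hyd d hd] at hx'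
      rcases hdT with rfl | hdT
      · exact absurd hk' hk5
      · exact Or.inl ⟨d, hdT, Finset.mem_filter.2 ⟨hx, hx'⟩, hk'⟩
    · rw [show 5 ^ 2 = 25 by norm_num] at hy
      obtain ⟨hk', hx'⟩ := mod_eq_of_mul_mod_eq hy
      rw [hy25] at hk'
      rw [hyd d hd] at hx'
      rcases hdT with rfl | hdT
      · exact Or.inr (Or.inr hk')
      · exact Or.inr (Or.inl ⟨d, hdT, Finset.mem_filter.2 ⟨hx, hx'⟩, hk'⟩)
  set E := (T.filter fun d => ρ 25 % 25 % 5 = ρ (5 * d) % 5).biUnion A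
  have hEU : E ⊆ U := Finset.biUnion_subset.2 fun d _ => Finset.filter_subset _ _
  have hEcard := Finset.card_sdiff_add_card_eq_card hEU
  have hA5 : (T.biUnion fun d => A d ×ˢ fiber (ρ (5 * d) % 5)).card ≤ 5 * ∑ d ∈ T, (A d).card := by
    refine Finset.card_biUnion_le.trans ?_
    rw [Finset.mul_sum]
    refine Finset.sum_le_sum fun d _ => ?_
    rw [Finset.card_product, hfiber _ (Nat.mod_lt _ (by norm_num)), mul_comm]
  have hC25 : (T.biUnion fun d => C d ×ˢ {ρ (25 * d) % 25}).card ≤ ∑ d ∈ T, (C d).card := by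
    refine Finset.card_biUnion_le.trans (Finset.sum_le_sum fun d _ => ?_)
    simp
  set K := (Finset.range 25).filter (· % 5 ≠ ρ 5 % 5) with hK
  have hKcard : K.card = 20 := by
    have := Finset.card_filter_add_card_filter_not (s := Finset.range 25) (· % 5 = ρ 5 % 5)
    have h5 : ((Finset.range 25).filter (· % 5 = ρ 5 % 5)).card = 5 := hfiber _ hρ5
    rw [h5, Finset.card_range] at this
    simp only [hK, ne_eq]
    omega
  have htotal : U ×ˢ K ⊆ (T.biUnion fun d => A d ×ˢ fiber (ρ (5 * d) % 5)) ∪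
      (T.biUnion fun d => C d ×ˢ {ρ (25 * d) % 25}) ∪ (U \ E) ×ˢ {ρ 25 % 25} := by
    rintro ⟨x, k⟩ hxk
    obtain ⟨hx, hk⟩ := Finset.mem_product.1 hxk
    simp only [hK, Finset.mem_filter, Finset.mem_range] at hx hk
    have hmem : ∀ d ∈ T, x ∈ A d → k % 5 = ρ (5 * d) % 5 →
        (x, k) ∈ T.biUnion fun d => A d ×ˢ fiber (ρ (5 * d) % 5) := fun d hd hxA hkd =>
      Finset.mem_biUnion.2 ⟨d, hd, Finset.mem_product.2 ⟨hxA,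
        Finset.mem_filter.2 ⟨Finset.mem_range.2 hk.1, hkd⟩⟩⟩
    simp only [Finset.mem_union]
    rcases hmeet x hx k hk.1 hk.2 with ⟨d, hd, hxA, hkd⟩ | ⟨d, hd, hxC, hkd⟩ | hk25
    · exact Or.inl (Or.inl (hmem d hd hxA hkd))
    · exact Or.inl (Or.inr (Finset.mem_biUnion.2 ⟨d, hd, by simp [hxC, hkd]⟩))
    · by_cases hxE : x ∈ E
      · obtain ⟨d, hd, hxA⟩ := Finset.mem_biUnion.1 hxE
        obtain ⟨hd, hkd⟩ := Finset.mem_filter.1 hd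
        exact Or.inl (Or.inl (hmem d hd hxA (hk25 ▸ hkd)))
      · exact Or.inr (by simp [hx, hxE, hk25])
  have htotal := (Finset.card_le_card htotal).trans ((Finset.card_union_le _ _).trans
    (Nat.add_le_add_right (Finset.card_union_le _ _) _))
  rw [Finset.card_product, Finset.card_product, hKcard, Finset.card_singleton] at htotal
  by_cases hk0 : ρ 25 % 25 % 5 = ρ 5 % 5
  · have hsub : U ×ˢ K ⊆ (T.biUnion fun d => A d ×ˢ fiber (ρ (5 * d) % 5)) ∪
        (T.biUnion fun d => C d ×ˢ {ρ (25 * d) % 25}) := by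
      rintro ⟨x, k⟩ hxk
      obtain ⟨hx, hk⟩ := Finset.mem_product.1 hxk
      simp only [hK, Finset.mem_filter, Finset.mem_range] at hx hk
      rcases hmeet x hx k hk.1 hk.2 with ⟨d, hd, hxA, hkd⟩ | ⟨d, hd, hxC, hkd⟩ | hk25
      · exact Finset.mem_union_left _ (Finset.mem_biUnion.2 ⟨d, hd, Finset.mem_product.2 ⟨hxA,
          Finset.mem_filter.2 ⟨Finset.mem_range.2 hk.1, hkd⟩⟩⟩)
      · exact Finset.mem_union_right _ (Finset.mem_biUnion.2 ⟨d, hd, by simp [hxC, hkd]⟩)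
      · exact absurd (hk25 ▸ hk0) hk.2
    have hsub := (Finset.card_le_card hsub).trans (Finset.card_union_le _ _)
    rw [Finset.card_product, hKcard] at hsub
    omega
  · have hsub : (U \ E) ×ˢ (fiber (ρ 25 % 25 % 5)).erase (ρ 25 % 25) ⊆
        T.biUnion fun d => C d ×ˢ {ρ (25 * d) % 25} := by
      rintro ⟨x, k⟩ hxk
      simp only [fiber, Finset.mem_product, Finset.mem_sdiff, Finset.mem_erase,
        Finset.mem_filter, Finset.mem_range] at hxk
      obtain ⟨⟨hx, hxE⟩, hk25, hk, hk5⟩ := hxk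
      rcases hmeet x hx k hk (hk5 ▸ hk0) with ⟨d, hd, hxA, hkd⟩ | ⟨d, hd, hxC, hkd⟩ | hk25'
      · exact absurd (Finset.mem_biUnion.2
          ⟨d, Finset.mem_filter.2 ⟨hd, hk5 ▸ hkd⟩, hxA⟩) hxE
      · exact Finset.mem_biUnion.2 ⟨d, hd, by simp [hxC, hkd]⟩
      · exact absurd hk25' hk25
    have hsub := (Finset.card_le_card hsub).trans hC25
    have hmem : ρ 25 % 25 ∈ fiber (ρ 25 % 25 % 5) :=
      Finset.mem_filter.2 ⟨Finset.mem_range.2 hρ25, rfl⟩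
    rw [Finset.card_product, Finset.card_erase_of_mem hmem, hfiber _ (Nat.mod_lt _ (by norm_num))] at hsub
    omega

/-- After a translation, a covering system is a covering of `ℕ` by residue classes in which two
prescribed coprime moduli have residue `0`. -/
lemma exists_nat_residues {S : Finset ℕ} {r : ℕ → ℤ} (hS : ∀ n ∈ S, 1 < n)
    (hcov : ∀ x : ℤ, ∃ n ∈ S, x ≡ r n [ZMOD (n : ℤ)]) {p q : ℕ} (hpq : p.Coprime q)
    (hp : p ≠ 0) (hq : q ≠ 0) :
    ∃ ρ : ℕ → ℕ, (∀ y : ℕ, ∃ n ∈ S, y % n = ρ n % n) ∧ ρ p % p = 0 ∧ ρ q % q = 0 := by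
  obtain ⟨t, htp, htq⟩ := Nat.chineseRemainder hpq (r p % p).toNat (r q % q).toNat
  have hzero : ∀ {m : ℕ}, m ≠ 0 → t ≡ (r m % m).toNat [MOD m] →
      ((r m - t) % m).toNat % m = 0 := by
    intro m hm ht
    have hm' : (m : ℤ) ≠ 0 := by exact_mod_cast hm
    have ht := Int.natCast_modEq_iff.2 ht
    rw [Int.toNat_of_nonneg (Int.emod_nonneg _ hm')] at ht
    rw [Int.emod_eq_zero_of_dvd (ht.trans (Int.mod_modEq _ _)).dvd]
    simp
  refine ⟨fun n => ((r n - t) % n).toNat, fun y => ?_, hzero hp htp, hzero hq htq⟩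
  obtain ⟨n, hn, hy⟩ := hcov (y + t)
  refine ⟨n, hn, ?_⟩
  have hn0 : (n : ℤ) ≠ 0 := by have := hS n hn; positivity
  have hy' : (y : ℤ) ≡ r n - t [ZMOD n] := by simpa using hy.sub_right (t : ℤ)
  zify
  rw [Int.toNat_of_nonneg (Int.emod_nonneg _ hn0), Int.emod_emod]
  exact hy'

/-- If C is a distinct covering system with least modulus 5 whose moduli have lcm 2^a * 3^b * 5^c with a ≥ b ≥ c ≥ 1, and a = 3, then b ≥ 3 and c ≥ 2. -/
theorem m5_a3_implies_b_ge_three_c_ge_two (S : Finset ℕ) (r : ℕ → ℤ) (a b c : ℕ)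
    (hmod : ∀ n ∈ S, 1 < n)
    (hcov : ∀ x : ℤ, ∃ n ∈ S, x ≡ r n [ZMOD (n : ℤ)])
    (hm : 5 ∈ S) (hmin : ∀ n ∈ S, 5 ≤ n)
    (hlcm : S.lcm id = 2 ^ a * 3 ^ b * 5 ^ c)
    (ha : 1 ≤ a) (hb : 1 ≤ b) (hc : 1 ≤ c) (hab : b ≤ a) (hbc : c ≤ b)
    (hA : a = 3) :
    3 ≤ b ∧ 2 ≤ c := by
  subst hA
  have hdvd : ∀ n ∈ S, n ∣ 2 ^ 3 * 3 ^ b * 5 ^ c := fun n hn => hlcm ▸ Finset.dvd_lcm hn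
  by_contra hcon
  rcases (by omega : b ≤ 2 ∨ c ≤ 1) with hb2 | hc1
  · obtain ⟨ρ, hρ, h8, h9⟩ := exists_nat_residues hmod hcov (p := 8) (q := 9) (by norm_num)
      (by norm_num) (by norm_num)
    refine not_cover_1800 h8 h9 fun y => ?_
    obtain ⟨n, hn, hy⟩ := hρ y
    exact ⟨n, (hdvd n hn).trans (mul_dvd_mul (mul_dvd_mul_left _ (pow_dvd_pow 3 hb2))
      (pow_dvd_pow 5 (hbc.trans hb2))), hmin n hn, hy⟩
  · obtain ⟨ρ, hρ, h8, h27⟩ := exists_nat_residues hmod hcov (p := 8) (q := 27) (by norm_num)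
      (by norm_num) (by norm_num)
    refine not_cover_1080 h8 h27 fun y => ?_
    obtain ⟨n, hn, hy⟩ := hρ y
    exact ⟨n, (hdvd n hn).trans (mul_dvd_mul (mul_dvd_mul_left _ (pow_dvd_pow 3 hab))
      (pow_dvd_pow 5 hc1)), hmin n hn, hy⟩
end

section
/- There exists a distinct covering system with least modulus 5 whose moduli have least common multiple equal to 2^3·3^3·5^2 = 5400 and in which no modulus is a multiple of 675. -/
/-- The congruences of the covering system, as pairs `(modulus, residue)`. -/
def congruences5400 : List (ℕ × ℕ) :=
  [ (5, 3), (6, 0), (8, 3), (9, 7), (10, 1), (12, 2), (15, 14), (18, 4),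
    (20, 17), (24, 8), (25, 10), (27, 10), (30, 9), (36, 32), (40, 7), (45, 19),
    (50, 45), (54, 28), (60, 45), (72, 44), (75, 50), (90, 49), (100, 5), (108, 46),
    (120, 15), (135, 100), (150, 65), (180, 92), (200, 55), (216, 208), (225, 175), (270, 55),
    (300, 80), (360, 236), (450, 265), (540, 532), (600, 265), (900, 20), (1080, 316), (1800, 740) ]

/-- The moduli of the covering system. -/
def moduli5400 : Finset ℕ := (congruences5400.map Prod.fst).toFinset

/-- The residue attached to a modulus, with value `0` outside `moduli5400`. -/
def residue5400 (n : ℕ) : ℕ := (congruences5400.lookup n).getD 0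

theorem exists_mod_eq_of_lt_5400 (x : ℕ) (hx : x < 5400) :
    ∃ c ∈ congruences5400, x % c.1 = c.2 := by
  -- Two short ranges in place of one long one keep the kernel's recursion shallow.
  have h : ∀ q < 72, ∀ s < 75, ∃ c ∈ congruences5400, (75 * q + s) % c.1 = c.2 := by
    decide +kernel
  simpa only [Nat.div_add_mod] using h (x / 75) (by omega) (x % 75) (by omega)

theorem residue5400_eq : ∀ c ∈ congruences5400, residue5400 c.1 = c.2 := by
  decide +kernel

theorem dvd_5400_of_mem_moduli5400 : ∀ n ∈ moduli5400, n ∣ 5400 := by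
  decide +kernel

theorem exists_modEq_residue5400 (x : ℤ) :
    ∃ n ∈ moduli5400, x ≡ (residue5400 n : ℤ) [ZMOD (n : ℤ)] := by
  obtain ⟨y, hy⟩ := Int.eq_ofNat_of_zero_le (Int.emod_nonneg x (by norm_num : (5400 : ℤ) ≠ 0))
  have hlt : y < 5400 := by omega
  obtain ⟨c, hc, hmod⟩ := exists_mod_eq_of_lt_5400 y hlt
  have hmem : c.1 ∈ moduli5400 := List.mem_toFinset.2 (List.mem_map_of_mem hc)
  have hdvd : (c.1 : ℤ) ∣ 5400 := by exact_mod_cast dvd_5400_of_mem_moduli5400 c.1 hmem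
  refine ⟨c.1, hmem, ?_⟩
  have hxy : x ≡ (y : ℤ) [ZMOD (c.1 : ℤ)] := by
    rw [← hy]
    exact ((Int.mod_modEq x 5400).of_dvd hdvd).symm
  rw [residue5400_eq c hc, ← hmod, Int.natCast_mod]
  exact hxy.trans (Int.mod_modEq _ _).symm


/-- There exists a distinct covering system with least modulus 5, lcm of moduli 2^3 * 3^3 * 5^2 = 5400, in which no modulus is a multiple of 675. -/
theorem exists_covering_m5_L5400_no_mult675 :
    ∃ (S : Finset ℕ) (r : ℕ → ℤ),
      (∀ n ∈ S, 1 < n) ∧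
      (∀ x : ℤ, ∃ n ∈ S, x ≡ r n [ZMOD (n : ℤ)]) ∧
      (5 ∈ S ∧ ∀ n ∈ S, 5 ≤ n) ∧
      S.lcm id = 2 ^ 3 * 3 ^ 3 * 5 ^ 2 ∧
      (∀ n ∈ S, ¬ 675 ∣ n) := by
  refine ⟨moduli5400, fun n => (residue5400 n : ℤ), ?_, exists_modEq_residue5400, ?_, ?_, ?_⟩ <;>
    decide +kernel
end
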